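/- arXiv:2211.06311 — 7 statements merged into one kernel-verified Lean document; each statement's English description precedes it below -/
import Mathlib

section
/- Let 1 ≤ p < ∞. There exists a constant C, depending only on d, p and φ, such that the following holds. Let 0 < h₁ < 1/4 and 0 < h < 1/2 with h₁ ≤ h, and let f₁, f₂, g₁, g₂ : ℝ^d → ℝ^d be measurable maps satisfying |x − f_i(x)| ≤ h₁ and |x − g_i(x)| ≤ h₁ for all x ∈ ℝ^d and i = 1,2. Then for all measurable u, v : ℝ^d → ℝ: ∫∫_{ℝ^d×ℝ^d} K^h(g₁(x) − g₂(y)) |u(x) − v(y)|^p dx dy ≤ (1 + C·h₁/h) ∫∫_{ℝ^d×ℝ^d} K^h(f₁(x) − f₂(y)) |u(x) − v(y)|^p dx dy, where both double integrals are interpreted in [0,∞]. -/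
open MeasureTheory
open scoped ENNReal

lemma kpe_three (p : ℝ) (hp : 1 ≤ p) (a b c : ℝ) :
    |a + b + c| ^ p ≤ 3 ^ p * (|a| ^ p + |b| ^ p + |c| ^ p) := by
  have hp0 : 0 ≤ p := by linarith
  have key : ∀ m : ℝ, 0 ≤ m → |a| ≤ m → |b| ≤ m → |c| ≤ m → |a + b + c| ^ p ≤ 3 ^ p * m ^ p := by
    intro m hm h1 h2 h3
    rw [← Real.mul_rpow (by norm_num) hm]
    apply Real.rpow_le_rpow (abs_nonneg _) _ hp0
    have := abs_add_three a b c
    linarith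
  have ha := Real.rpow_nonneg (abs_nonneg a) p
  have hb := Real.rpow_nonneg (abs_nonneg b) p
  have hc := Real.rpow_nonneg (abs_nonneg c) p
  have h3 : (0:ℝ) ≤ 3 ^ p := Real.rpow_nonneg (by norm_num) p
  rcases le_total |a| |b| with h | h <;> rcases le_total |b| |c| with h' | h' <;>
    rcases le_total |a| |c| with h'' | h''
  all_goals first
    | exact (key |a| (abs_nonneg _) le_rfl (by linarith) (by linarith)).trans
        (mul_le_mul_of_nonneg_left (by linarith) h3)
    | exact (key |b| (abs_nonneg _) (by linarith) le_rfl (by linarith)).trans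
        (mul_le_mul_of_nonneg_left (by linarith) h3)
    | exact (key |c| (abs_nonneg _) (by linarith) (by linarith) le_rfl).trans
        (mul_le_mul_of_nonneg_left (by linarith) h3)

lemma kpe_pow (d : ℕ) (t : ℝ) (h0 : 0 ≤ t) (h1 : t ≤ 1) : (1 + 4 * t) ^ d ≤ 1 + 5 ^ d * t := by
  have key : (1 + 4 * t) ^ d ≤ 1 + (5 ^ d - 1) * t := by
    induction d with
    | zero => simp
    | succ n ih =>
      rw [pow_succ, pow_succ]
      have h5 : (1:ℝ) ≤ 5 ^ n := one_le_pow₀ (by norm_num)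
      have : (1 + 4 * t) ^ n * (1 + 4 * t) ≤ (1 + (5 ^ n - 1) * t) * (1 + 4 * t) :=
        mul_le_mul_of_nonneg_right ih (by linarith)
      nlinarith [mul_nonneg (mul_nonneg h0 (sub_nonneg.2 h1)) (sub_nonneg.2 h5)]
  linarith

section
variable {d : ℕ}
local notation "E" => EuclideanSpace ℝ (Fin d)

/-- Correlation function. -/
noncomputable def kpeF (p : ℝ) (u v : EuclideanSpace ℝ (Fin d) → ℝ)
    (z : EuclideanSpace ℝ (Fin d)) : ℝ≥0∞ :=
  ∫⁻ x, ENNReal.ofReal (|u x - v (x + z)| ^ p)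

lemma kpe_F_meas (p : ℝ) (u v : E → ℝ) (hu : Measurable u) (hv : Measurable v) :
    Measurable (kpeF p u v) := by
  unfold kpeF
  apply Measurable.lintegral_prod_right'
    (f := fun q : E × E => ENNReal.ofReal (|u q.2 - v (q.2 + q.1)| ^ p))
  fun_prop

lemma kpe_F_three (p : ℝ) (hp : 1 ≤ p) (u v : E → ℝ) (hu : Measurable u) (hv : Measurable v)
    (a b c : E) : kpeF p u v (a - b + c) ≤
      ENNReal.ofReal (3 ^ p) * (kpeF p u v a + kpeF p u v b + kpeF p u v c) := by
  have hb : kpeF p u v b = ∫⁻ x, ENNReal.ofReal (|u (x + (a - b)) - v (x + a)| ^ p) := by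
    unfold kpeF
    rw [← lintegral_add_right_eq_self _ (a - b)]
    congr 1; ext x
    rw [show x + (a - b) + b = x + a by abel]
  have hc : kpeF p u v c =
      ∫⁻ x, ENNReal.ofReal (|u (x + (a - b)) - v (x + (a - b + c))| ^ p) := by
    unfold kpeF
    rw [← lintegral_add_right_eq_self _ (a - b)]
    congr 1; ext x
    rw [show x + (a - b) + c = x + (a - b + c) by abel]
  rw [hb, hc]
  unfold kpeF
  rw [← lintegral_add_left (by fun_prop), ← lintegral_add_left (by fun_prop),
    ← lintegral_const_mul _ (by fun_prop)]
  apply lintegral_mono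
  intro x
  have n1 := Real.rpow_nonneg (abs_nonneg (u x - v (x + a))) p
  have n2 := Real.rpow_nonneg (abs_nonneg (u (x + (a - b)) - v (x + a))) p
  have n3 := Real.rpow_nonneg (abs_nonneg (u (x + (a - b)) - v (x + (a - b + c)))) p
  dsimp only
  rw [← ENNReal.ofReal_add n1 n2, ← ENNReal.ofReal_add (by positivity) n3,
    ← ENNReal.ofReal_mul (by positivity)]
  apply ENNReal.ofReal_le_ofReal
  have := kpe_three p hp (u x - v (x + a)) (-(u (x + (a - b)) - v (x + a)))
    (u (x + (a - b)) - v (x + (a - b + c)))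
  rw [abs_neg] at this
  convert this using 3
  ring

lemma kpe_G (p : ℝ) (hp : 1 ≤ p) (u v : E → ℝ) (hu : Measurable u) (hv : Measurable v) (z : E) :
    kpeF p u v z + kpeF p u v (-z) ≤ ENNReal.ofReal (3 ^ p * 3) *
      (kpeF p u v ((1/3 : ℝ) • z) + kpeF p u v (-((1/3 : ℝ) • z))) := by
  have h1 := kpe_F_three p hp u v hu hv ((1/3 : ℝ) • z) (-((1/3 : ℝ) • z)) ((1/3 : ℝ) • z)
  have h2 := kpe_F_three p hp u v hu hv (-((1/3 : ℝ) • z)) ((1/3 : ℝ) • z) (-((1/3 : ℝ) • z))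
  have e1 : (1/3 : ℝ) • z - (-((1/3 : ℝ) • z)) + (1/3 : ℝ) • z = z := by module
  have e2 : -((1/3 : ℝ) • z) - (1/3 : ℝ) • z + -((1/3 : ℝ) • z) = -z := by module
  rw [e1] at h1
  rw [e2] at h2
  refine (add_le_add h1 h2).trans (le_of_eq ?_)
  rw [ENNReal.ofReal_mul (by positivity), ENNReal.ofReal_ofNat]
  ring

lemma kpe_G9 (p : ℝ) (hp : 1 ≤ p) (u v : E → ℝ) (hu : Measurable u) (hv : Measurable v) (z : E) :
    kpeF p u v z ≤ ENNReal.ofReal ((3 ^ p * 3) * (3 ^ p * 3)) *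
      (kpeF p u v ((1/9 : ℝ) • z) + kpeF p u v (-((1/9 : ℝ) • z))) := by
  have h1 := kpe_G p hp u v hu hv z
  have h2 := kpe_G p hp u v hu hv ((1/3 : ℝ) • z)
  rw [smul_smul, show (1/3 * (1/3) : ℝ) = 1/9 by norm_num] at h2
  refine le_self_add.trans (h1.trans ?_)
  rw [ENNReal.ofReal_mul (p := 3 ^ p * 3) (q := 3 ^ p * 3) (by positivity), mul_assoc]
  exact mul_le_mul_right h2 _

/-- Ball-localised double integral. -/
noncomputable def kpeA (p : ℝ) (u v : EuclideanSpace ℝ (Fin d) → ℝ) (r : ℝ) : ℝ≥0∞ :=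
  ∫⁻ x, ∫⁻ y, (Metric.closedBall (0 : EuclideanSpace ℝ (Fin d)) r).indicator 1 (y - x) *
    ENNReal.ofReal (|u x - v y| ^ p)

lemma kpe_A_eq (p : ℝ) (u v : E → ℝ) (hu : Measurable u) (hv : Measurable v) (r : ℝ) :
    kpeA p u v r = ∫⁻ z, (Metric.closedBall (0 : E) r).indicator 1 z * kpeF p u v z := by
  have hm : Measurable ((Metric.closedBall (0 : E) r).indicator (1 : E → ℝ≥0∞)) :=
    measurable_one.indicator Metric.isClosed_closedBall.measurableSet
  have : kpeA p u v r = ∫⁻ x, ∫⁻ z, (Metric.closedBall (0 : E) r).indicator 1 z *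
    ENNReal.ofReal (|u x - v (x + z)| ^ p) := by
    unfold kpeA
    congr 1; ext x
    rw [← lintegral_add_left_eq_self _ x]
    simp only [add_sub_cancel_left]
  rw [this, lintegral_lintegral_swap (by fun_prop)]
  congr 1; ext z
  rw [lintegral_const_mul _ (by fun_prop)]
  rfl

lemma kpe_scale (f : E → ℝ≥0∞) (hf : Measurable f) :
    ∫⁻ z, f ((1/9 : ℝ) • z) = ENNReal.ofReal (9 ^ d) * ∫⁻ z, f z := by
  rw [← lintegral_map (μ := volume) (g := fun z : E => (1/9 : ℝ) • z) hf (by fun_prop),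
    Measure.map_addHaar_smul _ (by norm_num), lintegral_smul_measure]
  simp [abs_of_nonneg]

lemma kpe_A (p : ℝ) (hp : 1 ≤ p) (u v : E → ℝ) (hu : Measurable u) (hv : Measurable v) :
    kpeA p u v (5/2) ≤ ENNReal.ofReal ((3 ^ p * 3) * (3 ^ p * 3) * (9 ^ d * 2)) *
      kpeA p u v (1/2) := by
  rw [kpe_A_eq p u v hu hv, kpe_A_eq p u v hu hv]
  have hF := kpe_F_meas p u v hu hv
  have hm : Measurable ((Metric.closedBall (0 : E) (1/2)).indicator (1 : E → ℝ≥0∞)) :=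
    measurable_one.indicator Metric.isClosed_closedBall.measurableSet
  set I : E → ℝ≥0∞ := (Metric.closedBall (0 : E) (1/2)).indicator 1 with hI
  have hIneg : ∀ z, I (-z) = I z := by
    intro z; simp [hI, Set.indicator]
  have step : ∀ z, (Metric.closedBall (0 : E) (5/2)).indicator 1 z * kpeF p u v z ≤
      ENNReal.ofReal ((3 ^ p * 3) * (3 ^ p * 3)) *
        (I ((1/9 : ℝ) • z) * (kpeF p u v ((1/9 : ℝ) • z) + kpeF p u v (-((1/9 : ℝ) • z)))) := by
    intro z
    by_cases hz : z ∈ Metric.closedBall (0 : E) (5/2)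
    · have : (1/9 : ℝ) • z ∈ Metric.closedBall (0 : E) (1/2) := by
        rw [mem_closedBall_zero_iff] at hz ⊢
        rw [norm_smul, Real.norm_of_nonneg (by norm_num)]
        linarith
      rw [hI, Set.indicator_of_mem hz, Set.indicator_of_mem this]
      simp only [Pi.one_apply, one_mul]
      exact kpe_G9 p hp u v hu hv z
    · rw [Set.indicator_of_notMem hz]; simp
  refine (lintegral_mono step).trans (le_of_eq ?_)
  rw [lintegral_const_mul _ (by fun_prop),
    kpe_scale (fun z => I z * (kpeF p u v z + kpeF p u v (-z))) (by fun_prop)]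
  simp only [mul_add]
  rw [lintegral_add_left (by fun_prop)]
  have : ∫⁻ z, I z * kpeF p u v (-z) = ∫⁻ z, I z * kpeF p u v z := by
    rw [← lintegral_neg_eq_self]
    simp only [hIneg, neg_neg]
  rw [this, ENNReal.ofReal_mul (p := (3 ^ p * 3) * (3 ^ p * 3)) (q := 9 ^ d * 2) (by positivity),
    ENNReal.ofReal_mul (by positivity : (0:ℝ) ≤ 9 ^ d), ENNReal.ofReal_ofNat]
  ring

lemma kpe_pointwise (φ : E → ℝ) (L : ℝ) (hL0 : 0 ≤ L)
    (hL : ∀ x y, |φ x - φ y| ≤ L * ‖x - y‖)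
    (hφ0 : ∀ x, 0 ≤ φ x)
    (hφone : ∀ x : E, ‖x‖ ≤ 1 → φ x = 1)
    (h₁ h : ℝ) (h1 : 0 < h₁) (hh : 0 < h) (hle : h₁ ≤ h) (z w : E) (hzw : ‖z - w‖ ≤ 4 * h₁) :
    φ z / (‖z‖ + h) ^ d ≤ (1 + 5 ^ d * (h₁ / h)) * (φ w / (‖w‖ + h) ^ d) + L * 4 * 4 ^ d * h₁ := by
  have hz := norm_nonneg z
  have hw := norm_nonneg w
  have ht0 : 0 ≤ h₁ / h := by positivity
  have ht1 : h₁ / h ≤ 1 := by rw [div_le_one hh]; exact hle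
  have hwz : ‖w‖ ≤ ‖z‖ + 4 * h₁ := by
    have := norm_sub_norm_le w z
    rw [norm_sub_rev] at this
    linarith
  have A : φ w / (‖z‖ + h) ^ d ≤ (1 + 5 ^ d * (h₁ / h)) * (φ w / (‖w‖ + h) ^ d) := by
    rw [mul_div_assoc', div_le_div_iff₀ (by positivity) (by positivity)]
    have e : ‖w‖ + h ≤ (1 + 4 * (h₁ / h)) * (‖z‖ + h) := by
      have : (1 + 4 * (h₁ / h)) * (‖z‖ + h) = ‖z‖ + h + 4 * h₁ + 4 * (h₁ / h) * ‖z‖ := by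
        field_simp; ring
      rw [this]
      have : 0 ≤ 4 * (h₁ / h) * ‖z‖ := by positivity
      linarith
    have e2 : (‖w‖ + h) ^ d ≤ (1 + 5 ^ d * (h₁ / h)) * (‖z‖ + h) ^ d := by
      refine (pow_le_pow_left₀ (by positivity) e d).trans ?_
      rw [mul_pow]
      exact mul_le_mul_of_nonneg_right (kpe_pow d _ ht0 ht1) (by positivity)
    calc φ w * (‖w‖ + h) ^ d ≤ φ w * ((1 + 5 ^ d * (h₁ / h)) * (‖z‖ + h) ^ d) :=
          mul_le_mul_of_nonneg_left e2 (hφ0 w)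
      _ = _ := by ring
  have B : (φ z - φ w) / (‖z‖ + h) ^ d ≤ L * 4 * 4 ^ d * h₁ := by
    by_cases hc : ‖z‖ ≤ 1 ∧ ‖w‖ ≤ 1
    · rw [hφone z hc.1, hφone w hc.2]
      simp; positivity
    · have hq : 1 ≤ 4 * (‖z‖ + h) := by
        by_contra hcon
        apply hc
        constructor <;> linarith
      have hq2 : 1 ≤ 4 ^ d * (‖z‖ + h) ^ d := by
        rw [← mul_pow]; exact one_le_pow₀ hq
      rw [div_le_iff₀ (by positivity)]
      have h3 : φ z - φ w ≤ L * (4 * h₁) :=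
        (le_abs_self _).trans ((hL z w).trans (mul_le_mul_of_nonneg_left hzw hL0))
      have h4 : 0 ≤ L * (4 * h₁) := by positivity
      calc φ z - φ w ≤ L * (4 * h₁) * 1 := by linarith
        _ ≤ L * (4 * h₁) * (4 ^ d * (‖z‖ + h) ^ d) := mul_le_mul_of_nonneg_left hq2 h4
        _ = _ := by ring
  rw [sub_div] at B
  linarith

end

/-- Stability of the kernel double integral under measurable perturbations of the
coordinates: perturbing by at most `h₁` changes the integral by a factor `1 + C h₁/h`. -/
theorem kernel_perturbation_estimate (d : ℕ) (hd : 1 ≤ d)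
    (φ : EuclideanSpace ℝ (Fin d) → ℝ)
    (hφs : ContDiff ℝ (⊤ : ℕ∞) φ)
    (hφ0 : ∀ x, 0 ≤ φ x) (hφ1 : ∀ x, φ x ≤ 1)
    (hφrad : ∀ x y : EuclideanSpace ℝ (Fin d), ‖x‖ = ‖y‖ → φ x = φ y)
    (hφone : ∀ x : EuclideanSpace ℝ (Fin d), ‖x‖ ≤ 1 → φ x = 1)
    (hφzero : ∀ x : EuclideanSpace ℝ (Fin d), 2 < ‖x‖ → φ x = 0)
    (p : ℝ) (hp : 1 ≤ p) :
    ∃ C : ℝ, 0 < C ∧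
      ∀ h₁ h : ℝ, 0 < h₁ → h₁ < 1 / 4 → 0 < h → h < 1 / 2 → h₁ ≤ h →
      ∀ f₁ f₂ g₁ g₂ : EuclideanSpace ℝ (Fin d) → EuclideanSpace ℝ (Fin d),
        Measurable f₁ → Measurable f₂ → Measurable g₁ → Measurable g₂ →
        (∀ x, ‖x - f₁ x‖ ≤ h₁) → (∀ x, ‖x - f₂ x‖ ≤ h₁) →
        (∀ x, ‖x - g₁ x‖ ≤ h₁) → (∀ x, ‖x - g₂ x‖ ≤ h₁) →
      ∀ u v : EuclideanSpace ℝ (Fin d) → ℝ, Measurable u → Measurable v →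
        (∫⁻ x, ∫⁻ y, ENNReal.ofReal
            (φ (g₁ x - g₂ y) / (‖g₁ x - g₂ y‖ + h) ^ d * |u x - v y| ^ p))
          ≤ ENNReal.ofReal (1 + C * h₁ / h) *
            ∫⁻ x, ∫⁻ y, ENNReal.ofReal
              (φ (f₁ x - f₂ y) / (‖f₁ x - f₂ y‖ + h) ^ d * |u x - v y| ^ p) := by
  obtain ⟨L, hL⟩ : ∃ L, LipschitzWith L φ := by
    have hcs : HasCompactSupport φ := by
      apply HasCompactSupport.of_support_subset_isCompact (isCompact_closedBall 0 2)
      intro x hx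
      rw [mem_closedBall_zero_iff]
      by_contra hcon
      exact hx (hφzero x (not_le.1 hcon))
    exact hφs.lipschitzWith_of_hasCompactSupport hcs (by simp)
  have hL' : ∀ x y, |φ x - φ y| ≤ L * ‖x - y‖ := by
    intro x y
    have := hL.dist_le_mul x y
    rwa [Real.dist_eq, dist_eq_norm] at this
  set M : ℝ := (3 ^ p * 3) * (3 ^ p * 3) * (9 ^ d * 2) with hM
  have hM0 : 0 ≤ M := by positivity
  have hLn : (0:ℝ) ≤ L := L.2
  set D : ℝ := (L : ℝ) * 4 * 4 ^ d with hD
  have hD0 : 0 ≤ D := by positivity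
  refine ⟨5 ^ d + D * (M * 2 ^ d), by positivity, ?_⟩
  intro h₁ h h1 h14 hh hh2 hle f₁ f₂ g₁ g₂ mf₁ mf₂ mg₁ mg₂ hf₁ hf₂ hg₁ hg₂ u v hu hv
  have hφm : Measurable φ := hφs.continuous.measurable
  have ht0 : 0 ≤ h₁ / h := by positivity
  have hB : ∀ r : ℝ, Measurable
      ((Metric.closedBall (0 : EuclideanSpace ℝ (Fin d)) r).indicator
        (1 : EuclideanSpace ℝ (Fin d) → ℝ≥0∞)) := fun r =>
    measurable_one.indicator Metric.isClosed_closedBall.measurableSet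
  set R := ∫⁻ x, ∫⁻ y, ENNReal.ofReal
              (φ (f₁ x - f₂ y) / (‖f₁ x - f₂ y‖ + h) ^ d * |u x - v y| ^ p) with hR
  have near : ∀ (a₁ a₂ : EuclideanSpace ℝ (Fin d) → EuclideanSpace ℝ (Fin d)),
      (∀ x, ‖x - a₁ x‖ ≤ h₁) → (∀ x, ‖x - a₂ x‖ ≤ h₁) → ∀ x y,
      ‖(x - y) - (a₁ x - a₂ y)‖ ≤ 2 * h₁ := by
    intro a₁ a₂ H1 H2 x y
    have : (x - y) - (a₁ x - a₂ y) = (x - a₁ x) - (y - a₂ y) := by abel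
    rw [this]
    have := norm_sub_le (x - a₁ x) (y - a₂ y)
    linarith [H1 x, H2 y]
  -- lower bound of the right-hand side
  have low : kpeA p u v (1/2) ≤ ENNReal.ofReal (2 ^ d) * R := by
    rw [hR, ← lintegral_const_mul' _ _ ENNReal.ofReal_ne_top]
    unfold kpeA
    apply lintegral_mono
    intro x
    dsimp only
    rw [← lintegral_const_mul' _ _ ENNReal.ofReal_ne_top]
    apply lintegral_mono
    intro y
    dsimp only
    by_cases hxy : y - x ∈ Metric.closedBall (0 : EuclideanSpace ℝ (Fin d)) (1/2)
    · rw [Set.indicator_of_mem hxy, Pi.one_apply, one_mul, ← ENNReal.ofReal_mul (by positivity)]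
      apply ENNReal.ofReal_le_ofReal
      rw [mem_closedBall_zero_iff, norm_sub_rev] at hxy
      have hn := near f₁ f₂ hf₁ hf₂ x y
      have hw : ‖f₁ x - f₂ y‖ ≤ 1 := by
        have := norm_sub_norm_le (f₁ x - f₂ y) (x - y)
        rw [norm_sub_rev (f₁ x - f₂ y) (x - y)] at this
        linarith
      rw [hφone _ hw, ← mul_assoc, mul_one_div]
      have hp0 := Real.rpow_nonneg (abs_nonneg (u x - v y)) p
      apply le_mul_of_one_le_left hp0
      rw [one_le_div (by positivity)]
      exact pow_le_pow_left₀ (by positivity) (by linarith) d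
    · rw [Set.indicator_of_notMem hxy]; simp
  -- upper bound of the left-hand side
  have up : (∫⁻ x, ∫⁻ y, ENNReal.ofReal
            (φ (g₁ x - g₂ y) / (‖g₁ x - g₂ y‖ + h) ^ d * |u x - v y| ^ p)) ≤
      ENNReal.ofReal (1 + 5 ^ d * (h₁ / h)) * R + ENNReal.ofReal (D * h₁) * kpeA p u v (5/2) := by
    rw [hR, ← lintegral_const_mul' _ _ ENNReal.ofReal_ne_top]
    unfold kpeA
    rw [← lintegral_const_mul' _ _ ENNReal.ofReal_ne_top, ← lintegral_add_left]
    swap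
    · apply Measurable.const_mul
      apply Measurable.lintegral_prod_right'
        (f := fun q : EuclideanSpace ℝ (Fin d) × EuclideanSpace ℝ (Fin d) => ENNReal.ofReal
          (φ (f₁ q.1 - f₂ q.2) / (‖f₁ q.1 - f₂ q.2‖ + h) ^ d * |u q.1 - v q.2| ^ p))
      fun_prop
    apply lintegral_mono
    intro x
    dsimp only
    rw [← lintegral_const_mul' _ _ ENNReal.ofReal_ne_top,
      ← lintegral_const_mul' _ _ ENNReal.ofReal_ne_top, ← lintegral_add_left (by fun_prop)]
    apply lintegral_mono
    intro y
    dsimp only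
    have hp0 := Real.rpow_nonneg (abs_nonneg (u x - v y)) p
    by_cases hxy : y - x ∈ Metric.closedBall (0 : EuclideanSpace ℝ (Fin d)) (5/2)
    · have hφf := hφ0 (f₁ x - f₂ y)
      rw [Set.indicator_of_mem hxy, Pi.one_apply, one_mul, ← ENNReal.ofReal_mul (by positivity),
        ← ENNReal.ofReal_mul (by positivity), ← ENNReal.ofReal_add (by positivity) (by positivity)]
      apply ENNReal.ofReal_le_ofReal
      have hzw : ‖(g₁ x - g₂ y) - (f₁ x - f₂ y)‖ ≤ 4 * h₁ := by
        have n1 := near f₁ f₂ hf₁ hf₂ x y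
        have n2 := near g₁ g₂ hg₁ hg₂ x y
        have := norm_sub_le ((x - y) - (f₁ x - f₂ y)) ((x - y) - (g₁ x - g₂ y))
        rw [sub_sub_sub_cancel_left] at this
        linarith
      have := kpe_pointwise φ L hLn hL' hφ0 hφone h₁ h h1 hh hle _ _ hzw
      calc _ ≤ _ := mul_le_mul_of_nonneg_right this hp0
        _ = _ := by ring
    · rw [mem_closedBall_zero_iff, norm_sub_rev] at hxy
      have : φ (g₁ x - g₂ y) = 0 := by
        apply hφzero
        have n2 := near g₁ g₂ hg₁ hg₂ x y
        have := norm_sub_norm_le (x - y) (g₁ x - g₂ y)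
        linarith
      rw [this]; simp
  have hA := kpe_A (d := d) p hp u v hu hv
  calc _ ≤ _ := up
    _ ≤ ENNReal.ofReal (1 + 5 ^ d * (h₁ / h)) * R + ENNReal.ofReal (D * h₁) *
        (ENNReal.ofReal M * (ENNReal.ofReal (2 ^ d) * R)) := by
      gcongr
      exact hA.trans (by gcongr)
    _ = ENNReal.ofReal (1 + 5 ^ d * (h₁ / h) + D * h₁ * (M * 2 ^ d)) * R := by
      rw [ENNReal.ofReal_add (p := 1 + 5 ^ d * (h₁ / h)) (q := D * h₁ * (M * 2 ^ d))
          (by positivity) (by positivity),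
        ENNReal.ofReal_mul (by positivity : 0 ≤ D * h₁), ENNReal.ofReal_mul hM0]
      ring
    _ ≤ _ := by
      refine mul_le_mul_left (ENNReal.ofReal_le_ofReal ?_) _
      have : h₁ ≤ h₁ / h := by rw [le_div_iff₀ hh]; nlinarith
      have h5 : 0 ≤ D * (M * 2 ^ d) := by positivity
      have := mul_le_mul_of_nonneg_left this h5
      have e : (5 ^ d + D * (M * 2 ^ d)) * h₁ / h = 5 ^ d * (h₁ / h) + D * (M * 2 ^ d) * (h₁ / h) := by
        ring
      rw [e]
      linarith
end

section
/- Let Ω ⊆ ℝ^d and consider a mesh datum with δx < 1/16 such that Σ_{i∈V} χ_i(x) ≤ 1 for every x ∈ ℝ^d and Σ_{i∈V} χ_i(x) = 1 for every x ∈ Ω + B(0,4). Then there exist pairwise disjoint measurable sets (V_i)_{i∈V} in ℝ^d with Lebesgue measure |V_i| = π_i, with |x − x_i| ≤ 2δx for every x ∈ V_i, and such that (Ω + B(0,3)) ∖ ⋃_{i∈V} V_i has Lebesgue measure zero. Moreover, for any family (V_i)_{i∈V} with these properties, any 0 < h₂ < 1/16, any virtual coordinates (x̃_i)_{i∈V}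 with |x̃_i − x_i| < h₂ for all i ∈ V, and any u : V → ℝ with u_i = 0 whenever supp χ_i is not contained in Ω, the following hold, where u^V := Σ_{i∈V} u_i·1_{V_i} and f : ℝ^d → ℝ^d is defined by f(x) = x̃_i for x ∈ V_i and f(x) = x for x ∉ ⋃_{i∈V} V_i: (a) |x − f(x)| ≤ 2δx + h₂ < 1/4 for every x ∈ ℝ^d; (b) supp u^V ⊆ Ω + B(0,1); (c) for every 1 ≤ p < ∞ and 0 < h < 1/2: Σ_{i,j∈V} K^h(x̃_i − x̃_j)|u_i − u_j|^p π_i π_j = ∫∫_{ℝ^d×ℝ^d} K^h(f(x) − f(y))|u^V(x) − u^V(y)|^p dx dy. -/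
open MeasureTheory
open scoped ENNReal Pointwise

lemma ket_sub {d : ℕ} (hd : 1 ≤ d) (Q : Set (EuclideanSpace ℝ (Fin d)))
    (hQ : MeasurableSet Q) (hb : Bornology.IsBounded Q) (a : ℝ≥0∞) (ha : a ≤ volume Q) :
    ∃ S, S ⊆ Q ∧ MeasurableSet S ∧ volume S = a := by
  have : Nonempty (Fin d) := ⟨⟨0, hd⟩⟩
  have : Nontrivial (EuclideanSpace ℝ (Fin d)) := inferInstance
  have hfin : volume Q ≠ ⊤ := hb.measure_lt_top.ne
  obtain ⟨R, hR0, hR⟩ := hb.subset_closedBall_lt 0 (0 : EuclideanSpace ℝ (Fin d))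
  let G : ℝ → ℝ := fun t => volume.real (Q ∩ Metric.closedBall 0 t)
  let H : ℝ → ℝ := fun t => t ^ d * volume.real (Metric.ball (0 : EuclideanSpace ℝ (Fin d)) 1)
  have hHc : Continuous H := by fun_prop
  have hHv : ∀ t, 0 ≤ t → volume.real (Metric.closedBall (0 : EuclideanSpace ℝ (Fin d)) t) = H t := by
    intro t ht
    rw [Measure.real, Measure.addHaar_closedBall _ _ ht]
    simp [H, Measure.real, ht]
  have key : ∀ s t, 0 ≤ s → s ≤ t → |G t - G s| ≤ |H t - H s| := by
    intro s t hs hst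
    have hsub : Metric.closedBall (0 : EuclideanSpace ℝ (Fin d)) s ⊆ Metric.closedBall 0 t :=
      Metric.closedBall_subset_closedBall hst
    have h1 : G s ≤ G t := measureReal_mono (Set.inter_subset_inter_right _ hsub)
      (measure_ne_top_of_subset Set.inter_subset_left hfin)
    have hft : volume (Metric.closedBall (0 : EuclideanSpace ℝ (Fin d)) t) ≠ ⊤ :=
      measure_closedBall_lt_top.ne
    have h2 : volume.real (Metric.closedBall (0 : EuclideanSpace ℝ (Fin d)) t \ Metric.closedBall 0 s)
        = H t - H s := by
      rw [measureReal_diff hsub measurableSet_closedBall, hHv t (hs.trans hst), hHv s hs]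
    have h3 : G t ≤ G s + (H t - H s) := by
      rw [← h2]
      refine le_trans (measureReal_mono ?_ ?_) (measureReal_union_le _ _)
      · intro x hx
        by_cases h : x ∈ Metric.closedBall (0 : EuclideanSpace ℝ (Fin d)) s
        · exact Or.inl ⟨hx.1, h⟩
        · exact Or.inr ⟨hx.2, h⟩
      · refine (measure_union_lt_top ?_ ?_).ne
        · exact (measure_ne_top_of_subset Set.inter_subset_left hfin).lt_top
        · exact (measure_ne_top_of_subset Set.diff_subset hft).lt_top
    rw [abs_of_nonneg (by linarith)]
    exact le_trans (by linarith) (le_abs_self _)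
  have key' : ∀ s t, 0 ≤ s → 0 ≤ t → dist (G t) (G s) ≤ dist (H t) (H s) := by
    intro s t hs ht
    rw [Real.dist_eq, Real.dist_eq]
    rcases le_total s t with h | h
    · exact key s t hs h
    · rw [abs_sub_comm, abs_sub_comm (H t)]; exact key t s ht h
  have hGc : ContinuousOn G (Set.Icc 0 R) := by
    rw [Metric.continuousOn_iff]
    intro b hbm ε hε
    obtain ⟨η, hη, h⟩ := Metric.continuous_iff.1 hHc b ε hε
    exact ⟨η, hη, fun x hx hxd => lt_of_le_of_lt (key' b x hbm.1 hx.1) (h x hxd)⟩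
  have hG0 : G 0 = 0 := by
    have : volume (Q ∩ Metric.closedBall (0 : EuclideanSpace ℝ (Fin d)) 0) = 0 := by
      refine measure_mono_null Set.inter_subset_right ?_
      simp
    simp only [G, Measure.real, this, ENNReal.toReal_zero]
  have hGR : G R = (volume Q).toReal := by
    simp only [G, Measure.real, Set.inter_eq_left.2 hR]
  have hmem : a.toReal ∈ Set.Icc (G 0) (G R) := by
    rw [hG0, hGR]
    exact ⟨ENNReal.toReal_nonneg, ENNReal.toReal_mono hfin ha⟩
  obtain ⟨t, -, ht⟩ := intermediate_value_Icc hR0.le hGc hmem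
  refine ⟨Q ∩ Metric.closedBall 0 t, Set.inter_subset_left, hQ.inter measurableSet_closedBall, ?_⟩
  exact (ENNReal.toReal_eq_toReal_iff' (measure_ne_top_of_subset Set.inter_subset_left hfin)
    (ne_top_of_le_ne_top hfin ha)).1 ht

lemma ket_split {d : ℕ} (hd : 1 ≤ d) {V : Type} (a : V → ℝ≥0∞) (s : Finset V) :
    ∀ Q : Set (EuclideanSpace ℝ (Fin d)), MeasurableSet Q → Bornology.IsBounded Q →
      ∑ i ∈ s, a i ≤ volume Q →
      ∃ S : V → Set (EuclideanSpace ℝ (Fin d)), (∀ i, S i ⊆ Q) ∧ (∀ i, MeasurableSet (S i)) ∧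
        (∀ i j, i ≠ j → Disjoint (S i) (S j)) ∧ ∀ i ∈ s, volume (S i) = a i := by
  classical
  induction s using Finset.induction_on with
  | empty => intro Q _ _ _; exact ⟨fun _ => ∅, by simp, by simp, by simp, by simp⟩
  | insert k s hk ih =>
    intro Q hQ hb hs
    rw [Finset.sum_insert hk] at hs
    have hfin : volume Q ≠ ⊤ := hb.measure_lt_top.ne
    obtain ⟨T, hTQ, hT, hTv⟩ := ket_sub hd Q hQ hb (a k) (le_self_add.trans hs)
    have hTf : volume T ≠ ⊤ := measure_ne_top_of_subset hTQ hfin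
    obtain ⟨S, hS1, hS2, hS3, hS4⟩ := ih (Q \ T) (hQ.diff hT) (hb.subset Set.diff_subset) (by
      rw [measure_diff hTQ hT.nullMeasurableSet hTf, hTv]
      exact ENNReal.le_sub_of_add_le_left (hTv ▸ hTf) hs)
    refine ⟨Function.update S k T, ?_, ?_, ?_, ?_⟩
    · intro i
      by_cases h : i = k
      · subst h; simpa using hTQ
      · simpa [Function.update_of_ne h] using (hS1 i).trans Set.diff_subset
    · intro i
      by_cases h : i = k
      · subst h; simpa using hT
      · simpa [Function.update_of_ne h] using hS2 i
    · have hd : ∀ i, Disjoint T (S i) := fun i =>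
        (Set.disjoint_sdiff_right).mono_right (hS1 i)
      intro i j hij
      by_cases h : i = k
      · subst h; rw [Function.update_self, Function.update_of_ne hij.symm]; exact hd j
      · rw [Function.update_of_ne h]
        by_cases h' : j = k
        · subst h'; rw [Function.update_self]; exact (hd i).symm
        · rw [Function.update_of_ne h']; exact hS3 i j hij
    · intro i hi
      by_cases h : i = k
      · subst h; simpa using hTv
      · rw [Function.update_of_ne h]; exact hS4 i (Finset.mem_of_mem_insert_of_ne hi h)

lemma ket_bary {d : ℕ} (χ : EuclideanSpace ℝ (Fin d) → ℝ) (π : ℝ)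
    (xb : EuclideanSpace ℝ (Fin d)) (δ : ℝ) (h0 : ∀ x, 0 ≤ χ x)
    (hb : Bornology.IsBounded (tsupport χ)) (hπ : π = ∫ x, χ x) (hpos : 0 < π)
    (hxb : xb = π⁻¹ • ∫ x, χ x • x) (hδ : Metric.diam (tsupport χ) ≤ δ)
    (y : EuclideanSpace ℝ (Fin d)) (hy : y ∈ tsupport χ) : ‖y - xb‖ ≤ δ := by
  have hint : Integrable χ := by
    by_contra h
    rw [hπ, integral_undef h] at hpos
    exact lt_irrefl _ hpos
  have hdist : ∀ x, ‖χ x • (y - x)‖ ≤ χ x * δ := by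
    intro x
    rw [norm_smul, Real.norm_eq_abs, abs_of_nonneg (h0 x)]
    by_cases hx : χ x = 0
    · simp [hx]
    · refine mul_le_mul_of_nonneg_left ?_ (h0 x)
      rw [← dist_eq_norm]
      exact (Metric.dist_le_diam_of_mem hb hy (subset_tsupport _ hx)).trans hδ
  have hmeas : AEStronglyMeasurable (fun x => χ x • (y - x)) volume :=
    hint.1.smul (by fun_prop)
  have hi1 : Integrable (fun x => χ x • (y - x)) :=
    Integrable.mono' (hint.mul_const δ) hmeas (Filter.Eventually.of_forall hdist)
  have hi2 : Integrable (fun x => χ x • y) := hint.smul_const y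
  have hi3 : Integrable (fun x => χ x • x) := by
    have := hi2.sub hi1
    refine this.congr (Filter.Eventually.of_forall fun x => ?_)
    simp [smul_sub]
  have he : y - xb = π⁻¹ • ∫ x, χ x • (y - x) := by
    have : (∫ x, χ x • (y - x)) = π • y - ∫ x, χ x • x := by
      rw [hπ, ← integral_smul_const, ← integral_sub hi2 hi3]
      simp [smul_sub]
    rw [this, smul_sub, smul_smul, inv_mul_cancel₀ hpos.ne', one_smul, hxb]
  rw [he, norm_smul, Real.norm_eq_abs, abs_of_pos (inv_pos.2 hpos), inv_mul_le_iff₀ hpos]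
  refine (norm_integral_le_of_norm_le (hint.mul_const δ) (Filter.Eventually.of_forall hdist)).trans ?_
  rw [integral_mul_const, hπ]

lemma ket_exists {d : ℕ} (hd : 1 ≤ d)
    (Ω : Set (EuclideanSpace ℝ (Fin d)))
    (V : Type) [Fintype V]
    (χ : V → EuclideanSpace ℝ (Fin d) → ℝ)
    (π : V → ℝ) (xb : V → EuclideanSpace ℝ (Fin d)) (δx : ℝ)
    (hχm : ∀ i, Measurable (χ i))
    (hχ0 : ∀ i x, 0 ≤ χ i x) 
    (hπ : ∀ i, π i = ∫ x, χ i x) (hπpos : ∀ i, 0 < π i)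
    (hδ0 : 0 < δx) (hbar : ∀ i, ∀ y ∈ tsupport (χ i), ‖y - xb i‖ ≤ δx)
    (hδ : δx < 1 / 16)
    (hle : ∀ x, ∑ i, χ i x ≤ 1)
    (heq : ∀ x ∈ Ω + Metric.ball (0 : EuclideanSpace ℝ (Fin d)) 4, ∑ i, χ i x = 1) :
    (∃ Vs : V → Set (EuclideanSpace ℝ (Fin d)),
        (∀ i, MeasurableSet (Vs i)) ∧
        (∀ i j, i ≠ j → Disjoint (Vs i) (Vs j)) ∧
        (∀ i, volume (Vs i) = ENNReal.ofReal (π i)) ∧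
        (∀ i, ∀ x ∈ Vs i, ‖x - xb i‖ ≤ 2 * δx) ∧
        volume ((Ω + Metric.ball (0 : EuclideanSpace ℝ (Fin d)) 3) \ (⋃ i, Vs i)) = 0) := by
  classical
  let B : ℕ → Set (EuclideanSpace ℝ (Fin d)) := fun n =>
    Metric.ball (TopologicalSpace.denseSeq (EuclideanSpace ℝ (Fin d)) n) (δx / 2)
  let Q := disjointed B
  have hQm : ∀ n, MeasurableSet (Q n) := MeasurableSet.disjointed fun n => measurableSet_ball
  have hQB : ∀ n, Q n ⊆ B n := fun n => disjointed_subset B n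
  have hQb : ∀ n, Bornology.IsBounded (Q n) := fun n => Metric.isBounded_ball.subset (hQB n)
  have hQd : Pairwise (Function.onFun Disjoint Q) := disjoint_disjointed B
  have hQdist : ∀ n, ∀ x ∈ Q n, ∀ y ∈ Q n, ‖x - y‖ ≤ δx := by
    intro n x hx y hy
    have h1 := Metric.mem_ball.1 (hQB n hx)
    have h2 := Metric.mem_ball'.1 (hQB n hy)
    rw [← dist_eq_norm]
    linarith [dist_triangle x (TopologicalSpace.denseSeq (EuclideanSpace ℝ (Fin d)) n) y]
  have hQU : ⋃ n, Q n = Set.univ := by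
    rw [iUnion_disjointed]
    refine Set.eq_univ_of_forall fun x => ?_
    obtain ⟨n, hn⟩ := (TopologicalSpace.denseRange_denseSeq _).exists_dist_lt x (half_pos hδ0)
    exact Set.mem_iUnion.2 ⟨n, hn⟩
  let a : ℕ → V → ℝ≥0∞ := fun n i => ∫⁻ x in Q n, ENNReal.ofReal (χ i x)
  have hsum : ∀ n, ∑ i, a n i = ∫⁻ x in Q n, ENNReal.ofReal (∑ i, χ i x) := by
    intro n
    rw [← lintegral_finsetSum _ (fun i _ => (hχm i).ennreal_ofReal)]
    refine lintegral_congr fun x => ?_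
    rw [ENNReal.ofReal_sum_of_nonneg fun i _ => hχ0 i x]
  have hsumle : ∀ n, ∑ i, a n i ≤ volume (Q n) := by
    intro n
    rw [hsum, ← setLIntegral_one]
    exact lintegral_mono fun x => by simpa using hle x
  choose S hS1 hS2 hS3 hS4 using fun n => ket_split hd (a n) Finset.univ (Q n) (hQm n) (hQb n) (hsumle n)
  let T : ℕ → V → Set (EuclideanSpace ℝ (Fin d)) := fun n i => if a n i = 0 then ∅ else S n i
  have hTS : ∀ n i, T n i ⊆ S n i := by
    intro n i
    by_cases h : a n i = 0 <;> simp [T, h]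
  have hTm : ∀ n i, MeasurableSet (T n i) := by
    intro n i
    by_cases h : a n i = 0 <;> simp [T, h, hS2]
  have hTv : ∀ n i, volume (T n i) = a n i := by
    intro n i
    by_cases h : a n i = 0
    · simp [T, h]
    · simp [T, h, hS4 n i]
  have hTne : ∀ n i, ∀ x ∈ T n i, a n i ≠ 0 := by
    intro n i x hx h
    simp [T, h] at hx
  have hTd : ∀ n i j, i ≠ j → Disjoint (T n i) (T n j) := fun n i j hij =>
    (hS3 n i j hij).mono (hTS n i) (hTS n j)
  have hTQ : ∀ n i, T n i ⊆ Q n := fun n i => (hTS n i).trans (hS1 n i)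
  refine ⟨fun i => ⋃ n, T n i, fun i => MeasurableSet.iUnion fun n => hTm n i, ?_, ?_, ?_, ?_⟩
  · intro i j hij
    rw [Set.disjoint_iUnion_left]
    intro n
    rw [Set.disjoint_iUnion_right]
    intro m
    by_cases h : n = m
    · subst h; exact hTd n i j hij
    · exact (hQd h).mono (hTQ n i) (hTQ m j)
  · intro i
    rw [measure_iUnion (fun n m h => (hQd h).mono (hTQ n i) (hTQ m i)) (fun n => hTm n i)]
    simp_rw [hTv]
    have hint : Integrable (χ i) := by
      by_contra h
      have := hπpos i
      rw [hπ, integral_undef h] at this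
      exact lt_irrefl _ this
    rw [hπ, ofReal_integral_eq_lintegral_ofReal hint (Filter.Eventually.of_forall (hχ0 i)),
      ← setLIntegral_univ, ← hQU, lintegral_iUnion hQm hQd]
  · intro i x hx
    obtain ⟨n, hn⟩ := Set.mem_iUnion.1 hx
    have hne := hTne n i x hn
    obtain ⟨y, hy, hyχ⟩ : ∃ y ∈ Q n, χ i y ≠ 0 := by
      by_contra hcon
      push Not at hcon
      apply hne
      refine (setLIntegral_congr_fun (hQm n) (g := fun _ => 0) fun y hy => ?_).trans (by simp)
      simp [hcon y hy]
    have h1 := hQdist n x (hTQ n i hn) y hy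
    have h2 := hbar i y (subset_tsupport _ hyχ)
    have h3 := norm_sub_le_norm_sub_add_norm_sub x y (xb i)
    linarith
  · have hnull : ∀ n, Q n ⊆ Ω + Metric.ball (0 : EuclideanSpace ℝ (Fin d)) 4 →
        volume (Q n \ ⋃ i, T n i) = 0 := by
      intro n hn
      have hm : MeasurableSet (⋃ i, T n i) := MeasurableSet.iUnion fun i => hTm n i
      have hsub : (⋃ i, T n i) ⊆ Q n := Set.iUnion_subset fun i => hTQ n i
      rw [measure_diff hsub hm.nullMeasurableSet
        (measure_ne_top_of_subset hsub (hQb n).measure_lt_top.ne),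
        measure_iUnion (fun i j h => hTd n i j h) (fun i => hTm n i), tsum_fintype]
      simp_rw [hTv]
      rw [hsum, setLIntegral_congr_fun (hQm n) (g := fun _ => 1) fun y hy => by simp [heq y (hn hy)]]
      simp
    have : (Ω + Metric.ball (0 : EuclideanSpace ℝ (Fin d)) 3) \ (⋃ i, ⋃ n, T n i) ⊆
        ⋃ n, ⋃ _ : Q n ⊆ Ω + Metric.ball (0 : EuclideanSpace ℝ (Fin d)) 4, (Q n \ ⋃ i, T n i) := by
      rintro x ⟨⟨w, hw, b, hb, rfl⟩, hx⟩
      have hxu : w + b ∈ ⋃ n, Q n := hQU ▸ Set.mem_univ _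
      obtain ⟨n, hn⟩ := Set.mem_iUnion.1 hxu
      refine Set.mem_iUnion.2 ⟨n, Set.mem_iUnion.2 ⟨?_, hn, ?_⟩⟩
      · intro y hy
        refine ⟨w, hw, y - w, ?_, by simp⟩
        rw [mem_ball_zero_iff] at hb ⊢
        have h1 := hQdist n y hy _ hn
        have h2 : y - w = (y - (w + b)) + b := by abel
        rw [h2]
        exact lt_of_le_of_lt (norm_add_le _ _) (by linarith)
      · intro h
        obtain ⟨i, hi⟩ := Set.mem_iUnion.1 h
        exact hx (Set.mem_iUnion.2 ⟨i, Set.mem_iUnion.2 ⟨n, hi⟩⟩)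
    refine measure_mono_null this ?_
    rw [measure_iUnion_null_iff]
    intro n
    rw [measure_iUnion_null_iff]
    exact hnull n

/-- Existence of a measurable partition realizing the cell volumes, and the
rewriting of the discrete kernel double sum as a double integral of the
piecewise constant extension. -/
theorem kernel_extension_trick (d : ℕ) (hd : 1 ≤ d)
    (φ : EuclideanSpace ℝ (Fin d) → ℝ)
    (hφs : ContDiff ℝ (⊤ : ℕ∞) φ)
    (hφ0 : ∀ x, 0 ≤ φ x) (hφ1 : ∀ x, φ x ≤ 1)
    (hφrad : ∀ x y : EuclideanSpace ℝ (Fin d), ‖x‖ = ‖y‖ → φ x = φ y)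
    (hφone : ∀ x : EuclideanSpace ℝ (Fin d), ‖x‖ ≤ 1 → φ x = 1)
    (hφzero : ∀ x : EuclideanSpace ℝ (Fin d), 2 < ‖x‖ → φ x = 0)
    (Ω : Set (EuclideanSpace ℝ (Fin d)))
    (V : Type) [Fintype V]
    (χ : V → EuclideanSpace ℝ (Fin d) → ℝ)
    (π : V → ℝ) (xb : V → EuclideanSpace ℝ (Fin d)) (δx : ℝ)
    (hχm : ∀ i, Measurable (χ i))
    (hχ0 : ∀ i x, 0 ≤ χ i x) (hχ1 : ∀ i x, χ i x ≤ 1)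
    (hχb : ∀ i, Bornology.IsBounded (tsupport (χ i)))
    (hπ : ∀ i, π i = ∫ x, χ i x) (hπpos : ∀ i, 0 < π i)
    (hxb : ∀ i, xb i = (π i)⁻¹ • ∫ x, χ i x • x)
    (hδ0 : 0 < δx) (hδd : ∀ i, Metric.diam (tsupport (χ i)) ≤ δx)
    (hδ : δx < 1 / 16)
    (hle : ∀ x, ∑ i, χ i x ≤ 1)
    (heq : ∀ x ∈ Ω + Metric.ball (0 : EuclideanSpace ℝ (Fin d)) 4, ∑ i, χ i x = 1) :
    (∃ Vs : V → Set (EuclideanSpace ℝ (Fin d)),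
        (∀ i, MeasurableSet (Vs i)) ∧
        (∀ i j, i ≠ j → Disjoint (Vs i) (Vs j)) ∧
        (∀ i, volume (Vs i) = ENNReal.ofReal (π i)) ∧
        (∀ i, ∀ x ∈ Vs i, ‖x - xb i‖ ≤ 2 * δx) ∧
        volume ((Ω + Metric.ball (0 : EuclideanSpace ℝ (Fin d)) 3) \ (⋃ i, Vs i)) = 0) ∧
    (∀ Vs : V → Set (EuclideanSpace ℝ (Fin d)),
        (∀ i, MeasurableSet (Vs i)) →
        (∀ i j, i ≠ j → Disjoint (Vs i) (Vs j)) →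
        (∀ i, volume (Vs i) = ENNReal.ofReal (π i)) →
        (∀ i, ∀ x ∈ Vs i, ‖x - xb i‖ ≤ 2 * δx) →
        volume ((Ω + Metric.ball (0 : EuclideanSpace ℝ (Fin d)) 3) \ (⋃ i, Vs i)) = 0 →
        ∀ h₂ : ℝ, 0 < h₂ → h₂ < 1 / 16 →
        ∀ xt : V → EuclideanSpace ℝ (Fin d), (∀ i, ‖xt i - xb i‖ < h₂) →
        ∀ u : V → ℝ, (∀ i, ¬ tsupport (χ i) ⊆ Ω → u i = 0) →
        ∀ f : EuclideanSpace ℝ (Fin d) → EuclideanSpace ℝ (Fin d),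
          (∀ i, ∀ x ∈ Vs i, f x = xt i) →
          (∀ x, x ∉ (⋃ i, Vs i) → f x = x) →
          -- (a)
          ((∀ x, ‖x - f x‖ ≤ 2 * δx + h₂) ∧ 2 * δx + h₂ < 1 / 4) ∧
          -- (b)
          (Function.support (fun x => ∑ i, Set.indicator (Vs i) (fun _ => u i) x)
            ⊆ Ω + Metric.ball (0 : EuclideanSpace ℝ (Fin d)) 1) ∧
          -- (c)
          (∀ p h : ℝ, 1 ≤ p → 0 < h → h < 1 / 2 →
            ∫⁻ x, ∫⁻ y, ENNReal.ofReal
                (φ (f x - f y) / (‖f x - f y‖ + h) ^ d *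
                  |(∑ i, Set.indicator (Vs i) (fun _ => u i) x) -
                    ∑ i, Set.indicator (Vs i) (fun _ => u i) y| ^ p)
              = ENNReal.ofReal (∑ i, ∑ j,
                  φ (xt i - xt j) / (‖xt i - xt j‖ + h) ^ d *
                    |u i - u j| ^ p * π i * π j))) := by
  classical
  have hbar : ∀ i, ∀ y ∈ tsupport (χ i), ‖y - xb i‖ ≤ δx := fun i y hy =>
    ket_bary (χ i) (π i) (xb i) δx (hχ0 i) (hχb i) (hπ i) (hπpos i) (hxb i) (hδd i) y hy
  refine ⟨ket_exists hd Ω V χ π xb δx hχm hχ0 hπ hπpos hδ0 hbar hδ hle heq, ?_⟩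
  intro Vs hVm hVd hVv hVx hVn h₂ hh0 hh1 xt hxt u hu f hfV hfn
  have hne : ∀ i, u i ≠ 0 → ∃ y ∈ Ω, ‖y - xb i‖ ≤ δx := by
    intro i hi
    have hs : tsupport (χ i) ⊆ Ω := by
      by_contra h
      exact hi (hu i h)
    obtain ⟨y, hy⟩ : ∃ y, χ i y ≠ 0 := by
      by_contra hcon
      push Not at hcon
      have := hπpos i
      rw [hπ] at this
      simp [hcon] at this
    exact ⟨y, hs (subset_tsupport _ hy), hbar i y (subset_tsupport _ hy)⟩
  have hin : ∀ i, ∀ x ∈ Vs i, ∑ j, Set.indicator (Vs j) (fun _ => u j) x = u i := by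
    intro i x hx
    rw [Finset.sum_eq_single i]
    · simp [hx]
    · intro j _ hj
      exact Set.indicator_of_notMem (fun h => (Set.disjoint_left.1 (hVd j i hj)) h hx) _
    · simp
  have hout : ∀ x, x ∉ (⋃ i, Vs i) → ∑ j, Set.indicator (Vs j) (fun _ => u j) x = 0 := by
    intro x hx
    refine Finset.sum_eq_zero fun j _ => Set.indicator_of_notMem (fun h => hx ?_) _
    exact Set.mem_iUnion.2 ⟨j, h⟩
  refine ⟨⟨?_, by linarith⟩, ?_, ?_⟩
  · intro x
    by_cases hx : x ∈ ⋃ i, Vs i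
    · obtain ⟨i, hi⟩ := Set.mem_iUnion.1 hx
      rw [hfV i x hi]
      have h1 := hVx i x hi
      have h2 := hxt i
      rw [norm_sub_rev] at h2
      have h3 := norm_sub_le_norm_sub_add_norm_sub x (xb i) (xt i)
      linarith
    · rw [hfn x hx]
      simp only [sub_self, norm_zero]
      linarith
  · intro x hx
    rw [Function.mem_support] at hx
    by_cases hxu : x ∈ ⋃ i, Vs i
    · obtain ⟨i, hi⟩ := Set.mem_iUnion.1 hxu
      rw [hin i x hi] at hx
      obtain ⟨y, hy, hyd⟩ := hne i hx
      refine ⟨y, hy, x - y, ?_, by simp⟩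
      rw [mem_ball_zero_iff]
      have h1 := hVx i x hi
      rw [norm_sub_rev] at hyd
      have h3 := norm_sub_le_norm_sub_add_norm_sub x (xb i) y
      linarith
    · exact absurd (hout x hxu) hx
  · intro p h hp hh hh'
    have hfar : ∀ i, u i ≠ 0 → ∀ y, y ∉ (Ω + Metric.ball (0 : EuclideanSpace ℝ (Fin d)) 3) →
        2 < ‖xt i - y‖ := by
      intro i hi y hy
      by_contra hcon
      push Not at hcon
      obtain ⟨w, hw, hwd⟩ := hne i hi
      apply hy
      refine ⟨w, hw, y - w, ?_, by simp⟩
      rw [mem_ball_zero_iff]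
      have h2 := hxt i
      rw [norm_sub_rev] at hcon hwd
      have h3 := norm_sub_le_norm_sub_add_norm_sub y (xt i) w
      have h4 := norm_sub_le_norm_sub_add_norm_sub (xt i) (xb i) w
      linarith
    have hp0 : p ≠ 0 := by linarith
    let c : V → V → ℝ := fun i j => φ (xt i - xt j) / (‖xt i - xt j‖ + h) ^ d * |u i - u j| ^ p
    have hc0 : ∀ i j, 0 ≤ c i j := fun i j =>
      mul_nonneg (div_nonneg (hφ0 _) (by positivity)) (by positivity)
    have hae : ∀ᵐ x : EuclideanSpace ℝ (Fin d),
        x ∉ (Ω + Metric.ball (0 : EuclideanSpace ℝ (Fin d)) 3) \ (⋃ i, Vs i) :=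
      measure_eq_zero_iff_ae_notMem.1 hVn
    let g : EuclideanSpace ℝ (Fin d) → EuclideanSpace ℝ (Fin d) → ℝ≥0∞ := fun x y =>
      ∑ i, Set.indicator (Vs i) (fun _ =>
        ∑ j, Set.indicator (Vs j) (fun _ => ENNReal.ofReal (c i j)) y) x
    have hgin : ∀ i, ∀ x ∈ Vs i, ∀ y, g x y =
        ∑ j, Set.indicator (Vs j) (fun _ => ENNReal.ofReal (c i j)) y := by
      intro i x hx y
      simp only [g]
      rw [Finset.sum_eq_single i]
      · simp [hx]
      · intro j _ hj
        exact Set.indicator_of_notMem (fun h => (Set.disjoint_left.1 (hVd j i hj)) h hx) _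
      · simp
    have hgout : ∀ x, x ∉ (⋃ i, Vs i) → ∀ y, g x y = 0 := by
      intro x hx y
      refine Finset.sum_eq_zero fun j _ => Set.indicator_of_notMem (fun h => hx ?_) _
      exact Set.mem_iUnion.2 ⟨j, h⟩
    have hpt : ∀ x y, x ∉ (Ω + Metric.ball (0 : EuclideanSpace ℝ (Fin d)) 3) \ (⋃ i, Vs i) →
        y ∉ (Ω + Metric.ball (0 : EuclideanSpace ℝ (Fin d)) 3) \ (⋃ i, Vs i) →
        ENNReal.ofReal
                (φ (f x - f y) / (‖f x - f y‖ + h) ^ d *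
                  |(∑ i, Set.indicator (Vs i) (fun _ => u i) x) -
                    ∑ i, Set.indicator (Vs i) (fun _ => u i) y| ^ p) = g x y := by
      intro x y hx hy
      by_cases hxu : x ∈ ⋃ i, Vs i
      · obtain ⟨i, hi⟩ := Set.mem_iUnion.1 hxu
        rw [hgin i x hi, hin i x hi, hfV i x hi]
        by_cases hyu : y ∈ ⋃ i, Vs i
        · obtain ⟨j, hj⟩ := Set.mem_iUnion.1 hyu
          rw [hin j y hj, hfV j y hj, Finset.sum_eq_single j]
          · simp [hj, c]
          · intro k _ hk
            exact Set.indicator_of_notMem (fun h => (Set.disjoint_left.1 (hVd k j hk)) h hj) _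
          · simp
        · rw [hout y hyu, hfn y hyu, Finset.sum_eq_zero]
          · by_cases hui : u i = 0
            · simp [hui, Real.zero_rpow hp0]
            · have := hφzero _ (hfar i hui y fun h => hy ⟨h, hyu⟩)
              simp [this]
          · exact fun j _ => Set.indicator_of_notMem (fun h => hyu (Set.mem_iUnion.2 ⟨j, h⟩)) _
      · rw [hgout x hxu, hout x hxu, hfn x hxu]
        by_cases hyu : y ∈ ⋃ i, Vs i
        · obtain ⟨j, hj⟩ := Set.mem_iUnion.1 hyu
          rw [hin j y hj, hfV j y hj]
          by_cases huj : u j = 0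
          · simp [huj, Real.zero_rpow hp0]
          · have h1 := hfar j huj x fun h => hx ⟨h, hxu⟩
            rw [norm_sub_rev] at h1
            simp [hφzero _ h1]
        · rw [hout y hyu]
          simp [Real.zero_rpow hp0]
    have hstep : ∀ᵐ x : EuclideanSpace ℝ (Fin d), ∫⁻ y, ENNReal.ofReal
                (φ (f x - f y) / (‖f x - f y‖ + h) ^ d *
                  |(∑ i, Set.indicator (Vs i) (fun _ => u i) x) -
                    ∑ i, Set.indicator (Vs i) (fun _ => u i) y| ^ p) =
          ∑ i, Set.indicator (Vs i) (fun _ =>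
            ∑ j, ENNReal.ofReal (c i j) * ENNReal.ofReal (π j)) x := by
      filter_upwards [hae] with x hx
      have h1 : ∫⁻ y, ENNReal.ofReal
                (φ (f x - f y) / (‖f x - f y‖ + h) ^ d *
                  |(∑ i, Set.indicator (Vs i) (fun _ => u i) x) -
                    ∑ i, Set.indicator (Vs i) (fun _ => u i) y| ^ p) = ∫⁻ y, g x y := by
        refine lintegral_congr_ae ?_
        filter_upwards [hae] with y hy
        exact hpt x y hx hy
      rw [h1]
      by_cases hxu : x ∈ ⋃ i, Vs i
      · obtain ⟨i, hi⟩ := Set.mem_iUnion.1 hxu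
        simp_rw [hgin i x hi]
        have h2 : ∑ k, Set.indicator (Vs k) (fun _ =>
            ∑ j, ENNReal.ofReal (c k j) * ENNReal.ofReal (π j)) x =
            ∑ j, ENNReal.ofReal (c i j) * ENNReal.ofReal (π j) := by
          rw [Finset.sum_eq_single i]
          · rw [Set.indicator_of_mem hi]
          · intro j _ hj
            exact Set.indicator_of_notMem (fun h => (Set.disjoint_left.1 (hVd j i hj)) h hi) _
          · simp
        rw [h2, lintegral_finsetSum _ (fun j _ => measurable_const.indicator (hVm j))]
        refine Finset.sum_congr rfl fun j _ => ?_
        rw [lintegral_indicator_const (hVm j), hVv]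
      · simp_rw [hgout x hxu]
        rw [Finset.sum_eq_zero]
        · simp
        · exact fun j _ => Set.indicator_of_notMem (fun h => hxu (Set.mem_iUnion.2 ⟨j, h⟩)) _
    rw [lintegral_congr_ae hstep,
      lintegral_finsetSum _ (fun j _ => measurable_const.indicator (hVm j))]
    have hterm : ∀ i j, 0 ≤ c i j * π i * π j := fun i j =>
      mul_nonneg (mul_nonneg (hc0 i j) (hπpos i).le) (hπpos j).le
    change _ = ENNReal.ofReal (∑ i, ∑ j, c i j * π i * π j)
    rw [ENNReal.ofReal_sum_of_nonneg fun i _ => Finset.sum_nonneg fun j _ => hterm i j]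
    refine Finset.sum_congr rfl fun i _ => ?_
    rw [lintegral_indicator_const (hVm i), hVv, ENNReal.ofReal_sum_of_nonneg fun j _ => hterm i j,
      Finset.sum_mul]
    refine Finset.sum_congr rfl fun j _ => ?_
    rw [ENNReal.ofReal_mul (mul_nonneg (hc0 i j) (hπpos i).le), ENNReal.ofReal_mul (hc0 i j)]
    ring
end

section
/- Let Ω ⊆ ℝ^d, 1 ≤ p < ∞, 0 < θ < 1 and 0 < h₀ < 1/2. Consider a mesh datum with δx < h₂ < 1/16 and h₂ ≤ h₀/4, such that Σ_{i∈V} χ_i(x) ≤ 1 for every x ∈ ℝ^d and Σ_{i∈V} χ_i(x) = 1 for every x ∈ Ω + B(0,4). Let u : V → ℝ with u_i = 0 whenever supp χ_i is not contained in Ω. Let x̃^{(1)}, x̃^{(2)} ∈ (ℝ^d)^V be two families of virtual coordinates satisfying |x̃_i^{(k)} − x_i| < h₂ for all i ∈ V and k = 1,2. Then ‖u‖_{h₀,p,θ;x̃^{(2)}} ≤ (1 + C·h₂/h₀)·‖u‖_{h₀,p,θ;x̃^{(1)}}, where the constant C depends only on d, p and φ. -/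
open MeasureTheory
open scoped ENNReal Pointwise

namespace DSE

set_option linter.unusedSectionVars false

lemma pow_tri (p : ℝ) (hp : 1 ≤ p) (a b c : ℝ) :
    |a - b| ^ p ≤ 2 ^ p * (|a - c| ^ p + |c - b| ^ p) := by
  have h1 : |a - b| ≤ |a - c| + |c - b| := abs_sub_le a c b
  have h2 : |a - b| ^ p ≤ (|a - c| + |c - b|) ^ p :=
    Real.rpow_le_rpow (abs_nonneg _) h1 (by linarith)
  have h3 := NNReal.rpow_add_le_mul_rpow_add_rpow ⟨|a - c|, abs_nonneg _⟩ ⟨|c - b|, abs_nonneg _⟩ hp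
  have h4 : (|a - c| + |c - b|) ^ p ≤ 2 ^ (p - 1) * (|a - c| ^ p + |c - b| ^ p) := by
    exact_mod_cast h3
  have h5 : (2:ℝ) ^ (p - 1) ≤ 2 ^ p := Real.rpow_le_rpow_of_exponent_le (by norm_num) (by linarith)
  have h6 : 0 ≤ |a - c| ^ p + |c - b| ^ p := by positivity
  exact h2.trans (h4.trans (mul_le_mul_of_nonneg_right h5 h6))

variable {E : Type*} [NormedAddCommGroup E] [NormedSpace ℝ E]

/-- indicator of a pair at distance at most `r` -/
noncomputable def ind (a b : E) (r : ℝ) : ℝ := if ‖a - b‖ ≤ r then 1 else 0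

lemma ind_nonneg (a b : E) (r : ℝ) : 0 ≤ ind a b r := by
  unfold ind; split_ifs <;> norm_num

lemma ind_mono (a b : E) {r s : ℝ} (h : r ≤ s) : ind a b r ≤ ind a b s := by
  unfold ind
  split_ifs with h1 h2
  · exact le_rfl
  · exact absurd (h1.trans h) h2
  · norm_num
  · exact le_rfl

lemma ind_comm (a b : E) (r : ℝ) : ind a b r = ind b a r := by
  unfold ind; rw [norm_sub_rev]

/-- truncated energy -/
noncomputable def S {V : Type} [Fintype V] (z : V → E) (π u : V → ℝ) (p r : ℝ) : ℝ :=
  ∑ i, ∑ j, ind (z i) (z j) r * (|u i - u j| ^ p * π i * π j)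

lemma S_mono {V : Type} [Fintype V] (z : V → E) (π u : V → ℝ) (hπ : ∀ i, 0 < π i) (p : ℝ)
    {r s : ℝ} (h : r ≤ s) : S z π u p r ≤ S z π u p s := by
  unfold S
  refine Finset.sum_le_sum fun i _ => Finset.sum_le_sum fun j _ => ?_
  have := (hπ i).le
  have := (hπ j).le
  exact mul_le_mul_of_nonneg_right (ind_mono _ _ h) (by positivity)

lemma chain {V : Type} [Fintype V] (z : V → E) (π u : V → ℝ) (hπ : ∀ i, 0 < π i)
    (p : ℝ) (hp : 1 ≤ p) (v U R : ℝ)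
    (hup : ∀ i, ∑ j, ind (z i) (z j) R * π j ≤ U)
    (hlow : ∀ i j, ‖z i - z j‖ ≤ R → u i ≠ u j →
      v ≤ ∑ k, ind (z k) (midpoint ℝ (z i) (z j)) (1/4) * π k) :
    v * S z π u p R ≤ 2 * 2 ^ p * U * S z π u p (R / 2 + 1 / 4) := by
  set R' := R / 2 + 1 / 4 with hR'
  have hpt : ∀ i j, v * (ind (z i) (z j) R * (|u i - u j| ^ p * π i * π j)) ≤
      ∑ k, (2 ^ p * (ind (z i) (z k) R' * (|u i - u k| ^ p * π i * π k) *
          (ind (z i) (z j) R * π j)) +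
        2 ^ p * (ind (z j) (z k) R' * (|u j - u k| ^ p * π j * π k) *
          (ind (z j) (z i) R * π i))) := by
    intro i j
    have hi := hπ i
    have hj := hπ j
    have hRHS : ∀ k, 0 ≤ (2 ^ p * (ind (z i) (z k) R' * (|u i - u k| ^ p * π i * π k) *
          (ind (z i) (z j) R * π j)) +
        2 ^ p * (ind (z j) (z k) R' * (|u j - u k| ^ p * π j * π k) *
          (ind (z j) (z i) R * π i))) := by
      intro k
      have hk := hπ k
      have a1 := ind_nonneg (z i) (z k) R'
      have a2 := ind_nonneg (z i) (z j) R
      have a3 := ind_nonneg (z j) (z k) R'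
      have a4 := ind_nonneg (z j) (z i) R
      positivity
    by_cases hR : ‖z i - z j‖ ≤ R
    swap
    · have : ind (z i) (z j) R = 0 := by unfold ind; rw [if_neg hR]
      rw [this]
      simp only [zero_mul, mul_zero]
      rw [this] at hRHS
      simp only [zero_mul, mul_zero] at hRHS
      exact Finset.sum_nonneg fun k _ => hRHS k
    by_cases hu : u i = u j
    · rw [hu, sub_self, abs_zero, Real.zero_rpow (by linarith)]
      simp only [zero_mul, mul_zero]
      rw [hu] at hRHS
      exact Finset.sum_nonneg fun k _ => hRHS k
    have h1 : ind (z i) (z j) R = 1 := by unfold ind; rw [if_pos hR]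
    have h2 : ind (z j) (z i) R = 1 := by rw [ind_comm, h1]
    rw [h1, h2]
    have hl := hlow i j hR hu
    have h0 : 0 ≤ 1 * (|u i - u j| ^ p * π i * π j) := by positivity
    refine (mul_le_mul_of_nonneg_right hl h0).trans ?_
    rw [Finset.sum_mul]
    refine Finset.sum_le_sum fun k _ => ?_
    have hk := hπ k
    by_cases hm : ‖z k - midpoint ℝ (z i) (z j)‖ ≤ 1 / 4
    swap
    · have : ind (z k) (midpoint ℝ (z i) (z j)) (1/4) = 0 := by unfold ind; rw [if_neg hm]
      rw [this]
      have := hRHS k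
      rw [h1, h2] at this
      simpa using this
    have e1 : ind (z k) (midpoint ℝ (z i) (z j)) (1/4) = 1 := by unfold ind; rw [if_pos hm]
    have d1 : ‖z i - midpoint ℝ (z i) (z j)‖ ≤ R / 2 := by
      rw [left_sub_midpoint, norm_smul]
      rw [show ‖(⅟2 : ℝ)‖ = 1 / 2 by simp]
      linarith
    have d2 : ‖z j - midpoint ℝ (z i) (z j)‖ ≤ R / 2 := by
      rw [right_sub_midpoint, norm_smul, norm_sub_rev]
      rw [show ‖(⅟2 : ℝ)‖ = 1 / 2 by simp]
      linarith
    have key : ∀ w : E, ‖w - midpoint ℝ (z i) (z j)‖ ≤ R / 2 → ind w (z k) R' = 1 := by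
      intro w hw
      unfold ind
      rw [if_pos]
      have := norm_sub_le (w - midpoint ℝ (z i) (z j)) (z k - midpoint ℝ (z i) (z j))
      rw [sub_sub_sub_cancel_right] at this
      linarith
    rw [e1, key _ d1, key _ d2]
    have ht := pow_tri p hp (u i) (u j) (u k)
    rw [abs_sub_comm (u k) (u j)] at ht
    have hpp : 0 ≤ π k * π i * π j := by positivity
    have := mul_le_mul_of_nonneg_right ht hpp
    nlinarith [this]
  have hsum : v * S z π u p R ≤ ∑ i, ∑ j, ∑ k,
      (2 ^ p * (ind (z i) (z k) R' * (|u i - u k| ^ p * π i * π k) *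
          (ind (z i) (z j) R * π j)) +
        2 ^ p * (ind (z j) (z k) R' * (|u j - u k| ^ p * π j * π k) *
          (ind (z j) (z i) R * π i))) := by
    unfold S
    rw [Finset.mul_sum]
    refine Finset.sum_le_sum fun i _ => ?_
    rw [Finset.mul_sum]
    exact Finset.sum_le_sum fun j _ => hpt i j
  have hA : ∑ i, ∑ j, ∑ k, (2 ^ p * (ind (z i) (z k) R' * (|u i - u k| ^ p * π i * π k) *
          (ind (z i) (z j) R * π j))) ≤ 2 ^ p * U * S z π u p R' := by
    unfold S
    rw [Finset.mul_sum]
    refine Finset.sum_le_sum fun i _ => ?_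
    rw [Finset.sum_comm, Finset.mul_sum]
    refine Finset.sum_le_sum fun k _ => ?_
    rw [← Finset.mul_sum, ← Finset.mul_sum, mul_assoc (2 ^ p) U, mul_comm U]
    have hi := hπ i
    have hk := hπ k
    have a1 := ind_nonneg (z i) (z k) R'
    refine mul_le_mul_of_nonneg_left ?_ (by positivity)
    exact mul_le_mul_of_nonneg_left (hup i) (by positivity)
  simp only [Finset.sum_add_distrib] at hsum
  have hB : ∑ i, ∑ j, ∑ k, (2 ^ p * (ind (z j) (z k) R' * (|u j - u k| ^ p * π j * π k) *
          (ind (z j) (z i) R * π i))) ≤ 2 ^ p * U * S z π u p R' := by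
    rw [Finset.sum_comm]; exact hA
  linarith

lemma kernel_pt (d : ℕ) (φ : E → ℝ) (hφ0 : ∀ x, 0 ≤ φ x) (hφ1 : ∀ x, φ x ≤ 1)
    (hφone : ∀ x : E, ‖x‖ ≤ 1 → φ x = 1) (hφzero : ∀ x : E, 2 < ‖x‖ → φ x = 0)
    (L : ℝ) (hL0 : 0 ≤ L) (hL : ∀ x y, |φ x - φ y| ≤ L * ‖x - y‖)
    (h₀ h₂ h : ℝ) (hh0 : 0 < h₀) (hh2 : 0 < h₂) (hh16 : h₂ < 1 / 16)
    (hh : h₀ ≤ h) (a b a' b' : E) (hab : ‖(a' - b') - (a - b)‖ ≤ 4 * h₂) :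
    φ (a' - b') / (‖a' - b'‖ + h) ^ d ≤ (1 + 4 * h₂ / h₀) ^ d *
      (φ (a - b) / (‖a - b‖ + h) ^ d + 4 * L * h₂ * ind a b (9 / 4)) := by
  unfold ind
  generalize a' - b' = y at *
  generalize a - b = x at *
  have hn1 : ‖x‖ ≤ ‖y‖ + 4 * h₂ := by
    have := norm_sub_norm_le x y
    rw [norm_sub_rev] at this
    linarith
  have hn2 : ‖y‖ ≤ ‖x‖ + 4 * h₂ := by
    have := norm_sub_norm_le y x
    linarith
  have hx0 := norm_nonneg x
  have hy0 := norm_nonneg y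
  have hφy := hφ0 y
  have hφx := hφ0 x
  have hx : 0 < ‖x‖ + h := by linarith
  have hy : 0 < ‖y‖ + h := by linarith
  have hr : ‖x‖ + h ≤ (1 + 4 * h₂ / h₀) * (‖y‖ + h) := by
    have h3 : 4 * h₂ ≤ 4 * h₂ / h₀ * (‖y‖ + h) := by
      rw [div_mul_eq_mul_div, le_div_iff₀ hh0]
      exact mul_le_mul_of_nonneg_left (by linarith) (by linarith)
    linarith
  have hrd : (‖x‖ + h) ^ d ≤ (1 + 4 * h₂ / h₀) ^ d * (‖y‖ + h) ^ d := by
    rw [← mul_pow]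
    exact pow_le_pow_left₀ hx.le hr d
  have step1 : φ y / (‖y‖ + h) ^ d ≤ (1 + 4 * h₂ / h₀) ^ d * (φ y / (‖x‖ + h) ^ d) := by
    rw [← mul_div_assoc, div_le_div_iff₀ (by positivity) (by positivity)]
    nlinarith [mul_le_mul_of_nonneg_left hrd hφy]
  refine step1.trans (mul_le_mul_of_nonneg_left ?_ (by positivity))
  by_cases h1 : ‖x‖ ≤ 1
  · have : φ y / (‖x‖ + h) ^ d ≤ φ x / (‖x‖ + h) ^ d := by
      rw [hφone x h1]
      exact div_le_div_of_nonneg_right (hφ1 y) (by positivity)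
    have h5 : (0:ℝ) ≤ if ‖x‖ ≤ 9 / 4 then 1 else 0 := by split_ifs <;> norm_num
    have : 0 ≤ 4 * L * h₂ * if ‖x‖ ≤ 9 / 4 then 1 else 0 := by positivity
    linarith
  by_cases h2 : ‖x‖ ≤ 9 / 4
  · rw [if_pos h2]
    have h3 : φ y ≤ φ x + 4 * L * h₂ := by
      have := (abs_le.1 (hL y x)).2
      nlinarith [mul_le_mul_of_nonneg_left hab hL0]
    have h4 : 1 ≤ (‖x‖ + h) ^ d := one_le_pow₀ (by linarith)
    calc φ y / (‖x‖ + h) ^ d ≤ (φ x + 4 * L * h₂) / (‖x‖ + h) ^ d :=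
          div_le_div_of_nonneg_right h3 (by positivity)
      _ = φ x / (‖x‖ + h) ^ d + 4 * L * h₂ / (‖x‖ + h) ^ d := add_div _ _ _
      _ ≤ _ := by
          have : 4 * L * h₂ / (‖x‖ + h) ^ d ≤ 4 * L * h₂ := div_le_self (by positivity) h4
          linarith
  · rw [if_neg h2, hφzero y (by linarith)]
    simp only [zero_div, mul_zero, add_zero]
    positivity

lemma one_add_pow_le (d : ℕ) (t : ℝ) (h0 : 0 ≤ t) (h1 : t ≤ 1) : (1 + t) ^ d ≤ 1 + 2 ^ d * t := by
  have key : (1 + t) ^ d ≤ 1 + (2 ^ d - 1) * t := by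
    induction d with
    | zero => simp
    | succ n ih =>
      have h2 : (1:ℝ) ≤ 2 ^ n := one_le_pow₀ (by norm_num)
      rw [pow_succ, pow_succ]
      have := mul_le_mul_of_nonneg_right ih (by linarith : 0 ≤ 1 + t)
      have h3 : (2 ^ n - 1) * (t * t) ≤ (2 ^ n - 1) * t :=
        mul_le_mul_of_nonneg_left (by nlinarith) (by linarith)
      nlinarith
  linarith

variable [MeasurableSpace E] [BorelSpace E] [FiniteDimensional ℝ E]
  (μ : Measure E) [μ.IsAddHaarMeasure]

lemma mass_upper {V : Type} [Fintype V] (χ : V → E → ℝ) (π : V → ℝ) (z : V → E)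
    (hi : ∀ i, Integrable (χ i) μ) (h0 : ∀ i x, 0 ≤ χ i x)
    (hπ : ∀ i, π i = ∫ x, χ i x ∂μ) (hsum : ∀ x, ∑ i, χ i x ≤ 1)
    (hc : ∀ i x, χ i x ≠ 0 → ‖x - z i‖ ≤ 1 / 8) (c : E) (R : ℝ) :
    ∑ j, ind c (z j) R * π j ≤ μ.real (Metric.closedBall 0 (R + 1 / 8)) := by
  have e : ∑ j, ind c (z j) R * π j = ∫ x, ∑ j, ind c (z j) R * χ j x ∂μ := by
    rw [integral_finsetSum _ (fun j _ => (hi j).const_mul _)]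
    refine Finset.sum_congr rfl fun j _ => ?_
    rw [integral_const_mul, hπ]
  rw [e, ← Measure.addHaar_real_closedBall_center μ c, ← integral_indicator_one measurableSet_closedBall]
  refine integral_mono (integrable_finsetSum _ (fun j _ => (hi j).const_mul _)) ?_ ?_
  · exact (integrable_indicator_iff measurableSet_closedBall).2
      (integrableOn_const (measure_closedBall_lt_top.ne))
  intro x
  by_cases hx : x ∈ Metric.closedBall c (R + 1 / 8)
  · simp only [Set.indicator_of_mem hx, Pi.one_apply]
    refine le_trans (Finset.sum_le_sum fun j _ => ?_) (hsum x)
    have : ind c (z j) R ≤ 1 := by unfold ind; split_ifs <;> norm_num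
    exact mul_le_of_le_one_left (h0 j x) this
  · simp only [Set.indicator_of_notMem hx]
    refine (Finset.sum_eq_zero fun j _ => ?_).le
    by_contra hne
    have hne' := mul_ne_zero_iff.1 hne
    have h1 : ‖c - z j‖ ≤ R := by
      by_contra h
      exact hne'.1 (by unfold ind; rw [if_neg h])
    have h2 := hc j x hne'.2
    apply hx
    rw [Metric.mem_closedBall, dist_eq_norm]
    have := norm_sub_le (x - z j) (c - z j)
    rw [sub_sub_sub_cancel_right] at this
    linarith

lemma mass_lower {V : Type} [Fintype V] (χ : V → E → ℝ) (π : V → ℝ) (z : V → E)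
    (hi : ∀ i, Integrable (χ i) μ) (h0 : ∀ i x, 0 ≤ χ i x)
    (hπ : ∀ i, π i = ∫ x, χ i x ∂μ)
    (hc : ∀ i x, χ i x ≠ 0 → ‖x - z i‖ ≤ 1 / 8) (m : E)
    (hsum : ∀ x, ‖x - m‖ ≤ 1 / 8 → ∑ i, χ i x = 1) :
    μ.real (Metric.closedBall 0 (1 / 8)) ≤ ∑ k, ind (z k) m (1 / 4) * π k := by
  have e : ∑ j, ind (z j) m (1 / 4) * π j = ∫ x, ∑ j, ind (z j) m (1 / 4) * χ j x ∂μ := by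
    rw [integral_finsetSum _ (fun j _ => (hi j).const_mul _)]
    refine Finset.sum_congr rfl fun j _ => ?_
    rw [integral_const_mul, hπ]
  rw [e, ← Measure.addHaar_real_closedBall_center μ m, ← integral_indicator_one measurableSet_closedBall]
  refine integral_mono ?_ (integrable_finsetSum _ (fun j _ => (hi j).const_mul _)) ?_
  · exact (integrable_indicator_iff measurableSet_closedBall).2
      (integrableOn_const (measure_closedBall_lt_top.ne))
  intro x
  by_cases hx : x ∈ Metric.closedBall m (1 / 8)
  · simp only [Set.indicator_of_mem hx, Pi.one_apply]
    rw [Metric.mem_closedBall, dist_eq_norm] at hx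
    refine (hsum x hx).symm.le.trans ?_
    refine Finset.sum_le_sum fun j _ => ?_
    by_cases hz : χ j x = 0
    · simp [hz]
    have h2 := hc j x hz
    have : ind (z j) m (1 / 4) = 1 := by
      unfold ind
      rw [if_pos]
      have := norm_sub_le (x - m) (x - z j)
      rw [sub_sub_sub_cancel_left] at this
      linarith
    rw [this, one_mul]
  · simp only [Set.indicator_of_notMem hx]
    exact Finset.sum_nonneg fun j _ => mul_nonneg (ind_nonneg _ _ _) (h0 j x)

lemma bary (χ : E → ℝ) (π : ℝ) (xb : E) (hm : Measurable χ) (h0 : ∀ x, 0 ≤ χ x)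
    (hb : Bornology.IsBounded (tsupport χ)) (hπ : π = ∫ x, χ x ∂μ) (hpos : 0 < π)
    (hi : Integrable χ μ)
    (hxb : xb = π⁻¹ • ∫ x, χ x • x ∂μ) (δ : ℝ) (hδ : Metric.diam (tsupport χ) ≤ δ)
    (y : E) (hy : χ y ≠ 0) : ‖y - xb‖ ≤ δ := by
  have hd : ∀ x, χ x ≠ 0 → ‖x - y‖ ≤ δ := by
    intro x hx
    rw [← dist_eq_norm]
    exact (Metric.dist_le_diam_of_mem hb (subset_tsupport _ hx) (subset_tsupport _ hy)).trans hδ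
  have hbd : ∀ x, ‖χ x • (x - y)‖ ≤ χ x * δ := by
    intro x
    rw [norm_smul, Real.norm_of_nonneg (h0 x)]
    by_cases hx : χ x = 0
    · simp [hx]
    · exact mul_le_mul_of_nonneg_left (hd x hx) (h0 x)
  have hmeas : AEStronglyMeasurable (fun x => χ x • (x - y)) μ := by
    have : Measurable (fun x => χ x • (x - y)) := by fun_prop
    exact this.aestronglyMeasurable
  have hint : Integrable (fun x => χ x • (x - y)) μ :=
    (hi.mul_const δ).mono' hmeas (Filter.Eventually.of_forall hbd)
  have e : ∫ x, χ x • x ∂μ = (∫ x, χ x • (x - y) ∂μ) + π • y := by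
    rw [hπ, ← integral_smul_const, ← integral_add hint (hi.smul_const y)]
    congr 1
    ext x
    rw [smul_sub, sub_add_cancel]
  have e2 : xb - y = π⁻¹ • ∫ x, χ x • (x - y) ∂μ := by
    rw [hxb, e, smul_add, inv_smul_smul₀ hpos.ne', add_sub_cancel_right]
  rw [norm_sub_rev, e2, norm_smul, Real.norm_of_nonneg (inv_nonneg.2 hpos.le)]
  have : ‖∫ x, χ x • (x - y) ∂μ‖ ≤ π * δ := by
    rw [hπ, ← integral_mul_const]
    exact norm_integral_le_of_norm_le (hi.mul_const δ) (Filter.Eventually.of_forall hbd)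
  calc π⁻¹ * ‖∫ x, χ x • (x - y) ∂μ‖ ≤ π⁻¹ * (π * δ) :=
        mul_le_mul_of_nonneg_left this (inv_nonneg.2 hpos.le)
    _ = δ := by field_simp

end DSE

/-- Equivalence of the discrete kernel semi-norms associated with two families of
virtual coordinates that are both close to the barycenters. -/
theorem discrete_seminorm_equivalence (d : ℕ) (hd : 1 ≤ d)
    (φ : EuclideanSpace ℝ (Fin d) → ℝ)
    (hφs : ContDiff ℝ (⊤ : ℕ∞) φ)
    (hφ0 : ∀ x, 0 ≤ φ x) (hφ1 : ∀ x, φ x ≤ 1)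
    (hφrad : ∀ x y : EuclideanSpace ℝ (Fin d), ‖x‖ = ‖y‖ → φ x = φ y)
    (hφone : ∀ x : EuclideanSpace ℝ (Fin d), ‖x‖ ≤ 1 → φ x = 1)
    (hφzero : ∀ x : EuclideanSpace ℝ (Fin d), 2 < ‖x‖ → φ x = 0)
    (p : ℝ) (hp : 1 ≤ p) :
    ∃ C : ℝ, 0 < C ∧
      ∀ (Ω : Set (EuclideanSpace ℝ (Fin d))) (θ h₀ h₂ : ℝ),
        0 < θ → θ < 1 → 0 < h₀ → h₀ < 1 / 2 →
      ∀ (V : Type) [Fintype V]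
        (χ : V → EuclideanSpace ℝ (Fin d) → ℝ)
        (π : V → ℝ) (xb : V → EuclideanSpace ℝ (Fin d)) (δx : ℝ),
        (∀ i, Measurable (χ i)) →
        (∀ i x, 0 ≤ χ i x) → (∀ i x, χ i x ≤ 1) →
        (∀ i, Bornology.IsBounded (tsupport (χ i))) →
        (∀ i, π i = ∫ x, χ i x) → (∀ i, 0 < π i) →
        (∀ i, xb i = (π i)⁻¹ • ∫ x, χ i x • x) →
        0 < δx → (∀ i, Metric.diam (tsupport (χ i)) ≤ δx) →
        δx < h₂ → h₂ < 1 / 16 → h₂ ≤ h₀ / 4 →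
        (∀ x, ∑ i, χ i x ≤ 1) →
        (∀ x ∈ Ω + Metric.ball (0 : EuclideanSpace ℝ (Fin d)) 4, ∑ i, χ i x = 1) →
      ∀ u : V → ℝ, (∀ i, ¬ tsupport (χ i) ⊆ Ω → u i = 0) →
      ∀ xt₁ xt₂ : V → EuclideanSpace ℝ (Fin d),
        (∀ i, ‖xt₁ i - xb i‖ < h₂) → (∀ i, ‖xt₂ i - xb i‖ < h₂) →
        (⨆ h : Set.Icc h₀ (1 / 2 : ℝ),
            |Real.log (h : ℝ)| ^ (-θ) * ∑ i, ∑ j,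
              φ (xt₂ i - xt₂ j) / (‖xt₂ i - xt₂ j‖ + (h : ℝ)) ^ d *
                |u i - u j| ^ p * π i * π j) ^ (1 / p)
          ≤ (1 + C * h₂ / h₀) *
            (⨆ h : Set.Icc h₀ (1 / 2 : ℝ),
              |Real.log (h : ℝ)| ^ (-θ) * ∑ i, ∑ j,
                φ (xt₁ i - xt₁ j) / (‖xt₁ i - xt₁ j‖ + (h : ℝ)) ^ d *
                  |u i - u j| ^ p * π i * π j) ^ (1 / p) := by
  classical
  obtain ⟨L, hL⟩ : ∃ L, LipschitzWith L φ :=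
    ContDiff.lipschitzWith_of_hasCompactSupport (𝕂 := ℝ)
      (HasCompactSupport.intro (isCompact_closedBall (0 : EuclideanSpace ℝ (Fin d)) 2)
        (fun x hx => hφzero x (by simpa using hx))) hφs (by simp)
  have hL' : ∀ x y, |φ x - φ y| ≤ (L : ℝ) * ‖x - y‖ := by
    intro x y
    have := hL.dist_le_mul x y
    rwa [Real.dist_eq, dist_eq_norm] at this
  have hL0 : (0 : ℝ) ≤ L := L.2
  set vol := (volume : Measure (EuclideanSpace ℝ (Fin d))) with hvol
  set v := vol.real (Metric.closedBall 0 (1 / 8)) with hv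
  set U := vol.real (Metric.closedBall 0 3) with hU
  have hv0 : 0 < v :=
    ENNReal.toReal_pos (Metric.measure_closedBall_pos _ _ (by norm_num)).ne'
      measure_closedBall_lt_top.ne
  have hU0 : 0 ≤ U := measureReal_nonneg
  set A := 2 * 2 ^ p * U / v with hA
  have hA0 : 0 ≤ A := by positivity
  set B := 4 * (L : ℝ) * (A * A) * 2 ^ d with hB
  have hB0 : 0 ≤ B := by positivity
  refine ⟨4 * 2 ^ d + B + 4 * 2 ^ d * B, by positivity, ?_⟩
  intro Ω θ h₀ h₂ hθ0 hθ1 hh0 hh0' V _ χ π xb δx hχm hχ0 hχ1 hχb hπ hπ0 hxb hδ0 hδ hδ2 h216 h204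
    hsum hsum1 u hu xt₁ xt₂ hx1 hx2
  have hh2 : 0 < h₂ := hδ0.trans hδ2
  have hint : ∀ i, Integrable (χ i) vol := by
    intro i
    by_contra hni
    have := integral_undef hni
    have h1 := hπ0 i
    rw [hπ i] at h1
    exact h1.ne' this
  have hcb : ∀ i x, χ i x ≠ 0 → ‖x - xb i‖ ≤ δx := fun i x hx =>
    DSE.bary vol (χ i) (π i) (xb i) (hχm i) (hχ0 i) (hχb i) (hπ i) (hπ0 i) (hint i) (hxb i) δx
      (hδ i) x hx
  have hc : ∀ i x, χ i x ≠ 0 → ‖x - xt₁ i‖ ≤ 1 / 8 := by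
    intro i x hx
    have h1 := hcb i x hx
    have h2 := (hx1 i).le
    have := norm_sub_le (x - xb i) (xt₁ i - xb i)
    rw [sub_sub_sub_cancel_right] at this
    linarith
  -- points of Ω near cells with nonzero value
  have hnear : ∀ i, u i ≠ 0 → ∃ y ∈ Ω, ‖y - xt₁ i‖ ≤ 1 / 8 := by
    intro i hi
    have hsub : tsupport (χ i) ⊆ Ω := by
      by_contra h
      exact hi (hu i h)
    have : ∃ y, χ i y ≠ 0 := by
      by_contra h
      push Not at h
      have h1 := hπ0 i
      rw [hπ i] at h1
      simp [h] at h1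
    obtain ⟨y, hy⟩ := this
    exact ⟨y, hsub (subset_tsupport _ hy), hc i y hy⟩
  have hstep : ∀ R, 0 ≤ R → R ≤ 9 / 4 →
      DSE.S xt₁ π u p R ≤ A * DSE.S xt₁ π u p (R / 2 + 1 / 4) := by
    intro R hR0 hR
    have := DSE.chain xt₁ π u hπ0 p hp v U R ?_ ?_
    · rw [hA, div_mul_eq_mul_div, le_div_iff₀ hv0]
      linarith
    · intro i
      refine (DSE.mass_upper vol χ π xt₁ hint hχ0 hπ hsum hc (xt₁ i) R).trans ?_
      exact measureReal_mono (Metric.closedBall_subset_closedBall (by linarith))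
        measure_closedBall_lt_top.ne
    · intro i j hij huij
      refine DSE.mass_lower vol χ π xt₁ hint hχ0 hπ hc _ ?_
      intro x hx
      apply hsum1
      have d1 : ‖midpoint ℝ (xt₁ i) (xt₁ j) - xt₁ i‖ ≤ 9 / 8 := by
        rw [midpoint_sub_left, norm_smul, norm_sub_rev]
        rw [show ‖(⅟2 : ℝ)‖ = 1 / 2 by simp]
        linarith
      have d2 : ‖midpoint ℝ (xt₁ i) (xt₁ j) - xt₁ j‖ ≤ 9 / 8 := by
        rw [midpoint_sub_right, norm_smul]
        rw [show ‖(⅟2 : ℝ)‖ = 1 / 2 by simp]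
        linarith
      have fin : ∀ k, u k ≠ 0 → ‖midpoint ℝ (xt₁ i) (xt₁ j) - xt₁ k‖ ≤ 9 / 8 →
          x ∈ Ω + Metric.ball (0 : EuclideanSpace ℝ (Fin d)) 4 := by
        intro k hk hd
        obtain ⟨y, hy, hyk⟩ := hnear k hk
        refine Set.mem_add.2 ⟨y, hy, x - y, ?_, by abel⟩
        rw [mem_ball_zero_iff]
        have e : x - y = (x - midpoint ℝ (xt₁ i) (xt₁ j)) +
          (midpoint ℝ (xt₁ i) (xt₁ j) - xt₁ k) - (y - xt₁ k) := by abel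
        rw [e]
        have t1 := norm_sub_le ((x - midpoint ℝ (xt₁ i) (xt₁ j)) +
          (midpoint ℝ (xt₁ i) (xt₁ j) - xt₁ k)) (y - xt₁ k)
        have t2 := norm_add_le (x - midpoint ℝ (xt₁ i) (xt₁ j))
          (midpoint ℝ (xt₁ i) (xt₁ j) - xt₁ k)
        linarith
      by_cases hi : u i = 0
      · exact fin j (fun h => huij (hi.trans h.symm)) d2
      · exact fin i hi d1
  have hS : DSE.S xt₁ π u p (9 / 4) ≤ A * A * DSE.S xt₁ π u p 1 := by
    have s1 := hstep (9 / 4) (by norm_num) le_rfl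
    have s2 := hstep (9 / 4 / 2 + 1 / 4) (by norm_num) (by norm_num)
    have s3 := DSE.S_mono xt₁ π u hπ0 p
      (show ((9:ℝ) / 4 / 2 + 1 / 4) / 2 + 1 / 4 ≤ 1 by norm_num)
    calc _ ≤ _ := s1
      _ ≤ _ := mul_le_mul_of_nonneg_left (s2.trans (mul_le_mul_of_nonneg_left s3 hA0)) hA0
      _ = _ := by ring
  set T : (V → EuclideanSpace ℝ (Fin d)) → ℝ → ℝ := fun z h => ∑ i, ∑ j,
    φ (z i - z j) / (‖z i - z j‖ + h) ^ d * |u i - u j| ^ p * π i * π j with hT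
  have hT0 : ∀ z h, 0 ≤ h → 0 ≤ T z h := by
    intro z h hh
    refine Finset.sum_nonneg fun i _ => Finset.sum_nonneg fun j _ => ?_
    have := hπ0 i
    have := hπ0 j
    have := hφ0 (z i - z j)
    positivity
  have hST : ∀ h, 0 < h → h ≤ 1 / 2 → DSE.S xt₁ π u p 1 ≤ 2 ^ d * T xt₁ h := by
    intro h hh hh'
    simp only [hT, DSE.S]
    rw [Finset.mul_sum]
    refine Finset.sum_le_sum fun i _ => ?_
    rw [Finset.mul_sum]
    refine Finset.sum_le_sum fun j _ => ?_
    have a1 := hπ0 i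
    have a2 := hπ0 j
    have a3 := hφ0 (xt₁ i - xt₁ j)
    have key : DSE.ind (xt₁ i) (xt₁ j) 1 ≤
        2 ^ d * (φ (xt₁ i - xt₁ j) / (‖xt₁ i - xt₁ j‖ + h) ^ d) := by
      unfold DSE.ind
      split_ifs with h1
      · rw [hφone _ h1, ← mul_div_assoc, mul_one, le_div_iff₀ (by positivity), one_mul]
        exact pow_le_pow_left₀ (by positivity) (by linarith) d
      · positivity
    calc _ ≤ _ := mul_le_mul_of_nonneg_right key
          (show 0 ≤ |u i - u j| ^ p * π i * π j by positivity)
      _ = _ := by ring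
  set s := h₂ / h₀ with hs
  have hs0 : 0 < s := div_pos hh2 hh0
  have hs4 : 4 * s ≤ 1 := by
    rw [hs, ← mul_div_assoc, div_le_one hh0]; linarith
  have hs2 : h₂ ≤ s := by
    rw [hs, le_div_iff₀ hh0]; nlinarith
  set M := 1 + (4 * 2 ^ d + B + 4 * 2 ^ d * B) * s with hM
  have hM1 : 1 ≤ M := by
    have : 0 ≤ (4 * 2 ^ d + B + 4 * 2 ^ d * B) * s := by positivity
    linarith
  have hTT : ∀ h, h₀ ≤ h → h ≤ 1 / 2 → T xt₂ h ≤ M * T xt₁ h := by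
    intro h hh hh'
    have hpos : 0 < h := hh0.trans_le hh
    have b1 : T xt₂ h ≤ (1 + 4 * h₂ / h₀) ^ d *
        (T xt₁ h + 4 * L * h₂ * DSE.S xt₁ π u p (9 / 4)) := by
      simp only [hT, DSE.S]
      rw [Finset.mul_sum, ← Finset.sum_add_distrib, Finset.mul_sum]
      refine Finset.sum_le_sum fun i _ => ?_
      rw [Finset.mul_sum, ← Finset.sum_add_distrib, Finset.mul_sum]
      refine Finset.sum_le_sum fun j _ => ?_
      have a1 := hπ0 i
      have a2 := hπ0 j
      have hd : ‖(xt₂ i - xt₂ j) - (xt₁ i - xt₁ j)‖ ≤ 4 * h₂ := by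
        have e : (xt₂ i - xt₂ j) - (xt₁ i - xt₁ j) =
          ((xt₂ i - xb i) - (xt₁ i - xb i)) - ((xt₂ j - xb j) - (xt₁ j - xb j)) := by abel
        rw [e]
        have t1 := norm_sub_le ((xt₂ i - xb i) - (xt₁ i - xb i)) ((xt₂ j - xb j) - (xt₁ j - xb j))
        have t2 := norm_sub_le (xt₂ i - xb i) (xt₁ i - xb i)
        have t3 := norm_sub_le (xt₂ j - xb j) (xt₁ j - xb j)
        linarith [hx1 i, hx1 j, hx2 i, hx2 j]
      have key := DSE.kernel_pt d φ hφ0 hφ1 hφone hφzero L hL0 hL' h₀ h₂ h hh0 hh2 h216 hh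
        (xt₁ i) (xt₁ j) (xt₂ i) (xt₂ j) hd
      calc _ = φ (xt₂ i - xt₂ j) / (‖xt₂ i - xt₂ j‖ + h) ^ d *
            (|u i - u j| ^ p * π i * π j) := by ring
        _ ≤ _ := mul_le_mul_of_nonneg_right key
          (show 0 ≤ |u i - u j| ^ p * π i * π j by positivity)
        _ = _ := by ring
    have hTp := hT0 xt₁ h hpos.le
    have b2 : 4 * L * h₂ * DSE.S xt₁ π u p (9 / 4) ≤ B * s * T xt₁ h := by
      have c1 := hS.trans (mul_le_mul_of_nonneg_left (hST h hpos hh') (mul_nonneg hA0 hA0))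
      calc _ ≤ 4 * L * h₂ * (A * A * (2 ^ d * T xt₁ h)) :=
            mul_le_mul_of_nonneg_left c1 (by positivity)
        _ = (B * T xt₁ h) * h₂ := by rw [hB]; ring
        _ ≤ (B * T xt₁ h) * s := mul_le_mul_of_nonneg_left hs2 (by positivity)
        _ = _ := by ring
    have b3 : (1 + 4 * h₂ / h₀) ^ d ≤ 1 + 2 ^ d * (4 * s) := by
      rw [mul_div_assoc]
      exact DSE.one_add_pow_le d (4 * s) (by positivity) hs4
    calc T xt₂ h ≤ _ := b1
      _ ≤ (1 + 2 ^ d * (4 * s)) * (T xt₁ h + B * s * T xt₁ h) := by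
          refine mul_le_mul b3 (by linarith) ?_ (by positivity)
          have : 0 ≤ DSE.S xt₁ π u p (9 / 4) := by
            refine Finset.sum_nonneg fun i _ => Finset.sum_nonneg fun j _ => ?_
            have := hπ0 i
            have := hπ0 j
            have := DSE.ind_nonneg (xt₁ i) (xt₁ j) (9 / 4)
            positivity
          positivity
      _ = (1 + (4 * 2 ^ d + B) * s + 4 * 2 ^ d * B * s * s) * T xt₁ h := by ring
      _ ≤ M * T xt₁ h := by
          refine mul_le_mul_of_nonneg_right ?_ hTp
          have : 4 * 2 ^ d * B * s * s ≤ 4 * 2 ^ d * B * s * 1 :=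
            mul_le_mul_of_nonneg_left (by linarith) (by positivity)
          rw [hM]
          linarith
  have hne : Nonempty (Set.Icc h₀ (1 / 2 : ℝ)) := ⟨⟨h₀, le_rfl, hh0'.le⟩⟩
  have hlog : ∀ h : Set.Icc h₀ (1 / 2 : ℝ), |Real.log (h : ℝ)| ^ (-θ) ≤ Real.log 2 ^ (-θ) := by
    intro h
    have hpos : 0 < (h : ℝ) := hh0.trans_le h.2.1
    have l2 : 0 < Real.log 2 := Real.log_pos (by norm_num)
    have : Real.log (h : ℝ) ≤ - Real.log 2 := by
      rw [← Real.log_inv]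
      exact Real.log_le_log hpos (by have := h.2.2; norm_num at this ⊢; exact this)
    have h3 : Real.log 2 ≤ |Real.log (h : ℝ)| := by
      rw [abs_of_nonpos (by linarith)]; linarith
    exact Real.rpow_le_rpow_of_nonpos l2 h3 (by linarith)
  have hbdd : BddAbove (Set.range fun h : Set.Icc h₀ (1 / 2 : ℝ) =>
      |Real.log (h : ℝ)| ^ (-θ) * T xt₁ h) := by
    refine ⟨Real.log 2 ^ (-θ) * T xt₁ h₀, ?_⟩
    rintro _ ⟨h, rfl⟩
    have hpos : 0 < (h : ℝ) := hh0.trans_le h.2.1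
    refine mul_le_mul (hlog h) ?_ (hT0 _ _ hpos.le)
      (Real.rpow_nonneg (Real.log_nonneg (by norm_num)) _)
    refine Finset.sum_le_sum fun i _ => Finset.sum_le_sum fun j _ => ?_
    have a1 := (hπ0 i).le
    have a2 := (hπ0 j).le
    have a3 := hφ0 (xt₁ i - xt₁ j)
    have a4 := h.2.1
    gcongr
  have hsup : (⨆ h : Set.Icc h₀ (1 / 2 : ℝ), |Real.log (h : ℝ)| ^ (-θ) * T xt₂ h) ≤
      M * ⨆ h : Set.Icc h₀ (1 / 2 : ℝ), |Real.log (h : ℝ)| ^ (-θ) * T xt₁ h := by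
    refine ciSup_le fun h => ?_
    have e1 := hTT h h.2.1 h.2.2
    have e2 := le_ciSup hbdd h
    have e3 : 0 ≤ |Real.log (h : ℝ)| ^ (-θ) := Real.rpow_nonneg (abs_nonneg _) _
    calc _ ≤ |Real.log (h : ℝ)| ^ (-θ) * (M * T xt₁ h) := mul_le_mul_of_nonneg_left e1 e3
      _ = M * (|Real.log (h : ℝ)| ^ (-θ) * T xt₁ h) := by ring
      _ ≤ _ := mul_le_mul_of_nonneg_left e2 (by linarith)
  have hnn : ∀ z, 0 ≤ ⨆ h : Set.Icc h₀ (1 / 2 : ℝ), |Real.log (h : ℝ)| ^ (-θ) * T z h := by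
    intro z
    refine Real.iSup_nonneg fun h => ?_
    exact mul_nonneg (Real.rpow_nonneg (abs_nonneg _) _) (hT0 _ _ (hh0.le.trans h.2.1))
  have hMe : 1 + (4 * 2 ^ d + B + 4 * 2 ^ d * B) * h₂ / h₀ = M := by
    rw [hM, hs]; ring
  rw [hMe]
  have hp1 : 1 / p ≤ 1 := by rw [div_le_one (by linarith)]; exact hp
  calc _ ≤ (M * ⨆ h : Set.Icc h₀ (1 / 2 : ℝ), |Real.log (h : ℝ)| ^ (-θ) * T xt₁ h) ^ (1 / p) :=
        Real.rpow_le_rpow (hnn xt₂) hsup (by positivity)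
    _ = M ^ (1 / p) * (⨆ h : Set.Icc h₀ (1 / 2 : ℝ), |Real.log (h : ℝ)| ^ (-θ) * T xt₁ h) ^ (1 / p) :=
        Real.mul_rpow (by linarith) (hnn xt₁)
    _ ≤ _ := mul_le_mul_of_nonneg_right (Real.rpow_le_self_of_one_le hM1 hp1)
        (Real.rpow_nonneg (hnn xt₁) _)
end

section
/- Consider a mesh datum with Σ_{i∈V} χ_i(x) ≤ 1 for every x ∈ ℝ^d. Let 1 ≤ p < ∞ and let 0 < h < 1/2 with δx ≤ h. Then there exists a constant C, depending only on d, p and φ, such that: (a) for every measurable u : ℝ^d → ℝ with ∫ |u| χ_i < ∞ for each i ∈ V, Σ_{i,j∈V} K^h(x_i − x_j) |(1/π_i)∫ u χ_i − (1/π_j)∫ u χ_j|^p π_i π_j ≤ (1 + C·δx/h) ∫∫_{ℝ^d×ℝ^d} K^h(x−y)|u(x)−u(y)|^p dx dy; and (b) if moreover Ω ⊆ ℝ^d is such that Σ_{i∈V} χ_i = 1 on Ω + B(0,4), and u : V → ℝ satisfies u_i = 0 whenever supp χ_i is not contained in Ω, then, with u^χ := Σ_{i∈V} u_i χ_i, ∫∫_{ℝ^d×ℝ^d}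 K^h(x−y)|u^χ(x)−u^χ(y)|^p dx dy ≤ (1 + C·δx/h) Σ_{i,j∈V} K^h(x_i − x_j)|u_i − u_j|^p π_i π_j. -/
open MeasureTheory
open scoped ENNReal Pointwise

lemma kernel_cmp (d : ℕ) (φ : EuclideanSpace ℝ (Fin d) → ℝ) (L : ℝ) (hL : 0 ≤ L)
    (hlip : ∀ x y, |φ x - φ y| ≤ L * ‖x - y‖)
    (hφ0 : ∀ x, 0 ≤ φ x) (hφ1 : ∀ x, φ x ≤ 1)
    (hφone : ∀ x : EuclideanSpace ℝ (Fin d), ‖x‖ ≤ 1 → φ x = 1) :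
    ∃ C : ℝ, 0 < C ∧ ∀ (δ h : ℝ) (z w : EuclideanSpace ℝ (Fin d)), 0 < δ → δ ≤ h → h < 1 / 2 →
      ‖z - w‖ ≤ 2 * δ →
      φ z / (‖z‖ + h) ^ d ≤ (1 + C * δ / h) * (φ w / (‖w‖ + h) ^ d) + C * δ / h := by
  have key : ∃ C1 : ℝ, 0 < C1 ∧ ∀ t : ℝ, 0 ≤ t → t ≤ 1 → (1 + 2 * t) ^ d ≤ 1 + C1 * t := by
    clear hφone hφ1 hφ0 hlip φ
    induction d with
    | zero => exact ⟨1, one_pos, fun t h0 _ => by simp; linarith⟩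
    | succ n ih =>
      obtain ⟨C, hC, h⟩ := ih
      refine ⟨3 * C + 2, by positivity, fun t h0 h1 => ?_⟩
      have := h t h0 h1
      rw [pow_succ]
      calc (1 + 2 * t) ^ n * (1 + 2 * t) ≤ (1 + C * t) * (1 + 2 * t) := by gcongr
        _ ≤ _ := by nlinarith [mul_nonneg hC.le (mul_nonneg h0 (sub_nonneg.2 h1))]
  obtain ⟨C1, hC1, hpow⟩ := key
  refine ⟨C1 + (1 + C1) * (2 * L) , by positivity, fun δ h z w hδ hδh hh hzw => ?_⟩
  have hh0 : 0 < h := lt_of_lt_of_le hδ hδh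
  set t := δ / h with ht
  have ht0 : 0 < t := by positivity
  have ht1 : t ≤ 1 := by rw [ht, div_le_one hh0]; exact hδh
  have hδt : δ ≤ t := by rw [ht, le_div_iff₀ hh0]; nlinarith
  rw [mul_div_assoc, ← ht]
  have hz : 0 < ‖z‖ + h := by positivity
  have hw : 0 < ‖w‖ + h := by positivity
  have hr : (‖w‖ + h) ^ d ≤ (1 + C1 * t) * (‖z‖ + h) ^ d := by
    have h1 : ‖w‖ + h ≤ (1 + 2 * t) * (‖z‖ + h) := by
      have : ‖w‖ ≤ ‖z‖ + 2 * δ := by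
        have := norm_sub_norm_le w z
        rw [norm_sub_rev] at this; linarith
      have e : t * h = δ := by rw [ht]; field_simp
      nlinarith [norm_nonneg z, mul_nonneg ht0.le (norm_nonneg z)]
    calc (‖w‖ + h) ^ d ≤ ((1 + 2 * t) * (‖z‖ + h)) ^ d := by gcongr
      _ = (1 + 2 * t) ^ d * (‖z‖ + h) ^ d := mul_pow _ _ _
      _ ≤ _ := by gcongr; exact hpow t ht0.le ht1
  have hstep : φ z / (‖z‖ + h) ^ d ≤ (1 + C1 * t) * (φ z / (‖w‖ + h) ^ d) := by
    rw [← mul_div_assoc, div_le_div_iff₀ (by positivity) (by positivity)]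
    calc φ z * (‖w‖ + h) ^ d ≤ φ z * ((1 + C1 * t) * (‖z‖ + h) ^ d) := by
          gcongr; exact hφ0 z
      _ = _ := by ring
  refine hstep.trans ?_
  have hKw : 0 ≤ φ w / (‖w‖ + h) ^ d := div_nonneg (hφ0 w) (by positivity)
  have hLt : 0 ≤ (1 + C1) * (2 * L) * t := by positivity
  by_cases hc : φ z ≤ φ w
  · have : φ z / (‖w‖ + h) ^ d ≤ φ w / (‖w‖ + h) ^ d := by gcongr
    calc (1 + C1 * t) * (φ z / (‖w‖ + h) ^ d) ≤ (1 + C1 * t) * (φ w / (‖w‖ + h) ^ d) := by gcongr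
      _ ≤ _ := by nlinarith [mul_nonneg hLt hKw, mul_pos hC1 ht0]
  · push Not at hc
    have hw1 : 1 < ‖w‖ := by
      by_contra hcon
      have := hφone w (not_lt.1 hcon)
      linarith [hφ1 z]
    have hone : 1 ≤ (‖w‖ + h) ^ d := one_le_pow₀ (by linarith)
    have hd : φ z ≤ φ w + 2 * L * δ := by
      have := (abs_le.1 (hlip z w)).2
      nlinarith
    have : φ z / (‖w‖ + h) ^ d ≤ φ w / (‖w‖ + h) ^ d + 2 * L * t := by
      calc φ z / (‖w‖ + h) ^ d ≤ (φ w + 2 * L * δ) / (‖w‖ + h) ^ d := by gcongr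
        _ = φ w / (‖w‖ + h) ^ d + 2 * L * δ / (‖w‖ + h) ^ d := add_div _ _ _
        _ ≤ _ := by
          gcongr
          calc 2 * L * δ / (‖w‖ + h) ^ d ≤ 2 * L * δ := div_le_self (by positivity) hone
            _ ≤ _ := by gcongr
    calc (1 + C1 * t) * (φ z / (‖w‖ + h) ^ d)
        ≤ (1 + C1 * t) * (φ w / (‖w‖ + h) ^ d + 2 * L * t) := by gcongr
      _ = (1 + C1 * t) * (φ w / (‖w‖ + h) ^ d) + (1 + C1 * t) * (2 * L * t) := by ring
      _ ≤ (1 + C1 * t) * (φ w / (‖w‖ + h) ^ d) + (1 + C1 * 1) * (2 * L * t) := by gcongr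
      _ ≤ _ := by nlinarith [mul_nonneg hLt hKw, mul_pos hC1 ht0]

lemma kernel_low (d : ℕ) (φ : EuclideanSpace ℝ (Fin d) → ℝ) (L : ℝ) (hL : 0 ≤ L)
    (hlip : ∀ x y, |φ x - φ y| ≤ L * ‖x - y‖)
    (hφone : ∀ x : EuclideanSpace ℝ (Fin d), ‖x‖ ≤ 1 → φ x = 1) :
    ∃ η : ℝ, 0 < η ∧ η ≤ 1 ∧ ∀ (h : ℝ) (z : EuclideanSpace ℝ (Fin d)), 0 < h → h < 1 / 2 →
      ‖z‖ ≤ 1 + η → 1 ≤ (2 * 3 ^ d) * (φ z / (‖z‖ + h) ^ d) := by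
  refine ⟨1 / (2 * (L + 1)), by positivity, ?_, fun h z h0 hh hz => ?_⟩
  · rw [div_le_one (by positivity)]; linarith
  have hη : 1 / (2 * (L + 1)) ≤ 1 := by rw [div_le_one (by positivity)]; linarith
  have hφ : 1 / 2 ≤ φ z := by
    by_cases hz1 : ‖z‖ ≤ 1
    · rw [hφone z hz1]; norm_num
    push Not at hz1
    have h1 := hφone (‖z‖⁻¹ • z) (by rw [norm_smul, norm_inv, norm_norm, inv_mul_cancel₀]; linarith)
    have h2 : ‖z - ‖z‖⁻¹ • z‖ = ‖z‖ - 1 := by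
      have : z - ‖z‖⁻¹ • z = (1 - ‖z‖⁻¹) • z := by rw [sub_smul, one_smul]
      rw [this, norm_smul, Real.norm_of_nonneg, sub_mul, inv_mul_cancel₀ (by linarith), one_mul]
      rw [sub_nonneg]; exact inv_le_one_of_one_le₀ hz1.le
    have h3 := (abs_le.1 (hlip z (‖z‖⁻¹ • z))).1
    rw [h2, h1] at h3
    have : L * (‖z‖ - 1) ≤ 1 / 2 := by
      calc L * (‖z‖ - 1) ≤ (L + 1) * (1 / (2 * (L + 1))) := by gcongr <;> linarith
        _ = 1 / 2 := by field_simp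
    linarith
  have : (‖z‖ + h) ^ d ≤ 3 ^ d := by gcongr; linarith
  rw [← mul_div_assoc, le_div_iff₀ (by positivity), one_mul]
  nlinarith [pow_pos (show (0:ℝ) < 3 by norm_num) d]

lemma half_scale (d : ℕ) (g : EuclideanSpace ℝ (Fin d) → ℝ≥0∞) (hg : Measurable g)
    (x : EuclideanSpace ℝ (Fin d)) :
    ∫⁻ y, g ((1 / 2 : ℝ) • (x + y)) = 2 ^ d * ∫⁻ y, g y := by
  rw [lintegral_add_left_eq_self (fun y => g ((1 / 2 : ℝ) • y)) x]
  rw [← lintegral_map (μ := volume) (f := g) (g := fun y => (1 / 2 : ℝ) • y) hg (by fun_prop)]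
  rw [Measure.map_addHaar_smul _ (by norm_num), lintegral_smul_measure]
  simp [ENNReal.ofReal_pow]

lemma dadd {d : ℕ} {f g : EuclideanSpace ℝ (Fin d) → EuclideanSpace ℝ (Fin d) → ℝ≥0∞}
    (hf : Measurable (Function.uncurry f)) :
    ∫⁻ x, ∫⁻ y, (f x y + g x y) = (∫⁻ x, ∫⁻ y, f x y) + ∫⁻ x, ∫⁻ y, g x y := by
  rw [← lintegral_add_left (by exact hf.lintegral_prod_right')]
  congr 1; ext x
  rw [lintegral_add_left (by exact hf.comp measurable_prodMk_left)]

lemma dmul {d : ℕ} {f : EuclideanSpace ℝ (Fin d) → EuclideanSpace ℝ (Fin d) → ℝ≥0∞}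
    (hf : Measurable (Function.uncurry f)) (c : ℝ≥0∞) :
    ∫⁻ x, ∫⁻ y, c * f x y = c * ∫⁻ x, ∫⁻ y, f x y := by
  rw [← lintegral_const_mul _ (by exact hf.lintegral_prod_right')]
  congr 1; ext x
  rw [lintegral_const_mul _ (by exact hf.comp measurable_prodMk_left)]

lemma dsum {d : ℕ} {ι : Type} (s : Finset ι)
    {f : ι → EuclideanSpace ℝ (Fin d) → EuclideanSpace ℝ (Fin d) → ℝ≥0∞}
    (hf : ∀ i, Measurable (Function.uncurry (f i))) :
    ∫⁻ x, ∫⁻ y, ∑ i ∈ s, f i x y = ∑ i ∈ s, ∫⁻ x, ∫⁻ y, f i x y := by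
  rw [← lintegral_finsetSum _ (fun i _ => by exact (hf i).lintegral_prod_right')]
  congr 1; ext x
  rw [lintegral_finsetSum _ (fun i _ => by exact (hf i).comp measurable_prodMk_left)]

lemma mid_left (d : ℕ) (G : EuclideanSpace ℝ (Fin d) → EuclideanSpace ℝ (Fin d) → ℝ≥0∞)
    (hG : Measurable (Function.uncurry G)) :
    ∫⁻ x, ∫⁻ y, G x ((1 / 2 : ℝ) • (x + y)) = 2 ^ d * ∫⁻ x, ∫⁻ y, G x y := by
  rw [← lintegral_const_mul _ (by exact hG.lintegral_prod_right')]
  congr 1; ext x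
  exact half_scale d (G x) (hG.comp measurable_prodMk_left) x

lemma mid_right (d : ℕ) (G : EuclideanSpace ℝ (Fin d) → EuclideanSpace ℝ (Fin d) → ℝ≥0∞)
    (hG : Measurable (Function.uncurry G)) :
    ∫⁻ x, ∫⁻ y, G ((1 / 2 : ℝ) • (y + x)) y = 2 ^ d * ∫⁻ x, ∫⁻ y, G x y := by
  have hm : Measurable (Function.uncurry fun x y : EuclideanSpace ℝ (Fin d) =>
      G ((1 / 2 : ℝ) • (y + x)) y) :=
    hG.comp (f := fun q : EuclideanSpace ℝ (Fin d) × EuclideanSpace ℝ (Fin d) =>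
      ((1 / 2 : ℝ) • (q.2 + q.1), q.2)) (by fun_prop)
  have hG' : Measurable (Function.uncurry fun x y : EuclideanSpace ℝ (Fin d) => G y x) :=
    hG.comp measurable_swap
  rw [lintegral_lintegral_swap (f := G) hG.aemeasurable, ← mid_left d (fun x y => G y x) hG']
  exact lintegral_lintegral_swap hm.aemeasurable

lemma chain (d : ℕ) (F : EuclideanSpace ℝ (Fin d) → EuclideanSpace ℝ (Fin d) → ℝ≥0∞)
    (hF : Measurable (Function.uncurry F)) (A : ℝ≥0∞)
    (hA : ∀ x y m, F x y ≤ A * (F x m + F m y)) (R : ℝ) :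
    ∫⁻ x, ∫⁻ y, (if ‖x - y‖ ≤ R then F x y else 0) ≤
      (2 * A * 2 ^ d) * ∫⁻ x, ∫⁻ y, (if ‖x - y‖ ≤ R / 2 then F x y else 0) := by
  set G : EuclideanSpace ℝ (Fin d) → EuclideanSpace ℝ (Fin d) → ℝ≥0∞ :=
    fun x y => if ‖x - y‖ ≤ R / 2 then F x y else 0 with hGdef
  have hG : Measurable (Function.uncurry G) :=
    Measurable.ite (measurableSet_le (by fun_prop) (by fun_prop)) hF measurable_const
  have hpt : ∀ x y, (if ‖x - y‖ ≤ R then F x y else 0) ≤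
      A * (G x ((1 / 2 : ℝ) • (x + y)) + G ((1 / 2 : ℝ) • (y + x)) y) := by
    intro x y
    split_ifs with h
    · have e1 : x - (1 / 2 : ℝ) • (x + y) = (1 / 2 : ℝ) • (x - y) := by module
      have e2 : (1 / 2 : ℝ) • (y + x) - y = (1 / 2 : ℝ) • (x - y) := by module
      have hn : ‖(1 / 2 : ℝ) • (x - y)‖ ≤ R / 2 := by
        rw [norm_smul]; norm_num; linarith
      simp only [hGdef, e1, e2, hn, if_true]
      rw [add_comm y x]
      exact hA _ _ _
    · exact zero_le
  calc ∫⁻ x, ∫⁻ y, (if ‖x - y‖ ≤ R then F x y else 0)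
      ≤ ∫⁻ x, ∫⁻ y, A * (G x ((1 / 2 : ℝ) • (x + y)) + G ((1 / 2 : ℝ) • (y + x)) y) := by
        gcongr with x y; exact hpt x y
    _ = A * ((∫⁻ x, ∫⁻ y, G x ((1 / 2 : ℝ) • (x + y))) +
          ∫⁻ x, ∫⁻ y, G ((1 / 2 : ℝ) • (y + x)) y) := by
        have m1 : Measurable fun q : EuclideanSpace ℝ (Fin d) × EuclideanSpace ℝ (Fin d) =>
            G q.1 ((1 / 2 : ℝ) • (q.1 + q.2)) :=
          hG.comp (f := fun q : EuclideanSpace ℝ (Fin d) × EuclideanSpace ℝ (Fin d) =>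
            (q.1, (1 / 2 : ℝ) • (q.1 + q.2))) (by fun_prop)
        have m2 : Measurable fun q : EuclideanSpace ℝ (Fin d) × EuclideanSpace ℝ (Fin d) =>
            G ((1 / 2 : ℝ) • (q.2 + q.1)) q.2 :=
          hG.comp (f := fun q : EuclideanSpace ℝ (Fin d) × EuclideanSpace ℝ (Fin d) =>
            ((1 / 2 : ℝ) • (q.2 + q.1), q.2)) (by fun_prop)
        rw [dmul (f := fun x y => G x ((1 / 2 : ℝ) • (x + y)) + G ((1 / 2 : ℝ) • (y + x)) y)
          (m1.add m2), dadd (f := fun x y => G x ((1 / 2 : ℝ) • (x + y))) m1]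
    _ = A * (2 ^ d * (∫⁻ x, ∫⁻ y, G x y) + 2 ^ d * ∫⁻ x, ∫⁻ y, G x y) := by
        rw [mid_left d G hG, mid_right d G hG]
    _ = _ := by ring

lemma chain_iter (d : ℕ) (F : EuclideanSpace ℝ (Fin d) → EuclideanSpace ℝ (Fin d) → ℝ≥0∞)
    (hF : Measurable (Function.uncurry F)) (A : ℝ≥0∞)
    (hA : ∀ x y m, F x y ≤ A * (F x m + F m y)) (R : ℝ) (n : ℕ) :
    ∫⁻ x, ∫⁻ y, (if ‖x - y‖ ≤ R then F x y else 0) ≤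
      (2 * A * 2 ^ d) ^ n * ∫⁻ x, ∫⁻ y, (if ‖x - y‖ ≤ R / 2 ^ n then F x y else 0) := by
  induction n with
  | zero => simp
  | succ n ih =>
    refine ih.trans ?_
    rw [pow_succ, mul_assoc (_ ^ n)]
    refine mul_le_mul_right ?_ _
    have := chain d F hF A hA (R / 2 ^ n)
    rw [div_div, ← pow_succ] at this
    exact this

lemma chain_bound (d : ℕ) (p R r : ℝ) (hr : 0 < r) :
    ∃ M : ℝ, 0 < M ∧ ∀ F : EuclideanSpace ℝ (Fin d) → EuclideanSpace ℝ (Fin d) → ℝ≥0∞,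
      Measurable (Function.uncurry F) →
      (∀ x y m, F x y ≤ ENNReal.ofReal (2 ^ p) * (F x m + F m y)) →
      ∫⁻ x, ∫⁻ y, (if ‖x - y‖ ≤ R then F x y else 0) ≤
        ENNReal.ofReal M * ∫⁻ x, ∫⁻ y, (if ‖x - y‖ ≤ r then F x y else 0) := by
  obtain ⟨n, hn⟩ := pow_unbounded_of_one_lt (R / r) (one_lt_two)
  refine ⟨(2 * 2 ^ p * 2 ^ d) ^ n, by positivity, fun F hF hA => ?_⟩
  refine (chain_iter d F hF _ hA R n).trans ?_
  rw [ENNReal.ofReal_pow (by positivity), ENNReal.ofReal_mul (by positivity),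
    ENNReal.ofReal_mul (by positivity), ENNReal.ofReal_pow (by positivity)]
  simp only [ENNReal.ofReal_ofNat]
  gcongr with x y
  have : R / 2 ^ n ≤ r := by
    rw [div_lt_iff₀ hr] at hn
    rw [div_le_iff₀ (by positivity)]; linarith
  split_ifs with h1 h2
  · exact le_rfl
  · exact absurd (h1.trans this) h2
  · exact zero_le
  · exact le_rfl

lemma bary (d : ℕ) (χ : EuclideanSpace ℝ (Fin d) → ℝ) (δ : ℝ) 
    (h0 : ∀ x, 0 ≤ χ x)
    (hb : Bornology.IsBounded (tsupport χ)) (hI : Integrable χ) (hpos : 0 < ∫ x, χ x)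
    (hdiam : Metric.diam (tsupport χ) ≤ δ) (x : EuclideanSpace ℝ (Fin d)) (hx : χ x ≠ 0) :
    ‖x - (∫ x, χ x)⁻¹ • ∫ y, χ y • y‖ ≤ δ := by
  have hx' : x ∈ tsupport χ := subset_tsupport _ hx
  have hbd : ∀ y, ‖χ y • (x - y)‖ ≤ χ y * δ := by
    intro y
    rw [norm_smul, Real.norm_of_nonneg (h0 y)]
    by_cases hy : χ y = 0
    · simp [hy]
    · have := (Metric.dist_le_diam_of_mem hb hx' (subset_tsupport _ hy)).trans hdiam
      rw [dist_eq_norm] at this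
      exact mul_le_mul_of_nonneg_left this (h0 y)
  have hi1 : Integrable fun y => χ y • (x - y) :=
    (hI.mul_const δ).mono' (hI.aestronglyMeasurable.smul (by fun_prop)) (ae_of_all _ hbd)
  have hi2 : Integrable fun y => χ y • x := hI.smul_const x
  have e : ∫ y, χ y • (x - y) = (∫ y, χ y) • x - ∫ y, χ y • y := by
    have hi3 : Integrable fun y => χ y • y := by
      have := hi2.sub hi1
      refine this.congr (ae_of_all _ fun y => ?_)
      simp [smul_sub]
    rw [← integral_smul_const, ← integral_sub hi2 hi3]
    simp [smul_sub]
  have e2 : x - (∫ x, χ x)⁻¹ • ∫ y, χ y • y = (∫ x, χ x)⁻¹ • ∫ y, χ y • (x - y) := by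
    rw [e, smul_sub, smul_smul, inv_mul_cancel₀ hpos.ne', one_smul]
  rw [e2, norm_smul, norm_inv, Real.norm_of_nonneg hpos.le, inv_mul_le_iff₀ hpos]
  calc ‖∫ y, χ y • (x - y)‖ ≤ ∫ y, χ y * δ :=
        norm_integral_le_of_norm_le (hI.mul_const δ) (ae_of_all _ hbd)
    _ = _ := integral_mul_const _ _

lemma fin_jensen {ι : Type} [Fintype ι] (a b u : ι → ℝ) (ha : ∀ i, 0 ≤ a i) (hb : ∀ i, 0 ≤ b i)
    (ha1 : ∑ i, a i = 1) (hb1 : ∑ i, b i = 1) (p : ℝ) (hp : 1 ≤ p) :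
    |∑ i, u i * a i - ∑ i, u i * b i| ^ p ≤ ∑ i, ∑ j, a i * b j * |u i - u j| ^ p := by
  have e : ∑ i, u i * a i - ∑ i, u i * b i = ∑ q : ι × ι, a q.1 * b q.2 * (u q.1 - u q.2) := by
    rw [Fintype.sum_prod_type]
    have h1 : ∑ i, u i * a i = ∑ i, ∑ j, a i * b j * u i := by
      refine Finset.sum_congr rfl fun i _ => ?_
      rw [← Finset.sum_mul, ← Finset.mul_sum, hb1]; ring
    have h2 : ∑ i, u i * b i = ∑ i, ∑ j, a i * b j * u j := by
      rw [Finset.sum_comm]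
      refine Finset.sum_congr rfl fun i _ => ?_
      rw [← Finset.sum_mul, ← Finset.sum_mul, ha1]; ring
    rw [h1, h2, ← Finset.sum_sub_distrib]
    simp only [← Finset.sum_sub_distrib, mul_sub]
  have hw : ∀ q : ι × ι, 0 ≤ a q.1 * b q.2 := fun q => mul_nonneg (ha _) (hb _)
  have h1 : ∑ q : ι × ι, a q.1 * b q.2 = 1 := by
    rw [Fintype.sum_prod_type]
    simp only [← Finset.mul_sum, hb1, mul_one, ha1]
  rw [e]
  calc |∑ q : ι × ι, a q.1 * b q.2 * (u q.1 - u q.2)| ^ p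
      ≤ (∑ q : ι × ι, a q.1 * b q.2 * |u q.1 - u q.2|) ^ p := by
        gcongr
        refine (Finset.abs_sum_le_sum_abs _ _).trans (Finset.sum_le_sum fun q _ => ?_)
        rw [abs_mul, abs_of_nonneg (hw q)]
    _ ≤ ∑ q : ι × ι, a q.1 * b q.2 * |u q.1 - u q.2| ^ p :=
        Real.rpow_arith_mean_le_arith_mean_rpow _ _ _ (fun q _ => hw q) h1
          (fun q _ => abs_nonneg _) hp
    _ = _ := Fintype.sum_prod_type _

lemma tri_rpow (p : ℝ) (hp : 1 ≤ p) (a b c : ℝ) :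
    |a - c| ^ p ≤ 2 ^ p * (|a - b| ^ p + |b - c| ^ p) := by
  have hp0 : 0 ≤ p := by linarith
  have h2 : |a - c| ≤ |a - b| + |b - c| := abs_sub_le _ _ _
  rcases le_total |a - b| |b - c| with h | h
  · calc |a - c| ^ p ≤ (2 * |b - c|) ^ p := by gcongr; linarith
      _ = 2 ^ p * |b - c| ^ p := Real.mul_rpow (by norm_num) (abs_nonneg _)
      _ ≤ _ := by gcongr; linarith [Real.rpow_nonneg (abs_nonneg (a - b)) p]
  · calc |a - c| ^ p ≤ (2 * |a - b|) ^ p := by gcongr; linarith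
      _ = 2 ^ p * |a - b| ^ p := Real.mul_rpow (by norm_num) (abs_nonneg _)
      _ ≤ _ := by gcongr; linarith [Real.rpow_nonneg (abs_nonneg (b - c)) p]

lemma dsum2 {d : ℕ} {V : Type} [Fintype V]
    {f : V → V → EuclideanSpace ℝ (Fin d) → EuclideanSpace ℝ (Fin d) → ℝ≥0∞}
    (hf : ∀ i j, Measurable (Function.uncurry (f i j))) (κ : V → V → ℝ≥0∞) :
    ∫⁻ x, ∫⁻ y, ∑ i, ∑ j, κ i j * f i j x y = ∑ i, ∑ j, κ i j * ∫⁻ x, ∫⁻ y, f i j x y := by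
  have hm : ∀ i j, Measurable (Function.uncurry fun x y => κ i j * f i j x y) :=
    fun i j => (hf i j).const_mul (κ i j)
  rw [dsum (f := fun i x y => ∑ j, κ i j * f i j x y)]
  · refine Finset.sum_congr rfl fun i _ => ?_
    rw [dsum (f := fun j x y => κ i j * f i j x y) _ (hm i)]
    exact Finset.sum_congr rfl fun j _ => dmul (hf i j) _
  · intro i
    exact Finset.measurable_fun_sum (f := fun j => Function.uncurry fun x y => κ i j * f i j x y)
      Finset.univ (fun j _ => hm i j)

lemma int_jensen (d : ℕ) (f g u : EuclideanSpace ℝ (Fin d) → ℝ) (hf : Measurable f)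
    (hg : Measurable g) (hu : Measurable u) (f0 : ∀ x, 0 ≤ f x) (g0 : ∀ x, 0 ≤ g x)
    (a b : ℝ) (ha : 0 < a) (hb : 0 < b) (hfa : a = ∫ x, f x) (hgb : b = ∫ x, g x)
    (hfu : Integrable fun x => |u x| * f x) (hgu : Integrable fun x => |u x| * g x)
    (p : ℝ) (hp : 1 ≤ p) :
    ENNReal.ofReal (|(1 / a) * (∫ x, u x * f x) - (1 / b) * ∫ x, u x * g x| ^ p * a * b) ≤
      ∫⁻ x, ∫⁻ y, ENNReal.ofReal (f x) * ENNReal.ofReal (g y) *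
        ENNReal.ofReal (|u x - u y| ^ p) := by
  have aux : ∀ (f : EuclideanSpace ℝ (Fin d) → ℝ) (a : ℝ), Measurable f → (∀ x, 0 ≤ f x) →
      0 < a → a = ∫ x, f x → (Integrable fun x => |u x| * f x) →
      ∃ ν : Measure (EuclideanSpace ℝ (Fin d)), IsProbabilityMeasure ν ∧ Integrable u ν ∧
        ∫ x, u x ∂ν = (1 / a) * ∫ x, u x * f x ∧
        ∀ G : EuclideanSpace ℝ (Fin d) → ℝ≥0∞, Measurable G →
          ENNReal.ofReal a * ∫⁻ x, G x ∂ν = ∫⁻ x, ENNReal.ofReal (f x) * G x := by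
    intro f a hf f0 ha hfa hfu
    have hI : Integrable f := by
      by_contra hc
      rw [integral_undef hc] at hfa; linarith
    have hm : Measurable fun x => ENNReal.ofReal (f x / a) := by fun_prop
    have hG : ∀ G : EuclideanSpace ℝ (Fin d) → ℝ≥0∞, Measurable G →
          ENNReal.ofReal a * ∫⁻ x, G x ∂(volume.withDensity fun x => ENNReal.ofReal (f x / a))
            = ∫⁻ x, ENNReal.ofReal (f x) * G x := by
      intro G hG
      rw [lintegral_withDensity_eq_lintegral_mul _ hm hG, ← lintegral_const_mul _ (hm.mul hG)]
      congr 1; ext x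
      simp only [Pi.mul_apply]
      rw [← mul_assoc, ← ENNReal.ofReal_mul ha.le, mul_div_cancel₀ _ ha.ne']
    refine ⟨volume.withDensity fun x => ENNReal.ofReal (f x / a), ⟨?_⟩, ?_, ?_, hG⟩
    · rw [withDensity_apply _ MeasurableSet.univ, Measure.restrict_univ,
        ← ofReal_integral_eq_lintegral_ofReal (hI.div_const a)
          (ae_of_all _ fun x => div_nonneg (f0 x) ha.le), integral_div, ← hfa, div_self ha.ne']
      simp
    · rw [integrable_withDensity_iff hm (ae_of_all _ fun x => ENNReal.ofReal_lt_top)]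
      refine (hfu.div_const a).mono (by fun_prop) (ae_of_all _ fun x => ?_)
      rw [ENNReal.toReal_ofReal (div_nonneg (f0 x) ha.le), mul_div_assoc]
      simp
    · rw [integral_withDensity_eq_integral_toReal_smul hm
        (ae_of_all _ fun x => ENNReal.ofReal_lt_top), ← integral_const_mul]
      congr 1; ext x
      rw [ENNReal.toReal_ofReal (div_nonneg (f0 x) ha.le), smul_eq_mul]
      ring
  obtain ⟨ν, hν, iν, eν, lν⟩ := aux f a hf f0 ha hfa hfu
  obtain ⟨ρ, hρ, iρ, eρ, lρ⟩ := aux g b hg g0 hb hgb hgu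
  have hp0 : 0 < p := by linarith
  have e : (1 / a) * (∫ x, u x * f x) - (1 / b) * ∫ x, u x * g x =
      ∫ q, (u q.1 - u q.2) ∂(ν.prod ρ) := by
    rw [integral_sub (iν.comp_fst ρ) (iρ.comp_snd ν), integral_fun_fst, integral_fun_snd, eν, eρ]
    simp
  have hmeas : Measurable fun q : EuclideanSpace ℝ (Fin d) × EuclideanSpace ℝ (Fin d) =>
      u q.1 - u q.2 := by fun_prop
  have h1 : ENNReal.ofReal (|∫ q, (u q.1 - u q.2) ∂(ν.prod ρ)| ^ p) ≤
      ∫⁻ q, ENNReal.ofReal (|u q.1 - u q.2| ^ p) ∂(ν.prod ρ) := by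
    have h2 : ‖∫ q, (u q.1 - u q.2) ∂(ν.prod ρ)‖ₑ ≤
        eLpNorm (fun q => u q.1 - u q.2) (ENNReal.ofReal p) (ν.prod ρ) := by
      refine (enorm_integral_le_lintegral_enorm _).trans ?_
      rw [← eLpNorm_one_eq_lintegral_enorm]
      exact eLpNorm_le_eLpNorm_of_exponent_le (by simpa using hp) hmeas.aestronglyMeasurable
    rw [eLpNorm_eq_lintegral_rpow_enorm_toReal (by simpa using hp0) (by simp),
      ENNReal.toReal_ofReal hp0.le] at h2
    have h3 := ENNReal.rpow_le_rpow h2 hp0.le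
    rw [← ENNReal.rpow_mul, one_div, inv_mul_cancel₀ hp0.ne', ENNReal.rpow_one] at h3
    have conv : ∀ r : ℝ, ENNReal.ofReal (|r| ^ p) = ‖r‖ₑ ^ p := fun r => by
      rw [← ENNReal.ofReal_rpow_of_nonneg (abs_nonneg r) hp0.le, Real.enorm_eq_ofReal_abs]
    simp only [conv]
    exact h3
  have hm2 : Measurable fun q : EuclideanSpace ℝ (Fin d) × EuclideanSpace ℝ (Fin d) =>
      ENNReal.ofReal (|u q.1 - u q.2| ^ p) := by fun_prop
  rw [e, ENNReal.ofReal_mul (by positivity), ENNReal.ofReal_mul (by positivity)]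
  calc _ ≤ (∫⁻ q, ENNReal.ofReal (|u q.1 - u q.2| ^ p) ∂(ν.prod ρ)) * ENNReal.ofReal a *
        ENNReal.ofReal b := by gcongr
    _ = ENNReal.ofReal a * (∫⁻ x, ENNReal.ofReal b *
          ∫⁻ y, ENNReal.ofReal (|u x - u y| ^ p) ∂ρ ∂ν) := by
        rw [lintegral_prod _ hm2.aemeasurable,
          lintegral_const_mul _ (by exact hm2.lintegral_prod_right')]
        ring
    _ = ∫⁻ x, ENNReal.ofReal (f x) * (ENNReal.ofReal b *
          ∫⁻ y, ENNReal.ofReal (|u x - u y| ^ p) ∂ρ) :=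
        lν _ (measurable_const.mul (by exact hm2.lintegral_prod_right'))
    _ = _ := by
        congr 1; ext x
        rw [lρ (fun y => ENNReal.ofReal (|u x - u y| ^ p)) (by fun_prop), ← lintegral_const_mul _ (by fun_prop)]
        congr 1; ext y
        ring

lemma part_a (d : ℕ) {V : Type} [Fintype V] (χ : V → EuclideanSpace ℝ (Fin d) → ℝ)
    (hχ : ∀ i, Measurable (χ i)) (h0 : ∀ i x, 0 ≤ χ i x) (h1 : ∀ x, ∑ i, χ i x ≤ 1)
    (k : EuclideanSpace ℝ (Fin d) → ℝ≥0∞) (hk : Measurable k) (κ : V → V → ℝ≥0∞) (s t : ℝ≥0∞)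
    (hκ : ∀ i j x y, χ i x ≠ 0 → χ j y ≠ 0 →
      κ i j ≤ s * k (x - y) + t * (if ‖x - y‖ ≤ 3 then 1 else 0))
    (F : EuclideanSpace ℝ (Fin d) → EuclideanSpace ℝ (Fin d) → ℝ≥0∞)
    (hF : Measurable (Function.uncurry F)) :
    ∑ i, ∑ j, κ i j * ∫⁻ x, ∫⁻ y, ENNReal.ofReal (χ i x) * ENNReal.ofReal (χ j y) * F x y ≤
      s * (∫⁻ x, ∫⁻ y, k (x - y) * F x y) +
        t * ∫⁻ x, ∫⁻ y, (if ‖x - y‖ ≤ 3 then F x y else 0) := by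
  have m0 : ∀ i j, Measurable (Function.uncurry fun x y =>
      ENNReal.ofReal (χ i x) * ENNReal.ofReal (χ j y) * F x y) := fun i j =>
    (((hχ i).comp measurable_fst).ennreal_ofReal.mul
      ((hχ j).comp measurable_snd).ennreal_ofReal).mul hF
  have m1 : Measurable (Function.uncurry fun x y => k (x - y) * F x y) :=
    (hk.comp measurable_sub).mul hF
  have m2 : Measurable (Function.uncurry fun x y => (if ‖x - y‖ ≤ 3 then F x y else 0)) :=
    Measurable.ite (measurableSet_le (by fun_prop) (by fun_prop)) hF measurable_const
  rw [← dmul m1, ← dmul m2, ← dadd (m1.const_mul s)]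
  rw [← dsum2 m0 κ]
  gcongr with x y
  have hs : ∀ x, ∑ i, ENNReal.ofReal (χ i x) ≤ 1 := fun x => by
    rw [← ENNReal.ofReal_sum_of_nonneg fun i _ => h0 i x]
    simpa using h1 x
  calc ∑ i, ∑ j, κ i j * (ENNReal.ofReal (χ i x) * ENNReal.ofReal (χ j y) * F x y)
      ≤ ∑ i, ∑ j, ENNReal.ofReal (χ i x) * (ENNReal.ofReal (χ j y) *
          ((s * k (x - y) + t * (if ‖x - y‖ ≤ 3 then 1 else 0)) * F x y)) := by
        refine Finset.sum_le_sum fun i _ => Finset.sum_le_sum fun j _ => ?_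
        by_cases hi : χ i x = 0
        · simp [hi]
        by_cases hj : χ j y = 0
        · simp [hj]
        calc _ = ENNReal.ofReal (χ i x) * (ENNReal.ofReal (χ j y) * (κ i j * F x y)) := by ring
          _ ≤ _ := by gcongr; exact hκ i j x y hi hj
    _ ≤ (s * k (x - y) + t * (if ‖x - y‖ ≤ 3 then 1 else 0)) * F x y := by
        simp only [← Finset.mul_sum, ← Finset.sum_mul]
        calc _ ≤ 1 * (1 * ((s * k (x - y) + t * (if ‖x - y‖ ≤ 3 then 1 else 0)) * F x y)) := by
              gcongr <;> apply hs
          _ = _ := by simp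
    _ = _ := by
        split_ifs <;> ring

lemma fin_tri {ι : Type} [Fintype ι] (a b c u : ι → ℝ) (ha : ∀ i, 0 ≤ a i) (hb : ∀ i, 0 ≤ b i)
    (hc : ∀ i, 0 ≤ c i)
    (ha1 : ∑ i, a i = 1) (hb1 : ∑ i, b i = 1) (hc1 : ∑ i, c i = 1) (p : ℝ) (hp : 1 ≤ p) :
    ∑ i, ∑ j, a i * b j * |u i - u j| ^ p ≤
      2 ^ p * (∑ i, ∑ j, a i * c j * |u i - u j| ^ p + ∑ i, ∑ j, c i * b j * |u i - u j| ^ p) := by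
  have e1 : ∑ i, ∑ j, a i * b j * |u i - u j| ^ p =
      ∑ i, ∑ j, ∑ k, a i * b j * c k * |u i - u j| ^ p := by
    refine Finset.sum_congr rfl fun i _ => Finset.sum_congr rfl fun j _ => ?_
    rw [← Finset.sum_mul, ← Finset.mul_sum, hc1, mul_one]
  have e2 : ∑ i, ∑ k, a i * c k * |u i - u k| ^ p =
      ∑ i, ∑ j, ∑ k, a i * b j * c k * |u i - u k| ^ p := by
    refine Finset.sum_congr rfl fun i _ => ?_
    rw [Finset.sum_comm]
    refine Finset.sum_congr rfl fun k _ => ?_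
    rw [← Finset.sum_mul, ← Finset.sum_mul, ← Finset.mul_sum, hb1, mul_one]
  have e3 : ∑ k, ∑ j, c k * b j * |u k - u j| ^ p =
      ∑ i, ∑ j, ∑ k, a i * b j * c k * |u k - u j| ^ p := by
    rw [Finset.sum_comm, Finset.sum_comm (f := fun i j => ∑ k, a i * b j * c k * |u k - u j| ^ p)]
    refine Finset.sum_congr rfl fun j _ => ?_
    rw [Finset.sum_comm]
    refine Finset.sum_congr rfl fun k _ => ?_
    rw [← Finset.sum_mul, ← Finset.sum_mul, ← Finset.sum_mul, ha1]; ring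
  rw [e1, e2, e3]
  simp only [← Finset.sum_add_distrib, Finset.mul_sum]
  refine Finset.sum_le_sum fun i _ => Finset.sum_le_sum fun j _ => Finset.sum_le_sum fun k _ => ?_
  have := tri_rpow p hp (u i) (u k) (u j)
  calc a i * b j * c k * |u i - u j| ^ p
      ≤ a i * b j * c k * (2 ^ p * (|u i - u k| ^ p + |u k - u j| ^ p)) := by
        have := mul_nonneg (mul_nonneg (ha i) (hb j)) (hc k)
        gcongr
    _ = _ := by ring

lemma part_b (d : ℕ) {V : Type} [Fintype V] (χ : V → EuclideanSpace ℝ (Fin d) → ℝ)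
    (hχ : ∀ i, Measurable (χ i)) (h0 : ∀ i x, 0 ≤ χ i x) (h1 : ∀ x, ∑ i, χ i x ≤ 1)
    (u : V → ℝ) (p : ℝ) (hp : 1 ≤ p)
    (loc : ∀ x y : EuclideanSpace ℝ (Fin d), ‖x - y‖ ≤ 2 → ∑ i, χ i x ≠ 1 →
      ∀ j, χ j y ≠ 0 → u j = 0)
    (k : EuclideanSpace ℝ (Fin d) → ℝ≥0∞) (hk0 : ∀ z, 2 < ‖z‖ → k z = 0)
    (κ : V → V → ℝ≥0∞) (s t m M : ℝ≥0∞) (η : ℝ) (hη : η ≤ 2)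
    (hκ : ∀ i j x y, χ i x ≠ 0 → χ j y ≠ 0 → k (x - y) ≤ s * κ i j + t)
    (hlow : ∀ i j x y, χ i x ≠ 0 → χ j y ≠ 0 → ‖x - y‖ ≤ η → 1 ≤ m * κ i j)
    (hM : ∀ F : EuclideanSpace ℝ (Fin d) → EuclideanSpace ℝ (Fin d) → ℝ≥0∞,
      Measurable (Function.uncurry F) →
      (∀ x y m, F x y ≤ ENNReal.ofReal (2 ^ p) * (F x m + F m y)) →
      ∫⁻ x, ∫⁻ y, (if ‖x - y‖ ≤ 2 then F x y else 0) ≤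
        M * ∫⁻ x, ∫⁻ y, (if ‖x - y‖ ≤ η then F x y else 0)) :
    ∫⁻ x, ∫⁻ y, k (x - y) * ENNReal.ofReal (|(∑ i, u i * χ i x) - ∑ i, u i * χ i y| ^ p) ≤
      (s + t * (M * m)) * ∑ i, ∑ j, κ i j * (ENNReal.ofReal (|u i - u j| ^ p) *
        ((∫⁻ x, ENNReal.ofReal (χ i x)) * ∫⁻ x, ENNReal.ofReal (χ j x))) := by
  -- extended cells
  let ψ : Option V → EuclideanSpace ℝ (Fin d) → ℝ :=
    fun o x => o.elim (1 - ∑ i, χ i x) (fun i => χ i x)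
  let v : Option V → ℝ := fun o => o.elim 0 u
  have ψ0 : ∀ o x, 0 ≤ ψ o x := by
    rintro (_ | i) x
    · exact sub_nonneg.2 (h1 x)
    · exact h0 i x
  have ψ1 : ∀ x, ∑ o, ψ o x = 1 := fun x => by
    rw [Fintype.sum_option]; simp [ψ]
  have ψm : ∀ o, Measurable (ψ o) := by
    rintro (_ | i)
    · exact measurable_const.sub (Finset.measurable_fun_sum _ fun i _ => hχ i)
    · exact hχ i
  have vψ : ∀ x, ∑ o, v o * ψ o x = ∑ i, u i * χ i x := fun x => by
    rw [Fintype.sum_option]; simp [ψ, v]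
  let F : EuclideanSpace ℝ (Fin d) → EuclideanSpace ℝ (Fin d) → ℝ≥0∞ := fun x y =>
    ENNReal.ofReal (∑ i, ∑ j, ψ i x * ψ j y * |v i - v j| ^ p)
  have Fm : Measurable (Function.uncurry F) := by
    refine Measurable.ennreal_ofReal ?_
    refine Finset.measurable_fun_sum _ fun i _ => Finset.measurable_fun_sum _ fun j _ => ?_
    exact (((ψm i).comp measurable_fst).mul ((ψm j).comp measurable_snd)).mul_const _
  have nn : ∀ x y, 0 ≤ ∑ i, ∑ j, ψ i x * ψ j y * |v i - v j| ^ p := fun x y =>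
    Finset.sum_nonneg fun i _ => Finset.sum_nonneg fun j _ =>
      mul_nonneg (mul_nonneg (ψ0 _ _) (ψ0 _ _)) (Real.rpow_nonneg (abs_nonneg _) _)
  have FA : ∀ x y m, F x y ≤ ENNReal.ofReal (2 ^ p) * (F x m + F m y) := fun x y m => by
    simp only [F]
    rw [← ENNReal.ofReal_add (nn _ _) (nn _ _), ← ENNReal.ofReal_mul (by positivity)]
    exact ENNReal.ofReal_le_ofReal (fin_tri _ _ _ v (fun i => ψ0 i x) (fun i => ψ0 i y)
      (fun i => ψ0 i m) (ψ1 x) (ψ1 y) (ψ1 m) p hp)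
  have Fj : ∀ x y, ENNReal.ofReal (|(∑ i, u i * χ i x) - ∑ i, u i * χ i y| ^ p) ≤ F x y := by
    intro x y
    rw [← vψ x, ← vψ y]
    exact ENNReal.ofReal_le_ofReal (fin_jensen _ _ v (fun i => ψ0 i x) (fun i => ψ0 i y)
      (ψ1 x) (ψ1 y) p hp)
  let w : V → V → EuclideanSpace ℝ (Fin d) → EuclideanSpace ℝ (Fin d) → ℝ≥0∞ := fun i j x y =>
    ENNReal.ofReal (|u i - u j| ^ p) * (ENNReal.ofReal (χ i x) * ENNReal.ofReal (χ j y))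
  have wm : ∀ i j, Measurable (Function.uncurry (w i j)) := fun i j =>
    (((hχ i).comp measurable_fst).ennreal_ofReal.mul
      ((hχ j).comp measurable_snd).ennreal_ofReal).const_mul _
  have hp0 : p ≠ 0 := by linarith
  have Floc : ∀ x y, ‖x - y‖ ≤ 2 → F x y = ∑ i, ∑ j, w i j x y := by
    intro x y hxy
    have z1 : ∀ j, ψ none x * χ j y * |u j| ^ p = 0 := fun j => by
      by_cases hs : ∑ i, χ i x = 1
      · simp [ψ, hs]
      by_cases hj : χ j y = 0
      · simp [hj]
      simp [loc x y hxy hs j hj, Real.zero_rpow hp0]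
    have z2 : ∀ j, χ j x * ψ none y * |u j| ^ p = 0 := fun j => by
      by_cases hs : ∑ i, χ i y = 1
      · simp [ψ, hs]
      by_cases hj : χ j x = 0
      · simp [hj]
      simp [loc y x (by rwa [norm_sub_rev]) hs j hj, Real.zero_rpow hp0]
    have : ∑ i, ∑ j, ψ i x * ψ j y * |v i - v j| ^ p =
        ∑ i, ∑ j, χ i x * χ j y * |u i - u j| ^ p := by
      rw [Fintype.sum_option, Fintype.sum_option]
      simp only [Fintype.sum_option]
      have a1 : v none = 0 := rfl
      have a2 : ∀ i, v (some i) = u i := fun i => rfl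
      have a3 : ∀ i x, ψ (some i) x = χ i x := fun i x => rfl
      simp only [a1, a2, a3, zero_sub, abs_neg, sub_zero, z1, z2, abs_zero, Real.zero_rpow hp0]
      simp
    simp only [F, w, this]
    rw [ENNReal.ofReal_sum_of_nonneg fun i _ => Finset.sum_nonneg fun j _ =>
      mul_nonneg (mul_nonneg (h0 _ _) (h0 _ _)) (Real.rpow_nonneg (abs_nonneg _) _)]
    refine Finset.sum_congr rfl fun i _ => ?_
    rw [ENNReal.ofReal_sum_of_nonneg fun j _ =>
      mul_nonneg (mul_nonneg (h0 _ _) (h0 _ _)) (Real.rpow_nonneg (abs_nonneg _) _)]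
    refine Finset.sum_congr rfl fun j _ => ?_
    rw [ENNReal.ofReal_mul (mul_nonneg (h0 _ _) (h0 _ _)), ENNReal.ofReal_mul (h0 _ _), mul_comm]
  have wz : ∀ i j x y, (χ i x = 0 ∨ χ j y = 0) → w i j x y = 0 := by
    rintro i j x y (h | h) <;> simp [w, h]
  have wint : ∫⁻ x, ∫⁻ y, ∑ i, ∑ j, κ i j * w i j x y =
      ∑ i, ∑ j, κ i j * (ENNReal.ofReal (|u i - u j| ^ p) *
        ((∫⁻ x, ENNReal.ofReal (χ i x)) * ∫⁻ x, ENNReal.ofReal (χ j x))) := by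
    rw [dsum2 wm κ]
    refine Finset.sum_congr rfl fun i _ => Finset.sum_congr rfl fun j _ => ?_
    congr 1
    simp only [w]
    rw [dmul (f := fun x y => ENNReal.ofReal (χ i x) * ENNReal.ofReal (χ j y))
      (((hχ i).comp measurable_fst).ennreal_ofReal.mul
      ((hχ j).comp measurable_snd).ennreal_ofReal)]
    congr 1
    rw [← lintegral_mul_const _ (hχ i).ennreal_ofReal]
    congr 1; ext x
    rw [lintegral_const_mul _ (hχ j).ennreal_ofReal]
  rw [← wint]
  have Km : Measurable (Function.uncurry fun x y => ∑ i, ∑ j, κ i j * w i j x y) :=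
    Finset.measurable_fun_sum (f := fun i => Function.uncurry fun x y => ∑ j, κ i j * w i j x y)
      Finset.univ fun i _ =>
      Finset.measurable_fun_sum (f := fun j => Function.uncurry fun x y => κ i j * w i j x y)
      Finset.univ fun j _ => (wm i j).const_mul (κ i j)
  have Im : Measurable (Function.uncurry fun x y => if ‖x - y‖ ≤ 2 then F x y else 0) :=
    Measurable.ite (measurableSet_le (by fun_prop) (by fun_prop)) Fm measurable_const
  calc _ ≤ ∫⁻ x, ∫⁻ y, (s * (∑ i, ∑ j, κ i j * w i j x y) +
        t * (if ‖x - y‖ ≤ 2 then F x y else 0)) := by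
        gcongr with x y
        by_cases hxy : ‖x - y‖ ≤ 2
        · rw [if_pos hxy]
          calc _ ≤ k (x - y) * F x y := by gcongr; exact Fj x y
            _ = ∑ i, ∑ j, k (x - y) * w i j x y := by
              rw [Floc x y hxy]; simp only [Finset.mul_sum]
            _ ≤ ∑ i, ∑ j, (s * κ i j + t) * w i j x y := by
              refine Finset.sum_le_sum fun i _ => Finset.sum_le_sum fun j _ => ?_
              by_cases hz : χ i x = 0 ∨ χ j y = 0
              · simp [wz i j x y hz]
              push Not at hz
              gcongr
              exact hκ i j x y hz.1 hz.2
            _ = _ := by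
              rw [Floc x y hxy]
              simp only [Finset.mul_sum, ← Finset.sum_add_distrib, add_mul, mul_assoc]
        · rw [hk0 _ (not_le.1 hxy), zero_mul]; exact zero_le
    _ = s * (∫⁻ x, ∫⁻ y, ∑ i, ∑ j, κ i j * w i j x y) +
        t * ∫⁻ x, ∫⁻ y, (if ‖x - y‖ ≤ 2 then F x y else 0) := by
        rw [dadd (f := fun x y => s * (∑ i, ∑ j, κ i j * w i j x y)) (Km.const_mul s),
          dmul Km, dmul Im]
    _ ≤ s * (∫⁻ x, ∫⁻ y, ∑ i, ∑ j, κ i j * w i j x y) +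
        t * (M * ∫⁻ x, ∫⁻ y, (if ‖x - y‖ ≤ η then F x y else 0)) := by
        gcongr
        exact hM F Fm FA
    _ ≤ s * (∫⁻ x, ∫⁻ y, ∑ i, ∑ j, κ i j * w i j x y) +
        t * (M * ∫⁻ x, ∫⁻ y, m * ∑ i, ∑ j, κ i j * w i j x y) := by
        gcongr with x y
        split_ifs with h
        · rw [Floc x y (h.trans hη)]
          simp only [Finset.mul_sum]
          refine Finset.sum_le_sum fun i _ => Finset.sum_le_sum fun j _ => ?_
          by_cases hz : χ i x = 0 ∨ χ j y = 0
          · simp [wz i j x y hz]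
          push Not at hz
          rw [← mul_assoc]
          calc w i j x y = 1 * w i j x y := (one_mul _).symm
            _ ≤ _ := by gcongr; exact hlow i j x y hz.1 hz.2 h
        · exact zero_le
    _ = _ := by
        rw [dmul Km]; ring

/-- The kernel regularity of cell averages is controlled by the kernel regularity of
the function, and the kernel regularity of the cell-function extension is controlled
by the discrete kernel regularity. -/
theorem discrete_regularity_extended (d : ℕ) (hd : 1 ≤ d)
    (φ : EuclideanSpace ℝ (Fin d) → ℝ)
    (hφs : ContDiff ℝ (⊤ : ℕ∞) φ)
    (hφ0 : ∀ x, 0 ≤ φ x) (hφ1 : ∀ x, φ x ≤ 1)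
    (hφrad : ∀ x y : EuclideanSpace ℝ (Fin d), ‖x‖ = ‖y‖ → φ x = φ y)
    (hφone : ∀ x : EuclideanSpace ℝ (Fin d), ‖x‖ ≤ 1 → φ x = 1)
    (hφzero : ∀ x : EuclideanSpace ℝ (Fin d), 2 < ‖x‖ → φ x = 0)
    (p : ℝ) (hp : 1 ≤ p) :
    ∃ C : ℝ, 0 < C ∧
      ∀ (V : Type) [Fintype V]
        (χ : V → EuclideanSpace ℝ (Fin d) → ℝ)
        (π : V → ℝ) (xb : V → EuclideanSpace ℝ (Fin d)) (δx h : ℝ),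
        (∀ i, Measurable (χ i)) →
        (∀ i x, 0 ≤ χ i x) → (∀ i x, χ i x ≤ 1) →
        (∀ i, Bornology.IsBounded (tsupport (χ i))) →
        (∀ i, π i = ∫ x, χ i x) → (∀ i, 0 < π i) →
        (∀ i, xb i = (π i)⁻¹ • ∫ x, χ i x • x) →
        0 < δx → (∀ i, Metric.diam (tsupport (χ i)) ≤ δx) →
        (∀ x, ∑ i, χ i x ≤ 1) →
        0 < h → h < 1 / 2 → δx ≤ h →
        -- (a) cell averages
        ((∀ u : EuclideanSpace ℝ (Fin d) → ℝ, Measurable u →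
          (∀ i, Integrable fun x => |u x| * χ i x) →
          ENNReal.ofReal (∑ i, ∑ j,
              φ (xb i - xb j) / (‖xb i - xb j‖ + h) ^ d *
                |(1 / π i) * (∫ x, u x * χ i x) -
                  (1 / π j) * ∫ x, u x * χ j x| ^ p * π i * π j)
            ≤ ENNReal.ofReal (1 + C * δx / h) *
              ∫⁻ x, ∫⁻ y, ENNReal.ofReal
                (φ (x - y) / (‖x - y‖ + h) ^ d * |u x - u y| ^ p)) ∧
        -- (b) cell-function extension
        (∀ (Ω : Set (EuclideanSpace ℝ (Fin d))) (u : V → ℝ),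
          (∀ x ∈ Ω + Metric.ball (0 : EuclideanSpace ℝ (Fin d)) 4, ∑ i, χ i x = 1) →
          (∀ i, ¬ tsupport (χ i) ⊆ Ω → u i = 0) →
          ∫⁻ x, ∫⁻ y, ENNReal.ofReal
              (φ (x - y) / (‖x - y‖ + h) ^ d *
                |(∑ i, u i * χ i x) - ∑ i, u i * χ i y| ^ p)
            ≤ ENNReal.ofReal (1 + C * δx / h) *
              ENNReal.ofReal (∑ i, ∑ j,
                φ (xb i - xb j) / (‖xb i - xb j‖ + h) ^ d *
                  |u i - u j| ^ p * π i * π j))) := by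
  -- Lipschitz constant
  have hcs : HasCompactSupport φ := by
    refine HasCompactSupport.of_support_subset_isCompact
      (isCompact_closedBall (0 : EuclideanSpace ℝ (Fin d)) 2) fun x hx => ?_
    rw [mem_closedBall_zero_iff]
    by_contra hc
    exact hx (hφzero x (not_le.1 hc))
  obtain ⟨L, hL⟩ := ContDiff.lipschitzWith_of_hasCompactSupport hcs hφs (by simp)
  have hlip : ∀ x y, |φ x - φ y| ≤ (L : ℝ) * ‖x - y‖ := fun x y => by
    have := hL.dist_le_mul x y
    rwa [Real.dist_eq, dist_eq_norm] at this
  obtain ⟨C0, hC0, hker⟩ := kernel_cmp d φ L L.2 hlip hφ0 hφ1 hφone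
  obtain ⟨η, hη0, hη1, hlow⟩ := kernel_low d φ L L.2 hlip hφone
  obtain ⟨Ma, hMa, hMa'⟩ := chain_bound d p 3 1 one_pos
  obtain ⟨Mb, hMb, hMb'⟩ := chain_bound d p 2 η hη0
  set m : ℝ := 2 * 3 ^ d with hm
  have hm0 : 0 < m := by positivity
  refine ⟨C0 * (1 + Ma * m + Mb * m), by positivity, ?_⟩
  intro V _ χ π xb δx h hχ h0 h1 hbd hπ hπ0 hxb hδ hdiam hsum hh0 hh hδh
  have hδ2 : δx < 1 / 2 := lt_of_le_of_lt hδh hh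
  have hp0 : 0 ≤ p := by linarith
  have hI : ∀ i, Integrable (χ i) := fun i => by
    by_contra hc
    have := hπ i
    rw [integral_undef hc] at this
    linarith [hπ0 i]
  have hbar : ∀ i x, χ i x ≠ 0 → ‖x - xb i‖ ≤ δx := fun i x hx => by
    rw [hxb i, hπ i]
    exact bary d (χ i) δx (h0 i) (hbd i) (hI i) (by rw [← hπ i]; exact hπ0 i) (hdiam i) x hx
  have hclose : ∀ i j x y, χ i x ≠ 0 → χ j y ≠ 0 → ‖(x - y) - (xb i - xb j)‖ ≤ 2 * δx := by
    intro i j x y hi hj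
    have e : (x - y) - (xb i - xb j) = (x - xb i) - (y - xb j) := by abel
    rw [e]
    linarith [norm_sub_le (x - xb i) (y - xb j), hbar i x hi, hbar j y hj]
  let K : EuclideanSpace ℝ (Fin d) → ℝ := fun z => φ z / (‖z‖ + h) ^ d
  have K0 : ∀ z, 0 ≤ K z := fun z => div_nonneg (hφ0 z) (by positivity)
  have Kz : ∀ z, 2 < ‖z‖ → K z = 0 := fun z hz => by simp [K, hφzero z hz]
  have Km : Measurable K := hφs.continuous.measurable.div (by fun_prop)
  let k : EuclideanSpace ℝ (Fin d) → ℝ≥0∞ := fun z => ENNReal.ofReal (K z)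
  have km : Measurable k := Km.ennreal_ofReal
  set t : ℝ := C0 * δx / h with ht
  have ht0 : 0 ≤ t := by positivity
  have hst : ∀ z w : EuclideanSpace ℝ (Fin d), ‖z - w‖ ≤ 2 * δx →
      k z ≤ ENNReal.ofReal (1 + t) * k w + ENNReal.ofReal t := by
    intro z w hzw
    simp only [k]
    rw [← ENNReal.ofReal_mul (by positivity),
      ← ENNReal.ofReal_add (mul_nonneg (by positivity) (K0 w)) ht0]
    exact ENNReal.ofReal_le_ofReal (hker δx h z w hδ hδh hh hzw)
  have hlow' : ∀ z : EuclideanSpace ℝ (Fin d), ‖z‖ ≤ 1 + η → 1 ≤ ENNReal.ofReal m * k z := by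
    intro z hz
    simp only [k]
    rw [← ENNReal.ofReal_mul hm0.le, ← ENNReal.ofReal_one]
    exact ENNReal.ofReal_le_ofReal (hlow h z hh0 hh hz)
  have hfin : ∀ M, 0 ≤ M → M ≤ Ma * m + Mb * m →
      1 + t + t * M ≤ 1 + C0 * (1 + Ma * m + Mb * m) * δx / h := by
    intro M hM0 hM
    have e : C0 * (1 + Ma * m + Mb * m) * δx / h = t * (1 + (Ma * m + Mb * m)) := by
      rw [ht]; ring
    rw [e]
    nlinarith [mul_le_mul_of_nonneg_left hM ht0]
  constructor
  · intro u hu hui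
    let F : EuclideanSpace ℝ (Fin d) → EuclideanSpace ℝ (Fin d) → ℝ≥0∞ :=
      fun x y => ENNReal.ofReal (|u x - u y| ^ p)
    have Fm : Measurable (Function.uncurry F) := by
      have : Measurable fun q : EuclideanSpace ℝ (Fin d) × EuclideanSpace ℝ (Fin d) =>
        ENNReal.ofReal (|u q.1 - u q.2| ^ p) := by fun_prop
      exact this
    have FA : ∀ x y m, F x y ≤ ENNReal.ofReal (2 ^ p) * (F x m + F m y) := fun x y m => by
      simp only [F]
      rw [← ENNReal.ofReal_add (by positivity) (by positivity),
        ← ENNReal.ofReal_mul (by positivity)]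
      exact ENNReal.ofReal_le_ofReal (tri_rpow p hp _ _ _)
    have hpa := part_a d χ hχ h0 hsum k km (fun i j => k (xb i - xb j)) (ENNReal.ofReal (1 + t))
      (ENNReal.ofReal t) (by
        intro i j x y hi hj
        have hc := hclose i j x y hi hj
        by_cases h3 : ‖x - y‖ ≤ 3
        · rw [if_pos h3, mul_one]
          exact hst _ _ (by rw [norm_sub_rev]; exact hc)
        · have : 2 < ‖xb i - xb j‖ := by
            have := norm_sub_norm_le (x - y) (xb i - xb j)
            push Not at h3
            linarith
          simp [k, Kz _ this]) F Fm
    have kF : ∀ x y, ENNReal.ofReal (φ (x - y) / (‖x - y‖ + h) ^ d * |u x - u y| ^ p) =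
        k (x - y) * F x y := fun x y => ENNReal.ofReal_mul (K0 _)
    simp only [kF]
    have kFm : Measurable (Function.uncurry fun x y => k (x - y) * F x y) :=
      (km.comp measurable_sub).mul Fm
    have hLHS : ENNReal.ofReal (∑ i, ∑ j,
              φ (xb i - xb j) / (‖xb i - xb j‖ + h) ^ d *
                |(1 / π i) * (∫ x, u x * χ i x) -
                  (1 / π j) * ∫ x, u x * χ j x| ^ p * π i * π j) ≤
        ∑ i, ∑ j, k (xb i - xb j) *
          ∫⁻ x, ∫⁻ y, ENNReal.ofReal (χ i x) * ENNReal.ofReal (χ j y) * F x y := by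
      have nn : ∀ i j, 0 ≤ φ (xb i - xb j) / (‖xb i - xb j‖ + h) ^ d *
                |(1 / π i) * (∫ x, u x * χ i x) -
                  (1 / π j) * ∫ x, u x * χ j x| ^ p * π i * π j := fun i j =>
        mul_nonneg (mul_nonneg (mul_nonneg (K0 _) (Real.rpow_nonneg (abs_nonneg _) _))
          (hπ0 i).le) (hπ0 j).le
      rw [ENNReal.ofReal_sum_of_nonneg fun i _ => Finset.sum_nonneg fun j _ => nn i j]
      refine Finset.sum_le_sum fun i _ => ?_
      rw [ENNReal.ofReal_sum_of_nonneg fun j _ => nn i j]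
      refine Finset.sum_le_sum fun j _ => ?_
      rw [mul_assoc, mul_assoc, ENNReal.ofReal_mul (K0 _)]
      refine mul_le_mul_right ?_ _
      rw [← mul_assoc]
      exact int_jensen d (χ i) (χ j) u (hχ i) (hχ j) hu (h0 i) (h0 j) (π i) (π j) (hπ0 i) (hπ0 j)
        (hπ i) (hπ j) (hui i) (hui j) p hp
    refine hLHS.trans (hpa.trans ?_)
    have hloc : ∫⁻ x, ∫⁻ y, (if ‖x - y‖ ≤ 1 then F x y else 0) ≤
        ENNReal.ofReal m * ∫⁻ x, ∫⁻ y, k (x - y) * F x y := by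
      rw [← dmul kFm]
      gcongr with x y
      split_ifs with hxy
      · rw [← mul_assoc]
        calc F x y = 1 * F x y := (one_mul _).symm
          _ ≤ _ := by gcongr; exact hlow' _ (by linarith)
      · exact zero_le
    calc _ ≤ ENNReal.ofReal (1 + t) * (∫⁻ x, ∫⁻ y, k (x - y) * F x y) +
          ENNReal.ofReal t * (ENNReal.ofReal Ma * (ENNReal.ofReal m *
            ∫⁻ x, ∫⁻ y, k (x - y) * F x y)) := by
          gcongr
          exact (hMa' F Fm FA).trans (by gcongr)
      _ = ENNReal.ofReal (1 + t + t * (Ma * m)) * ∫⁻ x, ∫⁻ y, k (x - y) * F x y := by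
          rw [ENNReal.ofReal_add (p := 1 + t) (by positivity) (by positivity),
            ENNReal.ofReal_mul ht0, ENNReal.ofReal_mul hMa.le]
          ring
      _ ≤ _ := by
          exact mul_le_mul' (ENNReal.ofReal_le_ofReal
            (hfin (Ma * m) (by positivity) (by linarith [mul_pos hMb hm0]))) le_rfl
  · intro Ω u hΩ hu0
    have hpb := part_b d χ hχ h0 hsum u p hp (by
        intro x y hxy hs j hj
        by_contra huj
        have hsub : tsupport (χ j) ⊆ Ω := by
          by_contra hc
          exact huj (hu0 j hc)
        have hy : y ∈ Ω := hsub (subset_tsupport _ hj)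
        refine hs (hΩ x ?_)
        refine ⟨y, hy, x - y, ?_, by simp⟩
        rw [mem_ball_zero_iff]; linarith)
      k (fun z hz => by simp [k, Kz z hz]) (fun i j => k (xb i - xb j))
      (ENNReal.ofReal (1 + t)) (ENNReal.ofReal t) (ENNReal.ofReal m) (ENNReal.ofReal Mb) η
      (by linarith) (fun i j x y hi hj => hst _ _ (hclose i j x y hi hj))
      (fun i j x y hi hj hxy => hlow' _ (by
        have h2 := norm_sub_norm_le (xb i - xb j) (x - y)
        rw [norm_sub_rev (xb i - xb j) (x - y)] at h2
        linarith [hclose i j x y hi hj])) hMb'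
    have kF : ∀ x y, ENNReal.ofReal (φ (x - y) / (‖x - y‖ + h) ^ d *
        |(∑ i, u i * χ i x) - ∑ i, u i * χ i y| ^ p) =
        k (x - y) * ENNReal.ofReal (|(∑ i, u i * χ i x) - ∑ i, u i * χ i y| ^ p) :=
      fun x y => ENNReal.ofReal_mul (K0 _)
    simp only [kF]
    refine hpb.trans ?_
    have hRHS : ENNReal.ofReal (∑ i, ∑ j,
                φ (xb i - xb j) / (‖xb i - xb j‖ + h) ^ d *
                  |u i - u j| ^ p * π i * π j) =
        ∑ i, ∑ j, k (xb i - xb j) * (ENNReal.ofReal (|u i - u j| ^ p) *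
        ((∫⁻ x, ENNReal.ofReal (χ i x)) * ∫⁻ x, ENNReal.ofReal (χ j x))) := by
      have nn : ∀ i j, 0 ≤ φ (xb i - xb j) / (‖xb i - xb j‖ + h) ^ d *
                |u i - u j| ^ p * π i * π j := fun i j =>
        mul_nonneg (mul_nonneg (mul_nonneg (K0 _) (Real.rpow_nonneg (abs_nonneg _) _))
          (hπ0 i).le) (hπ0 j).le
      have hl : ∀ i, ∫⁻ x, ENNReal.ofReal (χ i x) = ENNReal.ofReal (π i) := fun i => by
        rw [hπ i, ofReal_integral_eq_lintegral_ofReal (hI i) (ae_of_all _ (h0 i))]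
      simp only [hl]
      rw [ENNReal.ofReal_sum_of_nonneg fun i _ => Finset.sum_nonneg fun j _ => nn i j]
      refine Finset.sum_congr rfl fun i _ => ?_
      rw [ENNReal.ofReal_sum_of_nonneg fun j _ => nn i j]
      refine Finset.sum_congr rfl fun j _ => ?_
      rw [mul_assoc, mul_assoc, ENNReal.ofReal_mul (K0 _), ENNReal.ofReal_mul (by positivity),
        ENNReal.ofReal_mul (hπ0 i).le]
    rw [hRHS]
    gcongr
    calc _ = ENNReal.ofReal (1 + t + t * (Mb * m)) := by
          rw [ENNReal.ofReal_add (p := 1 + t) (by positivity) (by positivity),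
            ENNReal.ofReal_mul ht0, ENNReal.ofReal_mul hMb.le]
      _ ≤ _ := ENNReal.ofReal_le_ofReal (hfin _ (by positivity) (by linarith [mul_pos hMa hm0]))
end

section
/- There exists a constant C, depending only on d and φ, such that for all x, y, s ∈ ℝ^d and all 0 < h < 1/2 satisfying h ≤ |x−y| and |s| < h/2, the following two estimates hold: |K^h(x−y) − K^h(x−y+s) + ∇K^h(x−y)·s| ≤ C·|s|²/(|x−y|+h)^{d+2}, and |∇K^h(x−y+s) − ∇K^h(x−y)| ≤ C·|s|/(|x−y|+h)^{d+2}. -/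
open MeasureTheory
open scoped InnerProductSpace

lemma ktb_unit {E : Type*} [NormedAddCommGroup E] [InnerProductSpace ℝ E] (u w : E)
    (hu : u ≠ 0) (hw : w ≠ 0) :
    ‖‖u‖⁻¹ • u - ‖w‖⁻¹ • w‖ ≤ 2 * ‖u - w‖ * ‖u‖⁻¹ := by
  have hu' : 0 < ‖u‖ := norm_pos_iff.2 hu
  have hw' : 0 < ‖w‖ := norm_pos_iff.2 hw
  have e : ‖u‖⁻¹ • u - ‖w‖⁻¹ • w = ‖u‖⁻¹ • (u - w) + (‖u‖⁻¹ - ‖w‖⁻¹) • w := by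
    module
  rw [e]
  refine (norm_add_le _ _).trans ?_
  rw [norm_smul, norm_smul, norm_inv, norm_norm]
  have h1 : ‖‖u‖⁻¹ - ‖w‖⁻¹‖ * ‖w‖ = |‖w‖ - ‖u‖| * ‖u‖⁻¹ := by
    have : ‖u‖⁻¹ - ‖w‖⁻¹ = (‖w‖ - ‖u‖) * ‖u‖⁻¹ * ‖w‖⁻¹ := by field_simp
    rw [this, Real.norm_eq_abs, abs_mul, abs_mul, abs_of_pos (inv_pos.2 hu'), abs_of_pos (inv_pos.2 hw')]
    field_simp
  rw [h1]
  have h2 : |‖w‖ - ‖u‖| ≤ ‖u - w‖ := by rw [norm_sub_rev]; exact abs_norm_sub_norm_le _ _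
  have := mul_le_mul_of_nonneg_right h2 (inv_pos.2 hu').le
  linarith

lemma ktb_pow (a b t : ℝ) (ha : 0 < a) (hb : 0 < b) (hba : b ≤ 2 * a) (hab : |a - b| ≤ t * (a * b))
    (ht : 0 ≤ t) (n : ℕ) : |a ^ n - b ^ n| ≤ n * 2 ^ n * t * a ^ (n + 1) := by
  rcases n with _ | n
  · simp
  refine (abs_pow_sub_pow_le a b (n+1)).trans ?_
  have hm : max |a| |b| ≤ 2 * a := by
    rw [abs_of_pos ha, abs_of_pos hb]; exact max_le (by linarith) hba
  have h1 : |a - b| ≤ t * (a * (2 * a)) := hab.trans (by gcongr)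
  calc _ ≤ (t * (a * (2 * a))) * (n + 1 : ℕ) * (2 * a) ^ (n + 1 - 1) := by gcongr
    _ = _ := by simp only [Nat.add_sub_cancel]; ring

noncomputable def ktbG {E : Type*} [NormedAddCommGroup E] [InnerProductSpace ℝ E] [CompleteSpace E]
    (d : ℕ) (φ : E → ℝ) (h : ℝ) (z : E) : E :=
  ((‖z‖ + h)⁻¹ ^ d) • gradient φ z - (d * φ z * (‖z‖ + h)⁻¹ ^ (d + 1)) • (‖z‖⁻¹ • z)

lemma ktb_norm {E : Type*} [NormedAddCommGroup E] [InnerProductSpace ℝ E] [CompleteSpace E]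
    (z : E) (hz : z ≠ 0) : HasGradientAt (fun z : E => ‖z‖) (‖z‖⁻¹ • z) z := by
  have h1 := ((hasStrictFDerivAt_norm_sq z).hasFDerivAt).sqrt (by simpa using hz)
  have e : (fun z : E => ‖z‖) = fun z => √(‖z‖ ^ 2) := by ext; simp
  rw [hasGradientAt_iff_hasFDerivAt, e]
  refine h1.congr_fderiv ?_
  ext v
  have : ‖z‖ ≠ 0 := norm_ne_zero_iff.2 hz
  simp [inner_smul_left]
  field_simp

lemma ktb_grad {E : Type*} [NormedAddCommGroup E] [InnerProductSpace ℝ E] [CompleteSpace E]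
    (d : ℕ) (φ : E → ℝ) (h : ℝ) (z : E) (hh : 0 < h) (hz : z ≠ 0) (hφ : DifferentiableAt ℝ φ z) :
    HasGradientAt (fun z => φ z / (‖z‖ + h) ^ d) (ktbG d φ h z) z := by
  have hR : 0 < ‖z‖ + h := by positivity
  have h1 := hφ.hasGradientAt.hasFDerivAt
  have h2 := (ktb_norm z hz).hasFDerivAt
  have h3 : HasDerivAt (fun r : ℝ => ((r + h) ^ d)⁻¹) (-(d * (‖z‖ + h)⁻¹ ^ (d+1))) ‖z‖ := by
    have := ((((hasDerivAt_id ‖z‖).add_const h).pow d).inv (pow_ne_zero _ hR.ne'))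
    refine this.congr_deriv ?_
    rcases d with _ | d
    · simp
    · simp; field_simp; ring
  have h4 := h1.mul (h3.comp_hasFDerivAt z h2)
  rw [hasGradientAt_iff_hasFDerivAt]
  have e : (fun z => φ z / (‖z‖ + h) ^ d) = (φ * (fun r => ((r + h) ^ d)⁻¹) ∘ norm) := by
    ext w; simp [div_eq_mul_inv]
  rw [e]
  refine h4.congr_fderiv ?_
  ext v
  simp [ktbG, inner_smul_left, inner_sub_left]
  ring

lemma ktb_main {E : Type*} [NormedAddCommGroup E] [InnerProductSpace ℝ E] [CompleteSpace E]
    (d : ℕ) (φ : E → ℝ) (L M : ℝ) (hL0 : 0 ≤ L) (hM0 : 0 ≤ M)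
    (hφ0 : ∀ x, 0 ≤ φ x) (hφ1 : ∀ x, φ x ≤ 1)
    (hφzero : ∀ x : E, 2 < ‖x‖ → φ x = 0)
    (hL : ∀ u w, ‖gradient φ u - gradient φ w‖ ≤ L * ‖u - w‖)
    (hM : ∀ u, ‖gradient φ u‖ ≤ M)
    (hM' : ∀ u w, |φ u - φ w| ≤ M * ‖u - w‖)
    (u w : E) (h : ℝ) (h0 : 0 < h) (h1 : h < 1 / 2) (hu : h ≤ ‖u‖) (hs : ‖u - w‖ < h / 2) :
    ‖ktbG d φ h u - ktbG d φ h w‖ ≤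
      (16 * L + 4 * M * d * 2 ^ d + d * (4 * M + (d + 1) * 2 ^ (d + 1) + 4 * 2 ^ (d + 1)) + 1)
        * ‖u - w‖ * (‖u‖ + h)⁻¹ ^ (d + 2) := by
  have hn : |‖u‖ - ‖w‖| ≤ ‖u - w‖ := abs_norm_sub_norm_le _ _
  have hn' := abs_le.1 hn
  have hu0 : 0 < ‖u‖ := by linarith
  have hw0 : 0 < ‖w‖ := by linarith
  have hun : u ≠ 0 := norm_pos_iff.1 hu0
  have hwn : w ≠ 0 := norm_pos_iff.1 hw0
  by_cases h3 : 3 < ‖u‖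
  · have g0 : ∀ v : E, 2 < ‖v‖ → ktbG d φ h v = 0 := by
      intro v hv
      have e : φ =ᶠ[nhds v] fun _ => 0 := by
        filter_upwards [(isOpen_lt continuous_const continuous_norm).mem_nhds hv] with x hx
        exact hφzero x hx
      have : gradient φ v = 0 := by
        unfold gradient; rw [e.fderiv_eq]; simp
      simp [ktbG, this, hφzero v hv]
    rw [g0 u (by linarith), g0 w (by linarith)]
    simp only [sub_zero, norm_zero]
    positivity
  push Not at h3
  set t := ‖u - w‖ with ht
  have ht0 : 0 ≤ t := norm_nonneg _
  obtain ⟨a, ha⟩ : ∃ a, a = (‖u‖ + h)⁻¹ := ⟨_, rfl⟩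
  obtain ⟨b, hb⟩ : ∃ b, b = (‖w‖ + h)⁻¹ := ⟨_, rfl⟩
  have hR : 0 < ‖u‖ + h := by linarith
  have hR' : 0 < ‖w‖ + h := by linarith
  have ha0 : 0 < a := by rw [ha]; positivity
  have hb0 : 0 < b := by rw [hb]; positivity
  have hba : b ≤ 2 * a := by
    rw [ha, hb, ← div_eq_mul_inv, inv_eq_one_div, div_le_div_iff₀ hR' hR]; linarith
  have hab : |a - b| ≤ t * (a * b) := by
    have : a - b = -(‖u‖ - ‖w‖) * (a * b) := by rw [ha, hb]; field_simp; ring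
    rw [this, abs_mul, abs_neg, abs_of_pos (mul_pos ha0 hb0)]
    gcongr
  have h4a : 1 ≤ 4 * a := by
    rw [ha, ← div_eq_mul_inv, le_div_iff₀ hR]; linarith
  have hua : ‖u‖⁻¹ ≤ 2 * a := by
    rw [ha, ← div_eq_mul_inv, inv_eq_one_div, div_le_div_iff₀ hu0 hR]; linarith
  have p1 := ktb_pow a b t ha0 hb0 hba hab ht0 d
  have p2 := ktb_pow a b t ha0 hb0 hba hab ht0 (d + 1)
  have un : ‖‖u‖⁻¹ • u - ‖w‖⁻¹ • w‖ ≤ 4 * t * a := by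
    refine (ktb_unit u w hun hwn).trans ?_
    calc 2 * ‖u - w‖ * ‖u‖⁻¹ ≤ 2 * t * (2 * a) := by rw [← ht]; gcongr
      _ = _ := by ring
  have eu : ‖‖u‖⁻¹ • u‖ = 1 := by
    rw [norm_smul, norm_inv, norm_norm]; field_simp
  have hbp : b ^ (d + 1) ≤ 2 ^ (d + 1) * a ^ (d + 1) := by
    rw [← mul_pow]; gcongr
  have key : ktbG d φ h u - ktbG d φ h w =
      a ^ d • (gradient φ u - gradient φ w) + (a ^ d - b ^ d) • gradient φ w
      - ((d * (φ u - φ w) * a ^ (d + 1)) • (‖u‖⁻¹ • u)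
        + (d * φ w * (a ^ (d + 1) - b ^ (d + 1))) • (‖u‖⁻¹ • u)
        + (d * φ w * b ^ (d + 1)) • (‖u‖⁻¹ • u - ‖w‖⁻¹ • w)) := by
    simp only [ktbG, ← ha, ← hb]; module
  have t1 : ‖a ^ d • (gradient φ u - gradient φ w)‖ ≤ 16 * L * t * a ^ (d + 2) := by
    rw [norm_smul, Real.norm_of_nonneg (by positivity)]
    calc a ^ d * ‖gradient φ u - gradient φ w‖ ≤ a ^ d * (L * t) * 1 ^ 2 := by
          rw [one_pow, mul_one]; gcongr; exact hL u w
      _ ≤ a ^ d * (L * t) * (4 * a) ^ 2 := by gcongr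
      _ = _ := by ring
  have t2 : ‖(a ^ d - b ^ d) • gradient φ w‖ ≤ 4 * M * d * 2 ^ d * t * a ^ (d + 2) := by
    rw [norm_smul, Real.norm_eq_abs]
    calc |a ^ d - b ^ d| * ‖gradient φ w‖ ≤ (d * 2 ^ d * t * a ^ (d + 1)) * M * 1 := by
          rw [mul_one]; gcongr; exact hM w
      _ ≤ (d * 2 ^ d * t * a ^ (d + 1)) * M * (4 * a) := by gcongr
      _ = _ := by ring
  have t3 : ‖(d * (φ u - φ w) * a ^ (d + 1)) • (‖u‖⁻¹ • u)‖ ≤ d * (4 * M) * t * a ^ (d + 2) := by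
    rw [norm_smul, eu, Real.norm_eq_abs, abs_mul, abs_mul, abs_of_nonneg (Nat.cast_nonneg d),
      abs_of_pos (pow_pos ha0 _)]
    calc d * |φ u - φ w| * a ^ (d + 1) * 1 ≤ d * (M * t) * a ^ (d + 1) * (4 * a) := by
          gcongr; exact hM' u w
      _ = _ := by ring
  have t4 : ‖(d * φ w * (a ^ (d + 1) - b ^ (d + 1))) • (‖u‖⁻¹ • u)‖
      ≤ d * ((d + 1) * 2 ^ (d + 1)) * t * a ^ (d + 2) := by
    rw [norm_smul, eu, Real.norm_eq_abs, abs_mul, abs_mul, abs_of_nonneg (Nat.cast_nonneg d),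
      abs_of_nonneg (hφ0 w)]
    calc d * φ w * |a ^ (d + 1) - b ^ (d + 1)| * 1
        ≤ d * 1 * (((d + 1 : ℕ) : ℝ) * 2 ^ (d + 1) * t * a ^ (d + 1 + 1)) * 1 := by
          gcongr; exact hφ1 w
      _ = _ := by push_cast; ring
  have t5 : ‖(d * φ w * b ^ (d + 1)) • (‖u‖⁻¹ • u - ‖w‖⁻¹ • w)‖
      ≤ d * (4 * 2 ^ (d + 1)) * t * a ^ (d + 2) := by
    rw [norm_smul, Real.norm_of_nonneg (by have := hφ0 w; positivity)]
    calc d * φ w * b ^ (d + 1) * ‖‖u‖⁻¹ • u - ‖w‖⁻¹ • w‖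
        ≤ d * 1 * (2 ^ (d + 1) * a ^ (d + 1)) * (4 * t * a) := by
          gcongr; exact hφ1 w
      _ = _ := by ring
  rw [key, ← ha]
  refine (norm_sub_le _ _).trans ?_
  have n1 := norm_add_le (a ^ d • (gradient φ u - gradient φ w)) ((a ^ d - b ^ d) • gradient φ w)
  have n2 := norm_add₃_le (a := (d * (φ u - φ w) * a ^ (d + 1)) • (‖u‖⁻¹ • u))
    (b := (d * φ w * (a ^ (d + 1) - b ^ (d + 1))) • (‖u‖⁻¹ • u))
    (c := (d * φ w * b ^ (d + 1)) • (‖u‖⁻¹ • u - ‖w‖⁻¹ • w))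
  have n3 : 0 ≤ t * a ^ (d + 2) := by positivity
  linarith

/-- Second-order Taylor-type bounds for the kernel `K^h(x) = φ(x)/(|x|+h)^d`
and its gradient. -/
theorem kernel_taylor_bounds (d : ℕ) (hd : 1 ≤ d)
    (φ : EuclideanSpace ℝ (Fin d) → ℝ)
    (hφs : ContDiff ℝ (⊤ : ℕ∞) φ)
    (hφ0 : ∀ x, 0 ≤ φ x) (hφ1 : ∀ x, φ x ≤ 1)
    (hφrad : ∀ x y : EuclideanSpace ℝ (Fin d), ‖x‖ = ‖y‖ → φ x = φ y)
    (hφone : ∀ x : EuclideanSpace ℝ (Fin d), ‖x‖ ≤ 1 → φ x = 1)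
    (hφzero : ∀ x : EuclideanSpace ℝ (Fin d), 2 < ‖x‖ → φ x = 0) :
    ∃ C : ℝ, 0 < C ∧ ∀ (x y s : EuclideanSpace ℝ (Fin d)) (h : ℝ),
      0 < h → h < 1 / 2 → h ≤ ‖x - y‖ → ‖s‖ < h / 2 →
      (|φ (x - y) / (‖x - y‖ + h) ^ d - φ (x - y + s) / (‖x - y + s‖ + h) ^ d
          + ⟪gradient (fun z => φ z / (‖z‖ + h) ^ d) (x - y), s⟫_ℝ|
        ≤ C * ‖s‖ ^ 2 / (‖x - y‖ + h) ^ (d + 2)) ∧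
      (‖gradient (fun z => φ z / (‖z‖ + h) ^ d) (x - y + s)
          - gradient (fun z => φ z / (‖z‖ + h) ^ d) (x - y)‖
        ≤ C * ‖s‖ / (‖x - y‖ + h) ^ (d + 2)) := by
  have hcs : HasCompactSupport φ := by
    refine HasCompactSupport.intro (isCompact_closedBall 0 2) ?_
    intro x hx
    exact hφzero x (by simpa using hx)
  have hdiff : Differentiable ℝ φ := hφs.differentiable (by simp)
  obtain ⟨M, hM⟩ := hφs.lipschitzWith_of_hasCompactSupport hcs (by simp)
  have hφs' : ContDiff ℝ 1 (fderiv ℝ φ) := hφs.fderiv_right (by norm_cast)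
  obtain ⟨L, hL⟩ := hφs'.lipschitzWith_of_hasCompactSupport (hcs.fderiv ℝ) (by simp)
  have hLb : ∀ u w, ‖gradient φ u - gradient φ w‖ ≤ (L : ℝ) * ‖u - w‖ := by
    intro u w
    unfold gradient
    rw [← map_sub, LinearIsometryEquiv.norm_map]
    exact hL.norm_sub_le u w
  have hMb : ∀ u, ‖gradient φ u‖ ≤ (M : ℝ) := by
    intro u
    unfold gradient
    rw [LinearIsometryEquiv.norm_map]
    exact norm_fderiv_le_of_lipschitz ℝ hM
  have hM' : ∀ u w, |φ u - φ w| ≤ (M : ℝ) * ‖u - w‖ := fun u w => hM.norm_sub_le u w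
  have main := ktb_main d φ L M L.2 M.2 hφ0 hφ1 hφzero hLb hMb hM'
  obtain ⟨C, hC⟩ : ∃ C : ℝ, C = (16 * (L : ℝ) + 4 * M * d * 2 ^ d
    + d * (4 * M + (d + 1) * 2 ^ (d + 1) + 4 * 2 ^ (d + 1)) + 1) := ⟨_, rfl⟩
  rw [← hC] at main
  have hC0 : 0 < C := by rw [hC]; positivity
  refine ⟨C, hC0, ?_⟩
  intro x y s h h0 h1 hu hs
  generalize x - y = u at *
  have hR : 0 < ‖u‖ + h := by linarith
  have ne : ∀ v : EuclideanSpace ℝ (Fin d), ‖u - v‖ < h / 2 → v ≠ 0 := by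
    rintro v hv rfl
    rw [sub_zero] at hv
    linarith
  have hG : ∀ v : EuclideanSpace ℝ (Fin d), ‖u - v‖ < h / 2 →
      HasGradientAt (fun z => φ z / (‖z‖ + h) ^ d) (ktbG d φ h v) v :=
    fun v hv => ktb_grad d φ h v h0 (ne v hv) (hdiff v)
  have hu0 : ‖u - u‖ < h / 2 := by simp; linarith
  have hus : ‖u - (u + s)‖ = ‖s‖ := by simp
  rw [(hG u hu0).gradient, (hG (u + s) (by rw [hus]; exact hs)).gradient]
  constructor
  · have seg : ∀ v ∈ segment ℝ u (u + s), ‖u - v‖ ≤ ‖s‖ := by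
      intro v hv
      have := norm_sub_le_of_mem_segment hv
      rw [norm_sub_rev]
      simpa using this
    have mv := (convex_segment u (u + s)).norm_image_sub_le_of_norm_hasFDerivWithin_le'
      (f := fun z => φ z / (‖z‖ + h) ^ d) (φ := InnerProductSpace.toDual ℝ _ (ktbG d φ h u))
      (C := C * ‖s‖ * (‖u‖ + h)⁻¹ ^ (d + 2))
      (fun v hv => ((hG v ((seg v hv).trans_lt hs)).hasFDerivAt).hasFDerivWithinAt)
      (fun v hv => by
        rw [← map_sub, LinearIsometryEquiv.norm_map, norm_sub_rev]
        refine (main u v h h0 h1 hu ((seg v hv).trans_lt hs)).trans ?_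
        have := seg v hv
        gcongr)
      (left_mem_segment ℝ _ _) (right_mem_segment ℝ _ _)
    simp only [add_sub_cancel_left, InnerProductSpace.toDual_apply_apply, Real.norm_eq_abs] at mv
    rw [← abs_neg]
    refine le_trans (le_of_eq ?_) (mv.trans (le_of_eq ?_))
    · congr 1; ring
    · rw [inv_pow]; field_simp
  · rw [norm_sub_rev]
    have := main u (u + s) h h0 h1 hu (by rw [hus]; exact hs)
    rw [hus, inv_pow, ← div_eq_mul_inv] at this
    exact this
end

section
/- Let V be a finite set, π : V → (0,∞), a : V×V → [0,∞), and let K : V×V → [0,∞) be symmetric (K_{i,j} = K_{j,i} for all i,j). Let u : V → ℝ and R : V → ℝ, and define D_i := (1/π_i)·Σ_{i'∈V}(a_{i',i} − a_{i,i'}) for each i ∈ V. Then 2·Σ_{i,j∈V} K_{i,j}·sgn(u_i − u_j)·[ (1/π_i)·Σ_{i'∈V}(a_{i,i'}·u_{i'} − a_{i',i}·u_i) + R_i ]·π_i·π_j ≤ A_K + D_K + R_K, where A_K := 2·Σ_{i,j∈V} Σ_{i'∈V} (K_{i',j} − K_{i,j})·a_{i',i}·|u_i − u_j|·π_j, D_K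 := −2·Σ_{i,j∈V} K_{i,j}·sgn(u_i − u_j)·D_i·u_j·π_i·π_j, and R_K := 2·Σ_{i,j∈V} K_{i,j}·sgn(u_i − u_j)·R_i·π_i·π_j. -/
/-- Kruzkov doubling-of-variables inequality for the semi-discrete upwind scheme. -/
theorem kruzkov_doubling_upwind {V : Type*} [Fintype V]
    (π : V → ℝ) (hπ : ∀ i, 0 < π i)
    (a : V → V → ℝ) (ha : ∀ i j, 0 ≤ a i j)
    (K : V → V → ℝ) (hK0 : ∀ i j, 0 ≤ K i j) (hKsymm : ∀ i j, K i j = K j i)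
    (u R : V → ℝ)
    (D : V → ℝ) (hD : ∀ i, D i = (1 / π i) * ∑ i', (a i' i - a i i')) :
    2 * ∑ i, ∑ j, K i j * Real.sign (u i - u j) *
        ((1 / π i) * (∑ i', (a i i' * u i' - a i' i * u i)) + R i) * π i * π j
      ≤ (2 * ∑ i, ∑ j, ∑ i', (K i' j - K i j) * a i' i * |u i - u j| * π j)
        + (-2 * ∑ i, ∑ j, K i j * Real.sign (u i - u j) * (D i * u j) * π i * π j)
        + (2 * ∑ i, ∑ j, K i j * Real.sign (u i - u j) * R i * π i * π j) := by
  have key : ∀ i j, K i j * Real.sign (u i - u j) *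
        ((1 / π i) * (∑ i', (a i i' * u i' - a i' i * u i)) + R i) * π i * π j
      ≤ ∑ i', (K i j * a i i' * |u i' - u j| * π j - K i j * a i' i * |u i - u j| * π j)
        + (-(K i j * Real.sign (u i - u j) * (D i * u j) * π i * π j))
        + K i j * Real.sign (u i - u j) * R i * π i * π j := by
    intro i j
    have hne : π i ≠ 0 := (hπ i).ne'
    have e1 : K i j * Real.sign (u i - u j) *
        ((1 / π i) * (∑ i', (a i i' * u i' - a i' i * u i)) + R i) * π i * π j
        = ∑ i', K i j * Real.sign (u i - u j) * π j * (a i i' * u i' - a i' i * u i)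
          + K i j * Real.sign (u i - u j) * R i * π i * π j := by
      rw [← Finset.mul_sum]
      field_simp
    have e2 : -(K i j * Real.sign (u i - u j) * (D i * u j) * π i * π j)
        = ∑ i', -(K i j * Real.sign (u i - u j) * π j * u j) * (a i' i - a i i') := by
      rw [← Finset.mul_sum, hD]
      field_simp
    rw [e1, e2, ← Finset.sum_add_distrib]
    refine add_le_add (Finset.sum_le_sum fun i' _ => ?_) le_rfl
    have h1 : Real.sign (u i - u j) * (u i - u j) = |u i - u j| := by
      rcases lt_trichotomy (u i - u j) 0 with h | h | h
      · rw [Real.sign_of_neg h, abs_of_neg h]; ring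
      · rw [h]; simp
      · rw [Real.sign_of_pos h, abs_of_pos h]; ring
    have h2 : Real.sign (u i - u j) * (u i' - u j) ≤ |u i' - u j| := by
      rcases Real.sign_apply_eq (u i - u j) with h | h | h <;> rw [h]
      · rw [neg_one_mul]; exact neg_le_abs _
      · simp
      · rw [one_mul]; exact le_abs_self _
    have hc : 0 ≤ K i j * a i i' * π j :=
      mul_nonneg (mul_nonneg (hK0 i j) (ha i i')) (hπ j).le
    have h3 := mul_le_mul_of_nonneg_left h2 hc
    rw [← h1]
    linarith
  have swap : ∑ i, ∑ j, ∑ i', (K i' j - K i j) * a i' i * |u i - u j| * π j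
      = ∑ i, ∑ j, ∑ i',
        (K i j * a i i' * |u i' - u j| * π j - K i j * a i' i * |u i - u j| * π j) := by
    simp only [sub_mul, Finset.sum_sub_distrib]
    congr 1
    rw [Finset.sum_comm]
    conv_rhs => rw [Finset.sum_comm]
    exact Finset.sum_congr rfl fun j _ => Finset.sum_comm
  have tot := Finset.sum_le_sum fun i (_ : i ∈ Finset.univ) =>
    Finset.sum_le_sum fun j (_ : j ∈ Finset.univ) => key i j
  rw [swap]
  simp only [Finset.sum_add_distrib, Finset.sum_neg_distrib] at tot ⊢
  linarith
end

section
/- There exists a function C₁ : ℕ → ℝ such that for every integer n ≥ 1 the following holds. Let M ∈ M(n), let C₀ > 0, and let v ∈ ℝ^n satisfy, for every subset I' ⊆ {1,…,n}: |Σ_{j∈I'} v_j| ≤ C₀·Σ_{j∈I', i∈{1,…,n}∖I'} (|M_{ij}| + |M_{ji}|). Then there exists x ∈ ℝ^n with Mx = v and max_{1≤i≤n} |x_i| ≤ C₀·C₁(n). -/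
/-- `M(n)`: discrete diffusion operators, i.e. real `n × n` matrices with nonpositive
off-diagonal entries and vanishing row and column sums. -/
def IsDiffusionMatrix {n : ℕ} (M : Matrix (Fin n) (Fin n) ℝ) : Prop :=
  (∀ i j, i ≠ j → M i j ≤ 0) ∧ (∀ i, ∑ l, M i l = 0) ∧ (∀ i, ∑ l, M l i = 0)

/-- No gap of length `2 C₀` above a nonnegative level below the maximum, for the
regularized equation `M x + ε x = v`. -/
lemma gap_aux {n : ℕ} (M : Matrix (Fin n) (Fin n) ℝ) (hM : IsDiffusionMatrix M)
    (C₀ : ℝ) (v : Fin n → ℝ)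
    (hv : ∀ I' : Finset (Fin n),
          |∑ j ∈ I', v j| ≤ C₀ * ∑ j ∈ I', ∑ i ∈ I'ᶜ, (|M i j| + |M j i|))
    (ε : ℝ) (hε : 0 < ε) (x : Fin n → ℝ) (hx : ∀ i, M.mulVec x i + ε * x i = v i)
    (a : ℝ) (hC : 0 < C₀) (ha : 0 ≤ a) (i₀ : Fin n) (hi₀ : a + 2 * C₀ < x i₀) :
    ∃ j, a < x j ∧ x j ≤ a + 2 * C₀ := by
  by_contra! hgap
  obtain ⟨hoff, hrow, hcol⟩ := hM
  set I : Finset (Fin n) := Finset.univ.filter (fun j => a + 2 * C₀ < x j) with hI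
  have memI : ∀ j, j ∈ I ↔ a + 2 * C₀ < x j := by intro j; simp [hI]
  have hnI : ∀ j, j ∈ Iᶜ → x j ≤ a := by
    intro j hj
    rw [Finset.mem_compl, memI] at hj
    by_contra! h
    exact hj (hgap j h)
  have hne : ∀ i ∈ Iᶜ, ∀ j ∈ I, i ≠ j := by
    intro i hi j hj h
    subst h
    exact (Finset.mem_compl.1 hi) hj
  set A : ℝ := ∑ j ∈ I, ∑ i ∈ I, M i j with hA
  have hcolI : ∀ j, ∑ i ∈ I, M i j = - ∑ i ∈ Iᶜ, M i j := by
    intro j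
    have := Finset.sum_add_sum_compl I (fun i => M i j)
    rw [hcol j] at this
    linarith
  have hrowI : ∀ j, ∑ i ∈ I, M j i = - ∑ i ∈ Iᶜ, M j i := by
    intro j
    have := Finset.sum_add_sum_compl I (fun i => M j i)
    rw [hrow j] at this
    linarith
  have hW : ∑ j ∈ I, ∑ i ∈ Iᶜ, (|M i j| + |M j i|) = 2 * A := by
    have h1 : ∑ j ∈ I, ∑ i ∈ Iᶜ, |M i j| = A := by
      apply Finset.sum_congr rfl
      intro j hj
      rw [hcolI j, ← Finset.sum_neg_distrib]
      exact Finset.sum_congr rfl fun i hi => abs_of_nonpos (hoff i j (hne i hi j hj))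
    have h2 : ∑ j ∈ I, ∑ i ∈ Iᶜ, |M j i| = A := by
      rw [hA, Finset.sum_comm (s := I) (t := I)]
      apply Finset.sum_congr rfl
      intro j hj
      rw [hrowI j, ← Finset.sum_neg_distrib]
      exact Finset.sum_congr rfl fun i hi => abs_of_nonpos (hoff j i (hne i hi j hj).symm)
    simp only [Finset.sum_add_distrib]
    rw [h1, h2]; ring
  have hB : ∑ j ∈ Iᶜ, ∑ i ∈ I, M i j = -A := by
    have h := Finset.sum_add_sum_compl I (fun j => ∑ i ∈ I, M i j)
    have h0 : ∑ j, ∑ i ∈ I, M i j = 0 := by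
      rw [Finset.sum_comm]
      exact Finset.sum_eq_zero fun i _ => hrow i
    rw [h0] at h
    linarith
  have hsum : ∑ i ∈ I, v i = ∑ j, (∑ i ∈ I, M i j) * x j + ε * ∑ i ∈ I, x i := by
    rw [Finset.mul_sum]
    simp only [Finset.sum_mul]
    rw [Finset.sum_comm, ← Finset.sum_add_distrib]
    exact Finset.sum_congr rfl fun i _ => (hx i).symm
  have hpos : 0 < ∑ i ∈ I, x i := by
    apply Finset.sum_pos
    · intro i hi
      have := (memI i).1 hi
      linarith
    · exact ⟨i₀, (memI i₀).2 hi₀⟩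
  have hlow : 2 * C₀ * A ≤ ∑ j, (∑ i ∈ I, M i j) * x j := by
    rw [← Finset.sum_add_sum_compl I]
    have h1 : (a + 2 * C₀) * A ≤ ∑ j ∈ I, (∑ i ∈ I, M i j) * x j := by
      rw [hA, Finset.mul_sum]
      apply Finset.sum_le_sum
      intro j hj
      rw [mul_comm]
      apply mul_le_mul_of_nonneg_left ((memI j).1 hj).le
      rw [hcolI j, neg_nonneg]
      exact Finset.sum_nonpos fun i hi => hoff i j (hne i hi j hj)
    have h2 : a * (-A) ≤ ∑ j ∈ Iᶜ, (∑ i ∈ I, M i j) * x j := by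
      rw [← hB, Finset.mul_sum]
      apply Finset.sum_le_sum
      intro j hj
      rw [mul_comm]
      apply mul_le_mul_of_nonpos_left (hnI j hj)
      exact Finset.sum_nonpos fun i hi => hoff i j (hne j hj i hi).symm
    linarith
  have h1 := (le_abs_self _).trans (hv I)
  rw [hW, hsum] at h1
  have := mul_pos hε hpos
  linarith

lemma upper_aux {n : ℕ} (M : Matrix (Fin n) (Fin n) ℝ) (hM : IsDiffusionMatrix M)
    (C₀ : ℝ) (v : Fin n → ℝ)
    (hv : ∀ I' : Finset (Fin n),
          |∑ j ∈ I', v j| ≤ C₀ * ∑ j ∈ I', ∑ i ∈ I'ᶜ, (|M i j| + |M j i|))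
    (ε : ℝ) (hε : 0 < ε) (x : Fin n → ℝ) (hx : ∀ i, M.mulVec x i + ε * x i = v i)
    (hC : 0 < C₀) (i₀ : Fin n) : x i₀ ≤ C₀ * (2 * n) := by
  by_contra! hlt
  have key : ∀ k : Fin (n + 1), ∃ j, (k : ℝ) * (2 * C₀) < x j ∧
      ((k : ℕ) < n → x j ≤ ((k : ℝ) + 1) * (2 * C₀)) := by
    intro k
    by_cases hk : (k : ℕ) < n
    · have hk' : ((k : ℕ) : ℝ) + 1 ≤ n := by exact_mod_cast hk
      obtain ⟨j, h1, h2⟩ := gap_aux M hM C₀ v hv ε hε x hx ((k : ℝ) * (2 * C₀)) hC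
        (by positivity) i₀ (by nlinarith)
      exact ⟨j, h1, fun _ => by linarith⟩
    · have : (k : ℕ) = n := by omega
      refine ⟨i₀, ?_, fun h => absurd h hk⟩
      rw [this]; linarith
  choose f hf1 hf2 using key
  obtain ⟨k, l, hkl, hfe⟩ := Fintype.exists_ne_map_eq_of_card_lt f (by simp)
  have main : ∀ k l : Fin (n + 1), k < l → f k ≠ f l := by
    intro k l h he
    have hkl : (k : ℕ) < l := h
    have h1 := hf2 k (by omega)
    have h2 := hf1 l
    rw [he] at h1
    have h3 : ((k : ℕ) : ℝ) + 1 ≤ (l : ℕ) := by exact_mod_cast hkl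
    nlinarith
  rcases lt_or_gt_of_ne hkl with h | h
  · exact main k l h hfe
  · exact main l k h hfe.symm

lemma solve_aux {n : ℕ} (M : Matrix (Fin n) (Fin n) ℝ) (hM : IsDiffusionMatrix M)
    (v : Fin n → ℝ) (ε : ℝ) (hε : 0 < ε) :
    ∃ x : Fin n → ℝ, ∀ i, M.mulVec x i + ε * x i = v i := by
  have hdet : (M + ε • (1 : Matrix (Fin n) (Fin n) ℝ)).det ≠ 0 := by
    apply det_ne_zero_of_sum_row_lt_diag
    intro k
    obtain ⟨hoff, hrow, -⟩ := hM
    have h1 : ∑ j ∈ Finset.univ.erase k, ‖(M + ε • (1 : Matrix (Fin n) (Fin n) ℝ)) k j‖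
        = M k k := by
      have h2 := Finset.add_sum_erase Finset.univ (fun j => M k j) (Finset.mem_univ k)
      rw [hrow k] at h2
      have h3 : M k k = - ∑ j ∈ Finset.univ.erase k, M k j := by
        linarith
      rw [h3, ← Finset.sum_neg_distrib]
      apply Finset.sum_congr rfl
      intro j hj
      have hjk : k ≠ j := (Finset.ne_of_mem_erase hj).symm
      simp [Matrix.one_apply_ne hjk, abs_of_nonpos (hoff k j hjk)]
    rw [h1]
    have : (M + ε • (1 : Matrix (Fin n) (Fin n) ℝ)) k k = M k k + ε := by simp
    rw [this]
    exact lt_of_lt_of_le (by linarith) (le_abs_self _)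
  refine ⟨(M + ε • (1 : Matrix (Fin n) (Fin n) ℝ))⁻¹.mulVec v, fun i => ?_⟩
  have h : (M + ε • (1 : Matrix (Fin n) (Fin n) ℝ)).mulVec
      ((M + ε • (1 : Matrix (Fin n) (Fin n) ℝ))⁻¹.mulVec v) = v := by
    rw [Matrix.mulVec_mulVec, Matrix.mul_nonsing_inv _ (isUnit_iff_ne_zero.2 hdet),
      Matrix.one_mulVec]
  generalize (M + ε • (1 : Matrix (Fin n) (Fin n) ℝ))⁻¹.mulVec v = y at h ⊢
  rw [← h, Matrix.add_mulVec, Matrix.smul_mulVec, Matrix.one_mulVec]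
  simp

/-- Uniform boundedness theorem for discrete diffusion operators. -/
theorem diffusion_uniform_boundedness :
    ∃ C₁ : ℕ → ℝ, ∀ n : ℕ, 1 ≤ n →
      ∀ M : Matrix (Fin n) (Fin n) ℝ, IsDiffusionMatrix M →
      ∀ C₀ : ℝ, 0 < C₀ →
      ∀ v : Fin n → ℝ,
        (∀ I' : Finset (Fin n),
          |∑ j ∈ I', v j| ≤ C₀ * ∑ j ∈ I', ∑ i ∈ I'ᶜ, (|M i j| + |M j i|)) →
        ∃ x : Fin n → ℝ, M.mulVec x = v ∧ ∀ i, |x i| ≤ C₀ * C₁ n := by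
  refine ⟨fun n => 2 * n, ?_⟩
  intro n _ M hM C₀ hC v hv
  have hpos : ∀ k : ℕ, (0 : ℝ) < 1 / ((k : ℝ) + 1) := fun k => by positivity
  choose y hy using fun k : ℕ => solve_aux M hM v (1 / ((k : ℝ) + 1)) (hpos k)
  have hb : ∀ k i, |y k i| ≤ C₀ * (2 * n) := by
    intro k i
    rw [abs_le']
    refine ⟨upper_aux M hM C₀ v hv _ (hpos k) (y k) (hy k) hC i, ?_⟩
    refine upper_aux M hM C₀ (-v) (fun I' => ?_) _ (hpos k) (-(y k)) (fun i => ?_) hC i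
    · simpa [Finset.sum_neg_distrib, abs_neg] using hv I'
    · rw [Matrix.mulVec_neg]
      have := hy k i
      simp only [Pi.neg_apply]
      linarith
  have hmem : ∀ k, y k ∈ Metric.closedBall (0 : Fin n → ℝ) (C₀ * (2 * n)) := by
    intro k
    rw [mem_closedBall_zero_iff, pi_norm_le_iff_of_nonneg (by positivity)]
    exact hb k
  obtain ⟨x, hxb, φ, hφ, hlim⟩ :=
    (isCompact_closedBall (0 : Fin n → ℝ) (C₀ * (2 * n))).tendsto_subseq hmem
  refine ⟨x, ?_, ?_⟩
  · have hcont : Continuous fun p : ℝ × (Fin n → ℝ) => M.mulVec p.2 + p.1 • p.2 := by fun_prop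
    have hε : Filter.Tendsto (fun k => 1 / (((φ k : ℕ) : ℝ) + 1)) Filter.atTop (nhds 0) :=
      (tendsto_one_div_add_atTop_nhds_zero_nat (𝕜 := ℝ)).comp hφ.tendsto_atTop
    have h1 := (hcont.tendsto ((0 : ℝ), x)).comp (hε.prodMk_nhds hlim)
    have h2 : ((fun p : ℝ × (Fin n → ℝ) => M.mulVec p.2 + p.1 • p.2) ∘
        fun k => (1 / (((φ k : ℕ) : ℝ) + 1), (y ∘ φ) k)) = fun _ => v := by
      funext k i
      exact hy (φ k) i
    rw [h2] at h1
    have := tendsto_nhds_unique h1 tendsto_const_nhds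
    simpa using this
  · rw [mem_closedBall_zero_iff, pi_norm_le_iff_of_nonneg (by positivity)] at hxb
    exact hxb
end
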